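/- Let n ≥ 2 and let E = E(r_1,…,r_n) ⊂ ℝ^{2n} be an open ellipsoid with half axes 0 < r_1 ≤ … ≤ r_n, at least two of which are different. Then the boundary ∂E has an open neighborhood U ⊂ ℝ^{2n} such that s(U) < e(U). -/

import Mathlib

open Metric Set MeasureTheory Real Filter Topology Bornology
open scoped ContDiff ENNReal

noncomputable section

/-- `ℝ^{2n}` with the Euclidean structure. -/
abbrev R2n (n : ℕ) := EuclideanSpace ℝ (Fin (2 * n))

/-- The standard symplectic form `ω_st = Σ dx_i ∧ dy_i` on `ℝ^{2n}`,
evaluated on a pair of (tangent) vectors. -/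
def sympForm (n : ℕ) (v w : R2n n) : ℝ :=
  ∑ i : Fin n,
    (v ⟨2 * i.1, by have := i.isLt; omega⟩ * w ⟨2 * i.1 + 1, by have := i.isLt; omega⟩ -
      v ⟨2 * i.1 + 1, by have := i.isLt; omega⟩ * w ⟨2 * i.1, by have := i.isLt; omega⟩)

/-- `φ` is a symplectic embedding of the open set `N ⊆ ℝ^{2n}` into `U ⊆ ℝ^{2n}`:
a smooth injective map on `N` with image in `U` whose derivative preserves `ω_st`. -/
def IsSympEmbOn (n : ℕ) (N U : Set (R2n n)) (φ : R2n n → R2n n) : Prop :=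
  IsOpen N ∧ ContDiffOn ℝ ∞ φ N ∧ InjOn φ N ∧ MapsTo φ N U ∧
    ∀ p ∈ N, ∀ v w : R2n n,
      sympForm n (fderiv ℝ φ p v) (fderiv ℝ φ p w) = sympForm n v w

/-- A symplectic embedding of (a neighbourhood of) an arbitrary set `A ⊆ ℝ^{2n}` into `U`. -/
def SympEmbNbhd (n : ℕ) (A U : Set (R2n n)) : Prop :=
  ∃ N φ, A ⊆ N ∧ IsSympEmbOn n N U φ

/-- The spherical capacity `s(U)`. -/
def sphericalCap (n : ℕ) (U : Set (R2n n)) : ℝ≥0∞ :=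
  sSup {c : ℝ≥0∞ | ∃ r : ℝ, 0 < r ∧ c = ENNReal.ofReal (π * r ^ 2) ∧
    SympEmbNbhd n (sphere (0 : R2n n) r) U}

/-- The quadratic form defining the ellipsoid with symplectic half axes `a i`. -/
def ellQ (n : ℕ) (a : Fin n → ℝ) (z : R2n n) : ℝ :=
  ∑ i : Fin n,
    ((z ⟨2 * i.1, by have := i.isLt; omega⟩) ^ 2 +
      (z ⟨2 * i.1 + 1, by have := i.isLt; omega⟩) ^ 2) / (a i) ^ 2

/-- The open ellipsoid `E(a 0, …, a (n-1)) ⊆ ℝ^{2n}`. -/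
def ellipsoid (n : ℕ) (a : Fin n → ℝ) : Set (R2n n) := {z | ellQ n a z < 1}

/-- The boundary `∂E(a 0, …, a (n-1)) ⊆ ℝ^{2n}` of an ellipsoid. -/
def ellipsoidBdry (n : ℕ) (a : Fin n → ℝ) : Set (R2n n) := {z | ellQ n a z = 1}

/-- The ellipsoidal shell `U_ε = (1+ε)E \ closure((1-ε)E)`. -/
def ellShell (n : ℕ) (a : Fin n → ℝ) (ε : ℝ) : Set (R2n n) :=
  ellipsoid n (fun i => (1 + ε) * a i) \ closure (ellipsoid n (fun i => (1 - ε) * a i))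

/-- The `δ`-shell capacity `c_δ(U)`, defined via embeddings of the closed
shells `r A_δ = closure(B_r) \ B_{r(1-δ)}`. -/
def shellCap (n : ℕ) (δ : ℝ) (U : Set (R2n n)) : ℝ≥0∞ :=
  sSup {c : ℝ≥0∞ | ∃ r : ℝ, 0 < r ∧ c = ENNReal.ofReal (π * r ^ 2) ∧
    SympEmbNbhd n (closedBall (0 : R2n n) r \ ball 0 (r * (1 - δ))) U}

/-- The ellipsoidal capacity `e(U)`: the supremum of `π r₁²` over symplectic embeddings of
boundaries of ellipsoids with half axes `r₁ ≤ … ≤ r_n` (here `r₁ = ⨅ i, a i`). -/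
def ellipsoidalCap (n : ℕ) (U : Set (R2n n)) : ℝ≥0∞ :=
  sSup {c : ℝ≥0∞ | ∃ a : Fin n → ℝ, (∀ i, 0 < a i) ∧ Monotone a ∧
    c = ENNReal.ofReal (π * (⨅ i, a i) ^ 2) ∧ SympEmbNbhd n (ellipsoidBdry n a) U}

/-- The Gromov radius `c_B(U)`. -/
def gromovRadius (n : ℕ) (U : Set (R2n n)) : ℝ≥0∞ :=
  sSup {c : ℝ≥0∞ | ∃ r : ℝ, 0 < r ∧ c = ENNReal.ofReal (π * r ^ 2) ∧
    ∃ φ, IsSympEmbOn n (ball (0 : R2n n) r) U φ}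


section Brouwer

variable {F : Type*} [NormedAddCommGroup F] [InnerProductSpace ℝ F] [FiniteDimensional ℝ F]

/-- Lagrange interpolation expresses `det (1 + A)` through `det (1 + t • A)` for finitely many
prescribed values of `t`, with weights that do not depend on `A`. -/
theorem exists_weights_det_one_add (s : Finset ℝ) (hs : Module.finrank ℝ F < s.card) :
    ∃ w : ℝ → ℝ, ∑ t ∈ s, w t = 1 ∧
      ∀ A : F →L[ℝ] F, (1 + A).det = ∑ t ∈ s, w t * (1 + t • A).det := by
  classical
  have hinj : Set.InjOn (id : ℝ → ℝ) s := Function.injective_id.injOn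
  have hne : s.Nonempty := Finset.card_pos.mp (by omega)
  refine ⟨fun t => (Lagrange.basis s id t).eval 1, ?_, fun A => ?_⟩
  · have h := congrArg (Polynomial.eval (1 : ℝ)) (Lagrange.sum_basis hinj hne)
    rwa [Polynomial.eval_finsetSum, Polynomial.eval_one] at h
  · let b := Module.finBasis ℝ F
    let M := LinearMap.toMatrix b b (A : F →ₗ[ℝ] F)
    let P : Polynomial ℝ := ((Polynomial.X : Polynomial ℝ) • M.map Polynomial.C +
      (1 : Matrix (Fin (Module.finrank ℝ F)) (Fin (Module.finrank ℝ F)) ℝ).map Polynomial.C).det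
    have hev : ∀ t : ℝ, P.eval t = (1 + t • A).det := by
      intro t
      have h1 : (1 + t • A).det = (1 + t • M).det := by
        rw [ContinuousLinearMap.det, ← LinearMap.det_toMatrix b]
        congr 1
        simp [M, LinearMap.toMatrix_one]
      rw [h1]
      simp only [P]
      rw [← Polynomial.coe_evalRingHom t, RingHom.map_det]
      congr 1
      ext i j
      by_cases hij : i = j <;> (simp [hij, add_comm]; ring)
    have hdeg : P.degree < s.card := by
      refine lt_of_le_of_lt Polynomial.degree_le_natDegree ?_
      have := Polynomial.natDegree_det_X_add_C_le M 1
      rw [Fintype.card_fin] at this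
      exact_mod_cast lt_of_le_of_lt this hs
    have hP := congrArg (Polynomial.eval 1) (Lagrange.eq_interpolate hinj hdeg)
    rw [Lagrange.interpolate_apply, Polynomial.eval_finsetSum] at hP
    have h1 := hev 1
    rw [one_smul] at h1
    rw [← h1, hP]
    refine Finset.sum_congr rfl fun t _ => ?_
    rw [Polynomial.eval_mul, Polynomial.eval_C, id, hev, mul_comm]

theorem exists_zero_of_contDiff_of_eq_id {G : F → F} (hG : ContDiff ℝ 1 G) {ρ : ℝ} (hρ : 0 < ρ)
    (hid : ∀ x, ρ ≤ ‖x‖ → G x = x) : ∃ x, G x = 0 := by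
  by_contra! hne
  let _ : MeasurableSpace F := borel F
  have _ : BorelSpace F := ⟨rfl⟩
  let r : F → F := fun x => ρ • (‖G x‖⁻¹ • G x)
  have hr : ContDiff ℝ 1 r :=
    contDiff_const.smul (((hG.norm ℝ hne).inv fun x => norm_ne_zero_iff.mpr (hne x)).smul hG)
  have hrn : ∀ x, ‖r x‖ = ρ := fun x => by
    simp [r, norm_smul, abs_of_pos hρ, inv_mul_cancel₀ (norm_ne_zero_iff.mpr (hne x))]
  have hrid : ∀ x, ‖x‖ = ρ → r x = x := fun x hx => by
    simp only [r]; rw [hid x hx.ge, hx, smul_smul, mul_inv_cancel₀ hρ.ne', one_smul]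
  let u : F → F := fun x => r x - x
  have hu : ContDiff ℝ 1 u := hr.sub contDiff_id
  let K : Set F := closedBall 0 ρ
  obtain ⟨L, hL⟩ : ∃ L, LipschitzOnWith L u K :=
    hu.locallyLipschitz.locallyLipschitzOn.exists_lipschitzOnWith_of_compact
      (isCompact_closedBall _ _)
  let v : F → F := K.indicator u
  have hvK : ∀ x ∈ K, v x = u x := fun x hx => Set.indicator_of_mem hx _
  have hvn : ∀ x ∉ K, v x = 0 := fun x hx => Set.indicator_of_notMem hx _
  have hcross : ∀ x ∈ K, ∀ y ∉ K, ‖v x - v y‖ ≤ L * ‖x - y‖ := by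
    intro x hx y hy
    have hx' : ‖x‖ ≤ ρ := by simpa [K] using hx
    have hy' : ρ ≤ ‖y‖ := by
      have : ¬ ‖y‖ ≤ ρ := by simpa [K] using hy
      linarith
    obtain ⟨t, ht, hzt⟩ : ρ ∈ (fun t : ℝ => ‖x + t • (y - x)‖) '' Icc 0 1 := by
      apply intermediate_value_Icc zero_le_one (by fun_prop)
      simp [hx', hy']
    set z := x + t • (y - x)
    have hz : ‖z‖ = ρ := hzt
    have hzK : z ∈ K := by simp [K, hz]
    have huz : u z = 0 := by simp [u, hrid z hz]
    rw [hvn y hy, hvK x hx, sub_zero, ← sub_zero (u x), ← huz]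
    refine (hL.norm_sub_le hx hzK).trans ?_
    gcongr
    have : x - z = t • (x - y) := by simp only [z]; module
    rw [this, norm_smul, Real.norm_eq_abs, abs_of_nonneg ht.1]
    exact mul_le_of_le_one_left (norm_nonneg _) ht.2
  have hv : ∀ x y, ‖v x - v y‖ ≤ L * ‖x - y‖ := by
    intro x y
    by_cases hx : x ∈ K <;> by_cases hy : y ∈ K
    · rw [hvK x hx, hvK y hy]; exact hL.norm_sub_le hx hy
    · exact hcross x hx y hy
    · rw [norm_sub_rev, norm_sub_rev x]; exact hcross y hy x hx
    · rw [hvn x hx, hvn y hy]; simp; positivity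
  let B : Set F := ball 0 ρ
  have hBK : B ⊆ K := ball_subset_closedBall
  have hvB : ∀ x ∈ B, HasFDerivAt v (fderiv ℝ u x) x := fun x hx =>
    ((hu.differentiable one_ne_zero) x).hasFDerivAt.congr_of_eventuallyEq
      (Filter.eventually_of_mem (isOpen_ball.mem_nhds hx) fun y hy => hvK y (hBK hy))
  have hbd : ∀ x ∈ B, ‖fderiv ℝ u x‖ ≤ L := fun x hx =>
    norm_fderiv_le_of_lip' ℝ (C := L) L.2 (f := u) (x₀ := x)
      (Filter.eventually_of_mem (isOpen_ball.mem_nhds hx) fun y hy => hL.norm_sub_le (hBK hy) (hBK hx))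
  obtain ⟨δ, hδ, hdet⟩ : ∃ δ > 0, ∀ A : F →L[ℝ] F, ‖A‖ < δ → 0 < (1 + A).det := by
    have hc : ContinuousAt (fun A : F →L[ℝ] F => (1 + A).det) 0 :=
      (ContinuousLinearMap.continuous_det.comp (continuous_const.add continuous_id)).continuousAt
    have h0 : (0 : ℝ) < (1 + (0 : F →L[ℝ] F)).det := by
      rw [add_zero]; simp [ContinuousLinearMap.det]
    obtain ⟨δ, hδ, h⟩ := Metric.eventually_nhds_iff.mp (hc.eventually (lt_mem_nhds h0))
    exact ⟨δ, hδ, fun A hA => h (by simpa using hA)⟩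
  have hvol : ∀ t : ℝ, 0 < t → t * (L + 1) < min δ 1 →
      IntegrableOn (fun x => (1 + t • fderiv ℝ u x).det) B ∧
        ∫ x in B, (1 + t • fderiv ℝ u x).det = volume.real B := by
    intro t ht htδ
    let f : F → F := fun x => x + t • v x
    have htL : t * L < 1 := by nlinarith [min_le_right δ 1]
    have hf1 : ∀ x y, ‖f x - f y - (x - y)‖ ≤ t * L * ‖x - y‖ := by
      intro x y
      have : f x - f y - (x - y) = t • (v x - v y) := by simp only [f]; module
      rw [this, norm_smul, Real.norm_eq_abs, abs_of_pos ht, mul_assoc]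
      gcongr
      exact hv x y
    have hinj : Function.Injective f := by
      intro x y hxy
      have h1 := hf1 x y
      rw [hxy, sub_self, zero_sub, norm_neg] at h1
      by_contra hne'
      have : 0 < ‖x - y‖ := norm_pos_iff.mpr (sub_ne_zero.mpr hne')
      nlinarith
    have happ : ApproximatesLinearOn f ((ContinuousLinearEquiv.refl ℝ F : F ≃L[ℝ] F) : F →L[ℝ] F)
        univ (t.toNNReal * L) := by
      intro x _ y _
      simpa [ht.le] using hf1 x y
    have hsurj : Function.Surjective f := by
      refine happ.surjective ?_
      rcases subsingleton_or_nontrivial F with h | h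
      · exact Or.inl h
      · right
        rw [← NNReal.coe_lt_coe]
        simpa [ht.le] using htL
    have hfK : ∀ x, x ∉ B → f x = x := by
      intro x hx
      by_cases hxK : x ∈ K
      · have hxρ : ‖x‖ = ρ := by
          have h1 : ‖x‖ ≤ ρ := by simpa [K] using hxK
          have h2 : ¬ ‖x‖ < ρ := by simpa [B] using hx
          linarith
        simp [f, hvK x hxK, u, hrid x hxρ]
      · simp [f, hvn x hxK]
    have himg : f '' B = B := by
      ext y
      constructor
      · rintro ⟨x, hx, rfl⟩
        by_contra hy
        have := hinj (hfK _ hy)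
        rw [this] at hy
        exact hy hx
      · intro hy
        obtain ⟨x, rfl⟩ := hsurj y
        refine ⟨x, ?_, rfl⟩
        by_contra hx
        rw [hfK x hx] at hy
        exact hx hy
    have hder : ∀ x ∈ B, HasFDerivWithinAt f (1 + t • fderiv ℝ u x) B x := fun x hx =>
      ((hasFDerivAt_id x).add ((hvB x hx).const_smul t)).hasFDerivWithinAt
    have hpos : ∀ x ∈ B, 0 < (1 + t • fderiv ℝ u x).det := by
      intro x hx
      refine hdet _ ?_
      rw [norm_smul, Real.norm_eq_abs, abs_of_pos ht]
      have := hbd x hx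
      nlinarith [min_le_left δ 1, norm_nonneg (fderiv ℝ u x)]
    have hch := integral_image_eq_integral_abs_det_fderiv_smul volume
      (measurableSet_ball : MeasurableSet B) hder hinj.injOn (fun _ => (1 : ℝ))
    rw [himg] at hch
    refine ⟨?_, ?_⟩
    · have hcont : Continuous fun x => (1 + t • fderiv ℝ u x).det :=
        ContinuousLinearMap.continuous_det.comp
          (continuous_const.add ((hu.continuous_fderiv one_ne_zero).const_smul t))
      exact (hcont.continuousOn.integrableOn_compact (isCompact_closedBall 0 ρ)).mono_set hBK
    · rw [setIntegral_congr_fun measurableSet_ball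
        (g := fun x => |(1 + t • fderiv ℝ u x).det| • (1 : ℝ))
        (fun x hx => by
        beta_reduce
        rw [smul_eq_mul, mul_one, abs_of_pos (hpos x hx)]), ← hch]
      simp
  have hdet0 : ∀ x ∈ B, (1 + fderiv ℝ u x).det = 0 := by
    intro x hx
    have h1 : 1 + fderiv ℝ u x = fderiv ℝ r x := by
      have : fderiv ℝ u x = fderiv ℝ r x - 1 := by
        exact ((hr.differentiable one_ne_zero x).hasFDerivAt.sub (hasFDerivAt_id x)).fderiv
      rw [this]; abel
    rw [h1]
    by_contra hd
    have hsur : Function.Surjective (fderiv ℝ r x) := by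
      exact (LinearMap.equivOfDetNeZero (fderiv ℝ r x : F →ₗ[ℝ] F) hd).surjective
    obtain ⟨w, hw⟩ := hsur (r x)
    have hconst : (fun y => inner ℝ (r y) (r y)) = fun _ => ρ ^ 2 := by
      funext y; rw [real_inner_self_eq_norm_sq, hrn]
    have hd' := ((hr.differentiable one_ne_zero x).hasFDerivAt.inner ℝ
      (hr.differentiable one_ne_zero x).hasFDerivAt)
    rw [hconst] at hd'
    have h3 := congrArg (fun T => T w) (hd'.unique (hasFDerivAt_const (ρ ^ 2) x))
    simp [hw, hrn] at h3
    exact hρ.ne' h3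
  obtain ⟨s, hscard, hs⟩ : ∃ s : Finset ℝ, s.card = Module.finrank ℝ F + 1 ∧
      ∀ t ∈ s, 0 < t ∧ t * (L + 1) < min δ 1 := by
    have hm : 0 < min δ 1 / (L + 1) := by positivity
    obtain ⟨s, hs, hc⟩ := (Set.Ioo_infinite hm).exists_subset_card_eq (Module.finrank ℝ F + 1)
    refine ⟨s, hc, fun t ht => ?_⟩
    have := hs ht
    exact ⟨this.1, (lt_div_iff₀ (by positivity)).mp this.2⟩
  obtain ⟨w, hw1, hw⟩ := exists_weights_det_one_add (F := F) s (by omega)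
  have h0 : ∫ x in B, (1 + fderiv ℝ u x).det = 0 := by
    rw [setIntegral_congr_fun (g := fun _ => (0 : ℝ)) measurableSet_ball hdet0]; simp
  have h1 : ∫ x in B, (1 + fderiv ℝ u x).det = volume.real B := by
    rw [integral_congr_ae (.of_forall fun x => hw (fderiv ℝ u x))]
    rw [integral_finsetSum _ fun t ht => ((hvol t (hs t ht).1 (hs t ht).2).1.const_mul _)]
    simp_rw [integral_const_mul]
    rw [Finset.sum_congr rfl fun t ht => by rw [(hvol t (hs t ht).1 (hs t ht).2).2],
      ← Finset.sum_mul, hw1, one_mul]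
  have hvp : 0 < volume.real B :=
    ENNReal.toReal_pos (measure_ball_pos volume 0 hρ).ne' measure_ball_lt_top.ne
  linarith

/-- A continuous self-map which is the identity outside a ball has a zero. -/
theorem exists_zero_of_continuous_of_eq_id {G : F → F} (hG : Continuous G) {ρ : ℝ} (hρ : 0 < ρ)
    (hid : ∀ x, ρ ≤ ‖x‖ → G x = x) : ∃ x, G x = 0 := by
  by_contra! hne
  obtain ⟨c, hc, hcG⟩ : ∃ c > 0, ∀ x, c ≤ ‖G x‖ := by
    obtain ⟨x₀, -, hx₀⟩ := (isCompact_closedBall (0 : F) ρ).exists_isMinOn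
      ⟨0, by simp [hρ.le]⟩ hG.norm.continuousOn
    refine ⟨min ‖G x₀‖ ρ, lt_min (norm_pos_iff.mpr (hne _)) hρ, fun x => ?_⟩
    rcases le_total ‖x‖ ρ with h | h
    · exact (min_le_left _ _).trans (hx₀ (by simpa using h))
    · rw [hid x h]; exact (min_le_right _ _).trans h
  have hvc : HasCompactSupport fun x => G x - x :=
    HasCompactSupport.intro (isCompact_closedBall 0 ρ) fun x hx => by
      rw [hid x (by simpa using (not_le.mp fun h => hx (by simpa using h)).le), sub_self]
  obtain ⟨g, hg, hgv⟩ := ((hG.sub continuous_id).uniformContinuous_of_tendsto_cocompact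
    hvc.is_zero_at_infty).exists_contDiff_dist_le (half_pos hc)
  let χ : ContDiffBump (0 : F) := ⟨ρ, ρ + 1, hρ, by linarith⟩
  obtain ⟨x, hx⟩ := exists_zero_of_contDiff_of_eq_id (G := fun x => x + χ x • g x) (ρ := ρ + 1)
    (contDiff_id.add (χ.contDiff.smul (hg.of_le (by exact_mod_cast le_top)))) (by linarith)
    (fun x hx => by
      rw [χ.zero_of_le_dist (by simpa using hx)]; simp)
  have key : ‖G x - (x + χ x • g x)‖ < c := by
    have h2 : ‖g x - (G x - x)‖ < c / 2 := by simpa [dist_eq_norm, norm_sub_rev] using hgv x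
    rcases le_total ‖x‖ ρ with h | h
    · rw [χ.one_of_mem_closedBall (by simpa using h), one_smul]
      have : G x - (x + g x) = -(g x - (G x - x)) := by abel
      rw [this, norm_neg]; linarith
    · rw [hid x h] at h2 ⊢
      have : x - (x + χ x • g x) = -(χ x • (g x - (x - x))) := by simp
      rw [this, norm_neg, norm_smul, Real.norm_eq_abs, abs_of_nonneg χ.nonneg]
      nlinarith [norm_nonneg (g x - (x - x)), χ.le_one (x := x), χ.nonneg (x := x)]
  rw [hx, sub_zero] at key
  exact absurd (hcG x) (not_le.mpr key)

end Brouwer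

section Minimax

variable {W : Type*} [NormedAddCommGroup W] [InnerProductSpace ℝ W] [FiniteDimensional ℝ W]

/-- A finite-dimensional linking theorem: `g` plays the role of the gradient of `f`. -/
theorem exists_critical_of_linking {f : W → ℝ} {g : W → W} (hf : Continuous f)
    (hg : Continuous g) {K : ℝ} (hK : 0 < K)
    (hfg : ∀ x h, f (x + h) ≤ f x + inner ℝ (g x) h + K * ‖h‖ ^ 2)
    {A B : ℝ} (hA : 0 < A) (hPS : ∀ x, ‖x‖ ≤ A * ‖g x‖ + B)
    (S : Submodule ℝ W) {e : W} (heS : e ∈ Sᗮ) (he : ‖e‖ = 1)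
    {p : W → ℝ} (hp : Continuous p) (hpe : ∀ s : ℝ, 0 ≤ s → p (s • e) = s)
    {α β C R : ℝ} (hα : 0 < α) (hβ : 0 < β)
    (h1 : ∀ y ∈ Sᗮ, p y = α → β ≤ f y)
    (h2 : ∀ x ∈ S, f x ≤ 0)
    (h3 : ∀ x ∈ S, ∀ s : ℝ, 0 ≤ s → f (x + s • e) ≤ C)
    (h4 : ∀ x ∈ S, ∀ s : ℝ, 0 ≤ s → R ≤ ‖x + s • e‖ → f (x + s • e) ≤ 0) :
    ∃ x, g x = 0 ∧ β / 2 ≤ f x ∧ f x ≤ C := by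
  by_contra! hno
  obtain ⟨δ, hδ, hδg⟩ : ∃ δ > 0, ∀ x, β / 2 ≤ f x → f x ≤ C → δ ≤ ‖g x‖ := by
    let T : Set W := closedBall 0 (A + B) ∩ {x | β / 2 ≤ f x ∧ f x ≤ C}
    have hT : IsCompact T := (isCompact_closedBall _ _).inter_right
      ((isClosed_le continuous_const hf).inter (isClosed_le hf continuous_const))
    have hout : ∀ x, x ∉ closedBall (0 : W) (A + B) → 1 ≤ ‖g x‖ := by
      intro x hx
      have : A + B < ‖x‖ := by simpa using hx
      have := hPS x
      by_contra hlt
      nlinarith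
    rcases T.eq_empty_or_nonempty with hTe | hTn
    · refine ⟨1, one_pos, fun x hx1 hx2 => hout x fun hx => ?_⟩
      exact (hTe ▸ (⟨hx, hx1, hx2⟩ : x ∈ T) : x ∈ (∅ : Set W))
    · obtain ⟨x₀, hx₀, hmin⟩ := hT.exists_isMinOn hTn hg.norm.continuousOn
      have hpos : 0 < ‖g x₀‖ := norm_pos_iff.mpr fun h =>
        absurd (hno x₀ h hx₀.2.1) (not_lt.mpr hx₀.2.2)
      refine ⟨min 1 ‖g x₀‖, lt_min one_pos hpos, fun x hx1 hx2 => ?_⟩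
      by_cases hx : x ∈ closedBall (0 : W) (A + B)
      · exact (min_le_right _ _).trans (hmin ⟨hx, hx1, hx2⟩)
      · exact (min_le_left _ _).trans (hout x hx)
  let τ : ℝ := 1 / (2 * K)
  have hτ : 0 < τ := by positivity
  let χ : ℝ → ℝ := fun t => max 0 (min 1 ((t - β / 2) * (4 / β)))
  have hχc : Continuous χ := by fun_prop
  have hχ0 : ∀ t, 0 ≤ χ t := fun t => le_max_left _ _
  have hχ1 : ∀ t, χ t ≤ 1 := fun t => max_le zero_le_one (min_le_left _ _)
  have hχlow : ∀ t, t ≤ β / 2 → χ t = 0 := fun t ht => by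
    refine max_eq_left ((min_le_right _ _).trans ?_)
    exact mul_nonpos_of_nonpos_of_nonneg (by linarith) (by positivity)
  have hχhigh : ∀ t, 3 * β / 4 ≤ t → χ t = 1 := fun t ht => by
    have : 1 ≤ (t - β / 2) * (4 / β) := by
      rw [mul_div_assoc', le_div_iff₀ hβ]; linarith
    simp [χ, min_eq_left this]
  let ψ : W → W := fun x => x - (τ * χ (f x)) • g x
  have hψ : Continuous ψ := by fun_prop
  have hψf : ∀ x, f (ψ x) ≤ f x - τ / 2 * χ (f x) * ‖g x‖ ^ 2 := by
    intro x
    have h := hfg x (-((τ * χ (f x)) • g x))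
    rw [← sub_eq_add_neg, inner_neg_right, inner_smul_right, real_inner_self_eq_norm_sq, norm_neg,
      norm_smul, mul_pow, Real.norm_eq_abs, sq_abs] at h
    have hKτ : K * τ = 1 / 2 := by simp only [τ]; field_simp
    have h5 : K * ((τ * χ (f x)) ^ 2 * ‖g x‖ ^ 2) = τ / 2 * (χ (f x) * χ (f x)) * ‖g x‖ ^ 2 := by
      linear_combination (τ * χ (f x) ^ 2 * ‖g x‖ ^ 2) * hKτ
    have h6 : τ / 2 * (χ (f x) * χ (f x)) * ‖g x‖ ^ 2 ≤ τ / 2 * (χ (f x) * 1) * ‖g x‖ ^ 2 := by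
      gcongr
      exact hχ1 _
    have : f (ψ x) ≤ f x + -(τ * χ (f x) * ‖g x‖ ^ 2) + K * ((τ * χ (f x)) ^ 2 * ‖g x‖ ^ 2) := h
    linarith
  have hψid : ∀ x, f x ≤ β / 2 → ψ x = x := fun x hx => by simp [ψ, hχlow _ hx]
  have hψle : ∀ x, f (ψ x) ≤ f x := fun x => by
    have := hψf x
    have : 0 ≤ τ / 2 * χ (f x) * ‖g x‖ ^ 2 := by have := hχ0 (f x); positivity
    linarith
  have hiter : ∀ m : ℕ, ∀ y, f y ≤ C →
      f (ψ^[m] y) ≤ C ∧ f (ψ^[m] y) ≤ max (3 * β / 4) (C - m * (τ / 2 * δ ^ 2)) := by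
    intro m y hy
    induction m with
    | zero => simp [hy]
    | succ m ih =>
      rw [Function.iterate_succ_apply']
      set z := ψ^[m] y
      have hzle := hψle z
      refine ⟨hzle.trans ih.1, ?_⟩
      rcases le_total (3 * β / 4) (f z) with h | h
      · have h7 := hψf z
        rw [hχhigh _ h, mul_one] at h7
        have h8 : τ / 2 * δ ^ 2 ≤ τ / 2 * ‖g z‖ ^ 2 := by
          gcongr
          exact hδg z (by linarith) ih.1
        push_cast
        rcases le_max_iff.mp ih.2 with h9 | h9
        · exact le_max_of_le_left (by linarith)
        · exact le_max_of_le_right (by linarith)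
      · exact le_max_of_le_left (hzle.trans h)
  obtain ⟨m, hm⟩ := exists_nat_gt (C / (τ / 2 * δ ^ 2))
  have hm' : C - m * (τ / 2 * δ ^ 2) < 0 := by
    rw [div_lt_iff₀ (by positivity)] at hm; linarith
  let Ψ : W → W := ψ^[m]
  have hΨc : Continuous Ψ := hψ.iterate m
  have hΨid : ∀ x, f x ≤ 0 → Ψ x = x := fun x hx =>
    Function.iterate_fixed (hψid x (by linarith)) m
  have hΨlt : ∀ y, f y ≤ C → f (Ψ y) < β := fun y hy =>
    (hiter m y hy).2.trans_lt (max_lt (by linarith) (by linarith))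
  let P : W → S := fun w => S.orthogonalProjectionOnto w
  have hPc : Continuous P := (S.orthogonalProjectionOnto).continuous
  let y : WithLp 2 (S × ℝ) → W := fun z => (z.fst : W) + max (z.snd + α) 0 • e
  have hyc : Continuous y := by fun_prop
  let G : WithLp 2 (S × ℝ) → WithLp 2 (S × ℝ) := fun z => WithLp.toLp 2
    (P (Ψ (y z)), p (Ψ (y z) - P (Ψ (y z))) + min (z.snd + α) 0 - α)
  have hGc : Continuous G := by fun_prop
  have hPadd : ∀ (x : S) (s : ℝ), P ((x : W) + s • e) = x := by
    intro x s
    simp only [P, map_add, map_smul]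
    rw [Submodule.orthogonalProjectionOnto_mem_subspace_eq_self,
      Submodule.orthogonalProjectionOnto_eq_zero_iff.mpr heS]
    simp
  have hΨG : ∀ z, Ψ (y z) = y z → G z = z := by
    intro z hz
    have h5 : P (y z) = z.fst := hPadd _ _
    have h6 : y z - (z.fst : W) = max (z.snd + α) 0 • e := by simp [y]
    have h7 : max (z.snd + α) 0 + min (z.snd + α) 0 = z.snd + α := by
      rw [max_add_min, add_zero]
    simp only [G, hz, h5, h6, hpe _ (le_max_right _ _), h7]
    simp
    rfl
  obtain ⟨z, hz⟩ := exists_zero_of_continuous_of_eq_id (G := G) hGc (ρ := |R| + α) (by positivity)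
    (fun z hz => by
      apply hΨG
      apply hΨid
      rcases le_total (z.snd + α) 0 with h | h
      · simp only [y, max_eq_right h, zero_smul, add_zero]
        exact h2 _ z.fst.2
      · simp only [y, max_eq_left h]
        refine h4 _ z.fst.2 _ h ?_
        have horth : inner ℝ (z.fst : W) ((z.snd + α) • e) = 0 := by
          rw [inner_smul_right, Submodule.inner_right_of_mem_orthogonal z.fst.2 heS, mul_zero]
        have hn : ‖(z.fst : W) + (z.snd + α) • e‖ =
            ‖(WithLp.toLp 2 (z.fst, z.snd + α) : WithLp 2 (S × ℝ))‖ := by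
          rw [WithLp.prod_norm_eq_of_L2, ← Real.sqrt_sq (norm_nonneg _)]
          congr 1
          rw [norm_add_sq_real, horth, norm_smul, he]
          simp
        rw [hn]
        have hsub : z = (WithLp.toLp 2 (z.fst, z.snd + α) : WithLp 2 (S × ℝ)) -
            WithLp.toLp 2 ((0 : S), α) := by
          rw [← WithLp.toLp_sub]
          simp
          rfl
        have hα' : ‖(WithLp.toLp 2 ((0 : S), α) : WithLp 2 (S × ℝ))‖ = α := by
          rw [WithLp.prod_norm_eq_of_L2]
          simp [Real.sqrt_sq_eq_abs, abs_of_pos hα]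
        have := norm_sub_le (WithLp.toLp 2 (z.fst, z.snd + α) : WithLp 2 (S × ℝ))
          (WithLp.toLp 2 ((0 : S), α))
        rw [← hsub, hα'] at this
        linarith [le_abs_self R])
  have hz1 : P (Ψ (y z)) = 0 := congrArg (fun q : WithLp 2 (S × ℝ) => q.fst) hz
  have hz2 : p (Ψ (y z) - P (Ψ (y z))) + min (z.snd + α) 0 - α = 0 :=
    congrArg (fun q : WithLp 2 (S × ℝ) => q.snd) hz
  rcases le_total (z.snd + α) 0 with h | h
  · have hyz : y z = z.fst := by simp [y, max_eq_right h]
    have hzz : z = 0 := by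
      rw [← hΨG z (hΨid _ (by rw [hyz]; exact h2 _ z.fst.2)), hz]
    rw [hzz] at h
    simp at h
    linarith
  · rw [hz1, min_eq_right h] at hz2
    have hmem : Ψ (y z) ∈ Sᗮ := by
      rwa [← Submodule.orthogonalProjectionOnto_eq_zero_iff]
    have h5 := h1 _ hmem (by simpa [sub_eq_zero] using hz2)
    have h6 := hΨlt (y z) (by
      simp only [y, max_eq_left h]; exact h3 _ z.fst.2 _ h)
    linarith

end Minimax

section Fourier

/-- `ℂⁿ` with its Euclidean structure. -/
abbrev Cn (n : ℕ) := EuclideanSpace ℂ (Fin n)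

/-- The character `t ↦ exp (2πikt)`. -/
def expI (k : ℤ) (t : ℝ) : ℂ := Complex.exp (2 * π * k * Complex.I * t)

theorem continuous_expI (k : ℤ) : Continuous (expI k) := by
  unfold expI; fun_prop

theorem expI_add (k l : ℤ) (t : ℝ) : expI (k + l) t = expI k t * expI l t := by
  simp only [expI, ← Complex.exp_add]
  congr 1
  push_cast
  ring

theorem conj_expI (k : ℤ) (t : ℝ) : starRingEnd ℂ (expI k t) = expI (-k) t := by
  simp only [expI, ← Complex.exp_conj]
  congr 1
  have : starRingEnd ℂ 2 = 2 := Complex.conj_ofNat 2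
  simp [this]

theorem norm_expI (k : ℤ) (t : ℝ) : ‖expI k t‖ = 1 := by
  rw [expI, show (2 * π * k * Complex.I * t : ℂ) = ((2 * π * k * t : ℝ) : ℂ) * Complex.I by
    push_cast; ring, Complex.norm_exp_ofReal_mul_I]

theorem expI_add_one (k : ℤ) (t : ℝ) : expI k (t + 1) = expI k t := by
  rw [expI, expI, Complex.exp_eq_exp_iff_exists_int]
  exact ⟨k, by push_cast; ring⟩

theorem expI_zero_right (k : ℤ) : expI k 0 = 1 := by simp [expI]

theorem expI_zero_left (t : ℝ) : expI 0 t = 1 := by simp [expI]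

theorem hasDerivAt_expI (k : ℤ) (t : ℝ) :
    HasDerivAt (expI k) ((2 * π * k : ℝ) * Complex.I * expI k t) t := by
  have h : HasDerivAt (fun s : ℝ => (2 * π * k * Complex.I * s : ℂ)) (2 * π * k * Complex.I) t := by
    simpa using (Complex.ofRealCLM.hasDerivAt (x := t)).const_mul (2 * π * k * Complex.I : ℂ)
  refine h.cexp.congr_deriv ?_
  rw [expI]; push_cast; ring
theorem integral_expI (k : ℤ) : ∫ t in (0 : ℝ)..1, expI k t = if k = 0 then 1 else 0 := by
  split_ifs with h
  · subst h; simp [expI]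
  · have hc : (2 * π * k * Complex.I : ℂ) ≠ 0 := by
      simp [Real.pi_ne_zero, h]
    have h1 := expI_add_one k 0
    simp only [expI, zero_add] at h1 ⊢
    rw [integral_exp_mul_complex hc, h1, sub_self, zero_div]

theorem Cn.inner_def {n : ℕ} (u v : Cn n) : inner ℝ u v = ∑ i, (v i * starRingEnd ℂ (u i)).re := by
  rw [PiLp.inner_apply]; rfl

theorem Cn.inner_smul_right {n : ℕ} (z : ℂ) (u v : Cn n) :
    inner ℝ u (z • v) = inner ℝ (starRingEnd ℂ z • u) v := by
  simp only [Cn.inner_def]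
  refine Finset.sum_congr rfl fun i _ => ?_
  simp only [PiLp.smul_apply, smul_eq_mul, map_mul, Complex.conj_conj]
  ring_nf

theorem Cn.norm_sq {n : ℕ} (u : Cn n) : ‖u‖ ^ 2 = ∑ i, ‖u i‖ ^ 2 := EuclideanSpace.norm_sq_eq u

variable {n N : ℕ}

/-- Coefficient space of trigonometric polynomials of degree at most `N`. -/
abbrev Coef (n N : ℕ) := PiLp 2 (fun _ : Finset.Icc (-(N : ℤ)) N => Cn n)

/-- The trigonometric polynomial with given coefficients. -/
def trig (c : Coef n N) (t : ℝ) : Cn n := ∑ k, expI k.1 t • c k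

theorem continuous_trig_uncurry :
    Continuous (fun q : Coef n N × ℝ => trig q.1 q.2) := by
  unfold trig
  refine continuous_finsetSum _ fun k _ => ?_
  exact ((continuous_expI _).comp continuous_snd).smul (by fun_prop)

@[fun_prop]
theorem continuous_trig (c : Coef n N) : Continuous (trig c) :=
  continuous_trig_uncurry.comp (by fun_prop : Continuous fun t : ℝ => (c, t))

theorem trig_add (c d : Coef n N) (t : ℝ) : trig (c + d) t = trig c t + trig d t := by
  simp [trig, Finset.sum_add_distrib]

theorem trig_apply (c : Coef n N) (t : ℝ) (i : Fin n) :
    trig c t i = ∑ k, expI k.1 t * c k i := by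
  simp [trig]

/-- The Fourier coefficient of a function on `[0, 1]`. -/
def fc (u : ℝ → Cn n) (k : ℤ) : Cn n := ∫ t in (0 : ℝ)..1, expI (-k) t • u t

theorem integral_inner_trig {u : ℝ → Cn n} (hu : Continuous u) (w : Coef n N) :
    ∫ t in (0 : ℝ)..1, inner ℝ (u t) (trig w t) = ∑ k, inner ℝ (fc u k.1) (w k) := by
  simp only [trig, inner_sum]
  have hc : ∀ k : ℤ, Continuous fun t => expI k t • u t := fun k =>
    (continuous_expI k).smul hu
  rw [intervalIntegral.integral_finsetSum]
  · refine Finset.sum_congr rfl fun k _ => ?_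
    simp only [Cn.inner_smul_right, conj_expI]
    rw [fc, real_inner_comm]
    simp only [real_inner_comm (w k)]
    exact (innerSL ℝ (w k)).intervalIntegral_comp_comm ((hc _).intervalIntegrable 0 1)
  · intro k _
    have := (continuous_expI k.1).smul (continuous_const (y := w k))
    exact (hu.inner this).intervalIntegrable _ _

theorem fc_trig (c : Coef n N) (k : Finset.Icc (-(N : ℤ)) N) : fc (trig c) k.1 = c k := by
  rw [fc]
  simp only [trig, Finset.smul_sum, smul_smul, ← expI_add]
  rw [intervalIntegral.integral_finsetSum]
  · simp only [intervalIntegral.integral_smul_const, integral_expI]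
    rw [Finset.sum_eq_single k]
    · simp
    · intro l _ hl
      rw [if_neg, zero_smul]
      intro h
      exact hl (Subtype.ext (by omega))
    · simp
  · intro l _
    exact ((continuous_expI _).smul continuous_const).intervalIntegrable _ _

theorem integral_inner_trig_trig (c w : Coef n N) :
    ∫ t in (0 : ℝ)..1, inner ℝ (trig c t) (trig w t) = inner ℝ c w := by
  rw [integral_inner_trig (continuous_trig c), PiLp.inner_apply]
  simp only [fc_trig]

theorem integral_norm_trig_sq (c : Coef n N) : ∫ t in (0 : ℝ)..1, ‖trig c t‖ ^ 2 = ‖c‖ ^ 2 := by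
  simp only [← real_inner_self_eq_norm_sq]
  exact integral_inner_trig_trig c c

theorem hasDerivAt_trig (c : Coef n N) (t : ℝ) :
    HasDerivAt (trig c)
      (Complex.I • trig (WithLp.toLp 2 fun k => (2 * π * k.1 : ℝ) • c k) t) t := by
  have : HasDerivAt (trig c)
      (∑ k : Finset.Icc (-(N : ℤ)) N, ((2 * π * k.1 : ℝ) * Complex.I * expI k.1 t) • c k) t := by
    unfold trig
    exact HasDerivAt.fun_sum fun k _ => (hasDerivAt_expI k.1 t).smul_const (c k)
  convert this using 1
  simp only [trig, Finset.smul_sum]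
  refine Finset.sum_congr rfl fun k _ => ?_
  rw [← Complex.coe_smul, smul_smul, smul_smul]
  congr 1
  ring

theorem integral_norm_sum_expI_sq_le {ι : Type*} (T : Finset ι) (s : ι → ℤ) (α : ι → ℂ) :
    ∫ t in (0 : ℝ)..1, ‖∑ i ∈ T, expI (s i) t * α i‖ ^ 2 ≤
      ∑ i ∈ T, ∑ j ∈ T, if s i = s j then ‖α i‖ * ‖α j‖ else 0 := by
  have h1 : ∀ t, ‖∑ i ∈ T, expI (s i) t * α i‖ ^ 2 =
      ∑ i ∈ T, ∑ j ∈ T, Complex.reCLM (expI (s i - s j) t * (α i * starRingEnd ℂ (α j))) := by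
    intro t
    rw [← Complex.normSq_eq_norm_sq, ← Complex.ofReal_re (Complex.normSq _), ← Complex.mul_conj,
      map_sum, Finset.sum_mul_sum, Complex.re_sum]
    refine Finset.sum_congr rfl fun i _ => ?_
    rw [Complex.re_sum]
    refine Finset.sum_congr rfl fun j _ => ?_
    rw [map_mul, conj_expI, sub_eq_add_neg, expI_add, Complex.reCLM_apply]
    ring_nf
  have hc : ∀ i j, Continuous fun t => expI (s i - s j) t * (α i * starRingEnd ℂ (α j)) :=
    fun i j => (continuous_expI _).mul continuous_const
  have hc' : ∀ i j, Continuous fun t =>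
      Complex.reCLM (expI (s i - s j) t * (α i * starRingEnd ℂ (α j))) :=
    fun i j => Complex.reCLM.continuous.comp (hc i j)
  simp only [h1]
  rw [intervalIntegral.integral_finsetSum fun i _ =>
    (continuous_finsetSum _ fun j _ => hc' i j).intervalIntegrable _ _]
  refine Finset.sum_le_sum fun i _ => ?_
  rw [intervalIntegral.integral_finsetSum fun j _ => (hc' i j).intervalIntegrable _ _]
  refine Finset.sum_le_sum fun j _ => ?_
  rw [Complex.reCLM.intervalIntegral_comp_comm ((hc i j).intervalIntegrable _ _),
    intervalIntegral.integral_mul_const, integral_expI]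
  simp only [sub_eq_zero]
  split_ifs with h
  · rw [one_mul, Complex.reCLM_apply]
    refine (Complex.re_le_norm _).trans ?_
    rw [norm_mul, RCLike.norm_conj]
  · simp

theorem sum_inv_mul_le_one (T : Finset ℤ) (hT : ∀ k ∈ T, 1 ≤ k) (m : ℤ) :
    ∑ q ∈ T ×ˢ T, (if m = q.1 + q.2 then ((q.1 : ℝ) * q.2)⁻¹ else 0) ≤ 1 := by
  rw [← Finset.sum_filter]
  set P := (T ×ˢ T).filter fun q => m = q.1 + q.2
  have hP : ∀ q ∈ P, 1 ≤ q.1 ∧ 1 ≤ q.2 ∧ m = q.1 + q.2 := fun q hq => by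
    simp only [P, Finset.mem_filter, Finset.mem_product] at hq
    exact ⟨hT _ hq.1.1, hT _ hq.1.2, hq.2⟩
  rcases P.eq_empty_or_nonempty with h | ⟨q0, hq0⟩
  · simp [h]
  have hm : 2 ≤ m := by have := hP q0 hq0; omega
  have hcard : P.card ≤ (m - 1).toNat := by
    have : (Finset.Ioo 0 m).card = (m - 1).toNat := by simp
    rw [← this]
    refine Finset.card_le_card_of_injOn Prod.fst (fun q hq => ?_) fun q hq q' hq' h => ?_
    · have := hP q hq
      simp only [Finset.coe_Ioo, Set.mem_Ioo]; omega
    · have h1 := hP q hq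
      have h2 := hP q' hq'
      exact Prod.ext h (by omega)
  have hm1 : (0 : ℝ) < m - 1 := by
    have : (2 : ℝ) ≤ m := by exact_mod_cast hm
    linarith
  calc ∑ q ∈ P, ((q.1 : ℝ) * q.2)⁻¹ ≤ ∑ q ∈ P, ((m : ℝ) - 1)⁻¹ := by
        refine Finset.sum_le_sum fun q hq => inv_anti₀ hm1 ?_
        obtain ⟨h1, h2, h3⟩ := hP q hq
        have h1' : (1 : ℝ) ≤ q.1 := by exact_mod_cast h1
        have h2' : (1 : ℝ) ≤ q.2 := by exact_mod_cast h2
        rw [h3]; push_cast; nlinarith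
    _ = P.card * ((m : ℝ) - 1)⁻¹ := by rw [Finset.sum_const, nsmul_eq_mul]
    _ ≤ (m - 1 : ℝ) * ((m : ℝ) - 1)⁻¹ := by
        gcongr
        have : (P.card : ℝ) ≤ ((m - 1).toNat : ℝ) := by exact_mod_cast hcard
        refine this.trans (le_of_eq ?_)
        have : ((m - 1).toNat : ℤ) = m - 1 := Int.toNat_of_nonneg (by omega)
        exact_mod_cast congrArg (Int.cast : ℤ → ℝ) this
    _ = 1 := mul_inv_cancel₀ hm1.ne'

/-- A quartic bound for trigonometric polynomials with positive frequencies. -/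
theorem integral_norm_sum_expI_pow_four_le (T : Finset ℤ) (hT : ∀ k ∈ T, 1 ≤ k) (a : ℤ → ℂ) :
    ∫ t in (0 : ℝ)..1, ‖∑ k ∈ T, expI k t * a k‖ ^ 4 ≤ (∑ k ∈ T, (k : ℝ) * ‖a k‖ ^ 2) ^ 2 := by
  have h1 : ∀ t, ‖∑ k ∈ T, expI k t * a k‖ ^ 4 =
      ‖∑ q ∈ T ×ˢ T, expI (q.1 + q.2) t * (a q.1 * a q.2)‖ ^ 2 := by
    intro t
    rw [show 4 = 2 * 2 from rfl, pow_mul, ← norm_pow, sq (∑ k ∈ T, _), Finset.sum_mul_sum,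
      ← Finset.sum_product']
    congr 2
    refine Finset.sum_congr rfl fun q _ => ?_
    rw [expI_add]; ring
  simp only [h1]
  refine (integral_norm_sum_expI_sq_le (T ×ˢ T) (fun q => q.1 + q.2) _).trans ?_
  let w : ℤ × ℤ → ℝ := fun q => (q.1 : ℝ) * q.2
  let u : ℤ × ℤ → ℝ := fun q => ‖a q.1 * a q.2‖
  have hw : ∀ q ∈ T ×ˢ T, 0 < w q := fun q hq => by
    rw [Finset.mem_product] at hq
    have h1' : (1 : ℝ) ≤ q.1 := by exact_mod_cast hT _ hq.1
    have h2' : (1 : ℝ) ≤ q.2 := by exact_mod_cast hT _ hq.2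
    simp only [w]; positivity
  have h2 : ∀ q ∈ T ×ˢ T, ∀ q' ∈ T ×ˢ T,
      (if q.1 + q.2 = q'.1 + q'.2 then u q * u q' else 0) ≤
      (1 / 2) * (w q * u q ^ 2 * (if q.1 + q.2 = q'.1 + q'.2 then (w q')⁻¹ else 0)) +
      (1 / 2) * (w q' * u q' ^ 2 * (if q'.1 + q'.2 = q.1 + q.2 then (w q)⁻¹ else 0)) := by
    intro q hq q' hq'
    have hq := hw q hq
    have hq' := hw q' hq'
    by_cases h : q.1 + q.2 = q'.1 + q'.2
    · rw [if_pos h, if_pos h, if_pos h.symm]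
      have : (1 / 2) * (w q * u q ^ 2 * (w q')⁻¹) + (1 / 2) * (w q' * u q' ^ 2 * (w q)⁻¹) -
          u q * u q' = (w q * u q - w q' * u q') ^ 2 / (2 * w q * w q') := by
        field_simp; ring
      have : 0 ≤ (w q * u q - w q' * u q') ^ 2 / (2 * w q * w q') := by positivity
      linarith
    · rw [if_neg h, if_neg h, if_neg (Ne.symm h)]; simp
  have h3 : ∑ q ∈ T ×ˢ T, ∑ q' ∈ T ×ˢ T,
      (1 / 2) * (w q * u q ^ 2 * (if q.1 + q.2 = q'.1 + q'.2 then (w q')⁻¹ else 0)) ≤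
      ∑ q ∈ T ×ˢ T, (1 / 2) * (w q * u q ^ 2) := by
    refine Finset.sum_le_sum fun q hq => ?_
    rw [← Finset.mul_sum, ← Finset.mul_sum]
    have h4 := sum_inv_mul_le_one T hT (q.1 + q.2)
    have h5 : 0 ≤ w q * u q ^ 2 := mul_nonneg (hw q hq).le (sq_nonneg _)
    have := mul_le_of_le_one_right h5 h4
    simp only [w] at this ⊢
    linarith
  have h4 : ∑ q ∈ T ×ˢ T, w q * u q ^ 2 = (∑ k ∈ T, (k : ℝ) * ‖a k‖ ^ 2) ^ 2 := by
    rw [sq, Finset.sum_mul_sum, ← Finset.sum_product']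
    refine Finset.sum_congr rfl fun q _ => ?_
    simp only [w, u, norm_mul]; ring
  calc _ ≤ ∑ q ∈ T ×ˢ T, ∑ q' ∈ T ×ˢ T,
      ((1 / 2) * (w q * u q ^ 2 * (if q.1 + q.2 = q'.1 + q'.2 then (w q')⁻¹ else 0)) +
      (1 / 2) * (w q' * u q' ^ 2 * (if q'.1 + q'.2 = q.1 + q.2 then (w q)⁻¹ else 0))) :=
        Finset.sum_le_sum fun q hq => Finset.sum_le_sum fun q' hq' => h2 q hq q' hq'
    _ ≤ ∑ q ∈ T ×ˢ T, (1 / 2) * (w q * u q ^ 2) + ∑ q ∈ T ×ˢ T, (1 / 2) * (w q * u q ^ 2) := by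
        simp only [Finset.sum_add_distrib]
        refine add_le_add h3 ?_
        rw [Finset.sum_comm]
        exact h3
    _ = _ := by rw [← h4, ← Finset.mul_sum]; ring

end Fourier

section Galerkin

variable {n N : ℕ}

/-- Multiplication of the coordinates by real numbers. -/
def diagMul (b : Fin n → ℝ) (z : Cn n) : Cn n := WithLp.toLp 2 fun i => (b i : ℂ) * z i

@[fun_prop]
theorem continuous_diagMul (b : Fin n → ℝ) : Continuous (diagMul b) := by
  unfold diagMul; fun_prop

theorem inner_diagMul (b : Fin n → ℝ) (z w : Cn n) :
    inner ℝ (diagMul b z) w = ∑ i, b i * (w i * starRingEnd ℂ (z i)).re := by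
  rw [Cn.inner_def]
  refine Finset.sum_congr rfl fun i _ => ?_
  simp only [diagMul, map_mul, Complex.conj_ofReal]
  rw [mul_left_comm, Complex.re_ofReal_mul]

theorem inner_diagMul_self (b : Fin n → ℝ) (z : Cn n) :
    inner ℝ (diagMul b z) z = ∑ i, b i * ‖z i‖ ^ 2 := by
  rw [inner_diagMul]
  refine Finset.sum_congr rfl fun i _ => ?_
  rw [Complex.mul_conj, Complex.ofReal_re, Complex.normSq_eq_norm_sq]

theorem diagMul_trig (b : Fin n → ℝ) (c : Coef n N) (t : ℝ) :
    diagMul b (trig c t) = trig (WithLp.toLp 2 fun k => diagMul b (c k)) t := by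
  ext i
  simp only [trig_apply]
  simp only [diagMul, trig_apply, Finset.mul_sum]
  exact Finset.sum_congr rfl fun k _ => by ring

/-- A Hamiltonian `H` with gradient `G`, asymptotic to a nonresonant quadratic form with exactly
one eigenvalue beyond the first resonance. -/
structure IsAsympQuadratic (b : Fin n → ℝ) (i₀ : Fin n) (H : Cn n → ℝ) (G : Cn n → Cn n)
    (K M M' C γ δ : ℝ) : Prop where
  contH : Continuous H
  contG : Continuous G
  taylor : ∀ z w, |H (z + w) - H z - inner ℝ (G z) w| ≤ K * ‖w‖ ^ 2
  asymp : ∀ z, ‖G z - diagMul (fun i => 2 * b i) z‖ ≤ M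
  nonneg : ∀ z, 0 ≤ H z
  lower : ∀ z, ∑ i, b i * ‖z i‖ ^ 2 - C ≤ H z
  upper : ∀ z, H z ≤ M' * ∑ i, ‖z i‖ ^ 4
  gap : ∀ (k : ℤ) i, γ ≤ |2 * π * k - 2 * b i|
  low : ∀ i, δ ≤ b i
  high : δ ≤ b i₀ - π
  posK : 0 < K
  posM : 0 ≤ M
  posM' : 0 < M'
  posC : 0 ≤ C
  posγ : 0 < γ
  posδ : 0 < δ

/-- The action functional restricted to trigonometric polynomials. -/
def actN (H : Cn n → ℝ) (c : Coef n N) : ℝ :=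
  π * ∑ k, (k.1 : ℝ) * ‖c k‖ ^ 2 - ∫ t in (0 : ℝ)..1, H (trig c t)

/-- The gradient of the restricted action functional. -/
def gradN (G : Cn n → Cn n) (c : Coef n N) : Coef n N :=
  WithLp.toLp 2 fun k => (2 * π * k.1 : ℝ) • c k - fc (fun t => G (trig c t)) k.1

theorem inner_gradN {G : Cn n → Cn n} (hG : Continuous G) (c w : Coef n N) :
    inner ℝ (gradN G c) w = 2 * π * ∑ k, (k.1 : ℝ) * inner ℝ (c k) (w k) -
      ∫ t in (0 : ℝ)..1, inner ℝ (G (trig c t)) (trig w t) := by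
  rw [integral_inner_trig (u := fun t => G (trig c t)) (hG.comp (continuous_trig c)),
    PiLp.inner_apply]
  simp only [gradN, inner_sub_left, Finset.sum_sub_distrib, real_inner_smul_left, Finset.mul_sum,
    mul_assoc]

theorem continuous_actN {H : Cn n → ℝ} (hH : Continuous H) :
    Continuous (actN H : Coef n N → ℝ) := by
  unfold actN
  refine Continuous.sub (by fun_prop) ?_
  exact intervalIntegral.continuous_parametric_intervalIntegral_of_continuous'
    (f := fun (c : Coef n N) t => H (trig c t)) (hH.comp continuous_trig_uncurry) 0 1

theorem continuous_gradN {G : Cn n → Cn n} (hG : Continuous G) :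
    Continuous (gradN G : Coef n N → Coef n N) := by
  refine (PiLp.continuous_toLp 2 _).comp (continuous_pi fun k => ?_)
  refine Continuous.sub (by fun_prop) ?_
  exact intervalIntegral.continuous_parametric_intervalIntegral_of_continuous'
    (f := fun (c : Coef n N) t => expI (-k.1) t • G (trig c t)) (((continuous_expI _).comp continuous_snd).smul (hG.comp continuous_trig_uncurry)) 0 1

theorem integral_norm_trig_le (c : Coef n N) : ∫ t in (0 : ℝ)..1, ‖trig c t‖ ≤ ‖c‖ := by
  set a := ∫ t in (0 : ℝ)..1, ‖trig c t‖ with ha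
  refine abs_le_of_sq_le_sq' ?_ (norm_nonneg _) |>.2
  have h0 : 0 ≤ ∫ t in (0 : ℝ)..1, (‖trig c t‖ - a) ^ 2 :=
    intervalIntegral.integral_nonneg zero_le_one fun t _ => sq_nonneg _
  have h1 : ∫ t in (0 : ℝ)..1, (‖trig c t‖ - a) ^ 2 = ‖c‖ ^ 2 - 2 * a * a + a ^ 2 := by
    have : ∀ t, (‖trig c t‖ - a) ^ 2 = ‖trig c t‖ ^ 2 - 2 * a * ‖trig c t‖ + a ^ 2 := fun t => by
      ring
    simp only [this]
    have hi1 : IntervalIntegrable (fun t => ‖trig c t‖ ^ 2) volume 0 1 :=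
      Continuous.intervalIntegrable (by fun_prop) _ _
    have hi2 : IntervalIntegrable (fun t => 2 * a * ‖trig c t‖) volume 0 1 :=
      Continuous.intervalIntegrable (by fun_prop) _ _
    rw [intervalIntegral.integral_add (hi1.sub hi2) (by simp), intervalIntegral.integral_sub hi1 hi2,
      integral_norm_trig_sq, intervalIntegral.integral_const_mul, ← ha]
    simp
  nlinarith

variable {b : Fin n → ℝ} {i₀ : Fin n} {H : Cn n → ℝ} {G : Cn n → Cn n} {K M M' C γ δ : ℝ}

theorem IsAsympQuadratic.norm_le_gradN (h : IsAsympQuadratic b i₀ H G K M M' C γ δ)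
    (c : Coef n N) : γ * ‖c‖ ≤ ‖gradN G c‖ + M := by
  let w : Coef n N := WithLp.toLp 2 fun k => WithLp.toLp 2 fun i =>
    (SignType.sign (2 * π * k.1 - 2 * b i) : ℝ) * c k i
  have hwk : ∀ k i, w k i = ((SignType.sign (2 * π * k.1 - 2 * b i) : ℝ) : ℂ) * c k i :=
    fun k i => rfl
  have hw : ‖w‖ = ‖c‖ := by
    rw [← sq_eq_sq₀ (norm_nonneg _) (norm_nonneg _), PiLp.norm_sq_eq_of_L2, PiLp.norm_sq_eq_of_L2]
    refine Finset.sum_congr rfl fun k _ => ?_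
    rw [Cn.norm_sq, Cn.norm_sq]
    refine Finset.sum_congr rfl fun i _ => ?_
    rw [hwk, norm_mul]
    have h1 : (2 * π * k.1 - 2 * b i) ≠ 0 := fun h0 => by
      have := h.gap k.1 i
      rw [h0, abs_zero] at this
      linarith [h.posγ]
    rcases h1.lt_or_gt with h2 | h2
    · simp [sign_neg h2]
    · simp [sign_pos h2]
  have h1 := inner_gradN h.contG c w
  have h2 : ∫ t in (0 : ℝ)..1, inner ℝ (diagMul (fun i => 2 * b i) (trig c t)) (trig w t) =
      ∑ k, inner ℝ (diagMul (fun i => 2 * b i) (c k)) (w k) := by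
    simp only [diagMul_trig]
    rw [integral_inner_trig_trig, PiLp.inner_apply]
  have hG := h.contG
  have h3 : |∫ t in (0 : ℝ)..1,
      inner ℝ (G (trig c t) - diagMul (fun i => 2 * b i) (trig c t)) (trig w t)| ≤ M * ‖c‖ := by
    rw [← Real.norm_eq_abs]
    refine (intervalIntegral.norm_integral_le_of_norm_le (g := fun t => M * ‖trig w t‖) zero_le_one
      (Filter.Eventually.of_forall fun t _ => ?_)
      (Continuous.intervalIntegrable (by fun_prop) _ _)).trans ?_
    · refine (norm_inner_le_norm _ _).trans ?_
      gcongr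
      exact h.asymp _
    · rw [intervalIntegral.integral_const_mul, ← hw]
      have := h.posM
      gcongr
      exact integral_norm_trig_le w
  have h4 : ∫ t in (0 : ℝ)..1,
      inner ℝ (G (trig c t) - diagMul (fun i => 2 * b i) (trig c t)) (trig w t) =
      (∫ t in (0 : ℝ)..1, inner ℝ (G (trig c t)) (trig w t)) -
      ∫ t in (0 : ℝ)..1, inner ℝ (diagMul (fun i => 2 * b i) (trig c t)) (trig w t) := by
    simp only [inner_sub_left]
    exact intervalIntegral.integral_sub (Continuous.intervalIntegrable (by fun_prop) _ _)
      (Continuous.intervalIntegrable (by fun_prop) _ _)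
  have h5 : γ * ‖c‖ ^ 2 ≤ 2 * π * ∑ k, (k.1 : ℝ) * inner ℝ (c k) (w k) -
      ∑ k, inner ℝ (diagMul (fun i => 2 * b i) (c k)) (w k) := by
    rw [PiLp.norm_sq_eq_of_L2, Finset.mul_sum, Finset.mul_sum, ← Finset.sum_sub_distrib]
    refine Finset.sum_le_sum fun k _ => ?_
    rw [inner_diagMul, Cn.inner_def, Cn.norm_sq, Finset.mul_sum, Finset.mul_sum, Finset.mul_sum,
      ← Finset.sum_sub_distrib]
    refine Finset.sum_le_sum fun i _ => ?_
    have h6 : (w k i * starRingEnd ℂ (c k i)).re =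
        (SignType.sign (2 * π * k.1 - 2 * b i) : ℝ) * ‖c k i‖ ^ 2 := by
      rw [hwk, mul_assoc, Complex.mul_conj, Complex.re_ofReal_mul, Complex.ofReal_re,
        Complex.normSq_eq_norm_sq]
    rw [h6]
    calc γ * ‖c k i‖ ^ 2 ≤ |2 * π * k.1 - 2 * b i| * ‖c k i‖ ^ 2 := by
          gcongr; exact h.gap _ _
      _ = (SignType.sign (2 * π * k.1 - 2 * b i) * (2 * π * k.1 - 2 * b i)) * ‖c k i‖ ^ 2 := by
          rw [sign_mul_self]
      _ = _ := by ring
  have h7 : inner ℝ (gradN G c) w ≤ ‖gradN G c‖ * ‖c‖ := hw ▸ real_inner_le_norm _ _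
  have h8 := neg_le_of_abs_le h3
  have h9 := le_of_abs_le h3
  have h10 : γ * ‖c‖ ^ 2 ≤ (‖gradN G c‖ + M) * ‖c‖ := by linarith
  rcases (norm_nonneg c).eq_or_lt with h0 | h0
  · rw [← h0, mul_zero]
    exact add_nonneg (norm_nonneg _) h.posM
  · exact le_of_mul_le_mul_right (by linarith) h0

theorem IsAsympQuadratic.actN_add_le (h : IsAsympQuadratic b i₀ H G K M M' C γ δ)
    (c w : Coef n N) :
    actN H (c + w) ≤ actN H c + inner ℝ (gradN G c) w + (π * N + K) * ‖w‖ ^ 2 := by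
  have hH := h.contH
  have hG := h.contG
  have h1 : (∫ t in (0 : ℝ)..1, H (trig c t)) +
      (∫ t in (0 : ℝ)..1, inner ℝ (G (trig c t)) (trig w t)) - K * ‖w‖ ^ 2 ≤
      ∫ t in (0 : ℝ)..1, H (trig (c + w) t) := by
    rw [← integral_norm_trig_sq w, ← intervalIntegral.integral_const_mul,
      ← intervalIntegral.integral_add (Continuous.intervalIntegrable (by fun_prop) _ _)
        (Continuous.intervalIntegrable (by fun_prop) _ _),
      ← intervalIntegral.integral_sub (Continuous.intervalIntegrable (by fun_prop) _ _)
        (Continuous.intervalIntegrable (by fun_prop) _ _)]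
    refine intervalIntegral.integral_mono_on zero_le_one
      (Continuous.intervalIntegrable (by fun_prop) _ _)
      (Continuous.intervalIntegrable (by fun_prop) _ _) fun t _ => ?_
    rw [trig_add]
    linarith [neg_le_of_abs_le (h.taylor (trig c t) (trig w t))]
  have h2 : ∑ k : Finset.Icc (-(N : ℤ)) N, (k.1 : ℝ) * ‖(c + w) k‖ ^ 2 ≤
      ∑ k : Finset.Icc (-(N : ℤ)) N, (k.1 : ℝ) * ‖c k‖ ^ 2 +
      2 * ∑ k : Finset.Icc (-(N : ℤ)) N, (k.1 : ℝ) * inner ℝ (c k) (w k) + N * ‖w‖ ^ 2 := by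
    rw [PiLp.norm_sq_eq_of_L2, Finset.mul_sum, Finset.mul_sum, ← Finset.sum_add_distrib,
      ← Finset.sum_add_distrib]
    refine Finset.sum_le_sum fun k _ => ?_
    have hk : (k.1 : ℝ) ≤ N := by exact_mod_cast (Finset.mem_Icc.mp k.2).2
    rw [PiLp.add_apply, norm_add_sq_real]
    have := mul_le_mul_of_nonneg_right hk (sq_nonneg ‖w k‖)
    linarith
  rw [inner_gradN h.contG, actN, actN]
  have := mul_le_mul_of_nonneg_left h2 Real.pi_pos.le
  linarith

theorem sum_pow_four_le (c : Coef n N) (hc : ∀ k : Finset.Icc (-(N : ℤ)) N, k.1 ≤ 0 → c k = 0) :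
    ∫ t in (0 : ℝ)..1, ∑ i, ‖trig c t i‖ ^ 4 ≤ (∑ k, (k.1 : ℝ) * ‖c k‖ ^ 2) ^ 2 := by
  let T : Finset ℤ := Finset.Icc 1 (N : ℤ)
  let a : Fin n → ℤ → ℂ := fun i k =>
    if h : k ∈ Finset.Icc (-(N : ℤ)) N then c ⟨k, h⟩ i else 0
  have hsum : ∀ {X : Type} [AddCommMonoid X] (F : ℤ → X), (∀ k ≤ 0, F k = 0) →
      ∑ k : Finset.Icc (-(N : ℤ)) N, F k.1 = ∑ k ∈ T, F k := by
    intro X _ F hF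
    rw [Finset.sum_coe_sort _ F]
    refine (Finset.sum_subset (fun k hk => ?_) fun k hk hk' => hF k ?_).symm
    · simp only [T, Finset.mem_Icc] at hk ⊢; omega
    · simp only [T, Finset.mem_Icc] at hk hk'; omega
  have ha0 : ∀ i, ∀ k ≤ 0, a i k = 0 := fun i k hk => by
    by_cases h : k ∈ Finset.Icc (-(N : ℤ)) N
    · simp only [a, dif_pos h, hc ⟨k, h⟩ hk, PiLp.zero_apply]
    · simp only [a, dif_neg h]
  have hac : ∀ i (k : Finset.Icc (-(N : ℤ)) N), a i k.1 = c k i := fun i k => by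
    simp only [a, dif_pos k.2, Subtype.coe_eta]
  have h1 : ∀ t i, trig c t i = ∑ k ∈ T, expI k t * a i k := fun t i => by
    rw [trig_apply, ← hsum (fun k => expI k t * a i k) fun k hk => by rw [ha0 i k hk, mul_zero]]
    simp only [hac]
  have h2 : ∀ i, ∑ k : Finset.Icc (-(N : ℤ)) N, (k.1 : ℝ) * ‖c k i‖ ^ 2 =
      ∑ k ∈ T, (k : ℝ) * ‖a i k‖ ^ 2 := fun i => by
    rw [← hsum (fun k => (k : ℝ) * ‖a i k‖ ^ 2) fun k hk => by simp [ha0 i k hk]]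
    simp only [hac]
  rw [intervalIntegral.integral_finsetSum fun i _ =>
    Continuous.intervalIntegrable (by fun_prop) _ _]
  have h3 : ∑ k : Finset.Icc (-(N : ℤ)) N, (k.1 : ℝ) * ‖c k‖ ^ 2 =
      ∑ i, ∑ k ∈ T, (k : ℝ) * ‖a i k‖ ^ 2 := by
    simp only [Cn.norm_sq, Finset.mul_sum, ← h2]
    exact Finset.sum_comm
  rw [h3]
  have hT : ∀ k ∈ T, 1 ≤ k := fun k hk => (Finset.mem_Icc.mp hk).1
  refine (Finset.sum_le_sum fun i _ => ?_).trans
    (Finset.sum_sq_le_sq_sum_of_nonneg fun i _ => Finset.sum_nonneg fun k hk => ?_)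
  · simp only [h1]
    exact integral_norm_sum_expI_pow_four_le T hT (a i)
  · have : (1 : ℝ) ≤ k := by exact_mod_cast hT k hk
    positivity

end Galerkin

section GalerkinCritical

variable {n N : ℕ}

/-- Trigonometric polynomials without positive frequencies. -/
def nonposModes (n N : ℕ) : Submodule ℝ (Coef n N) where
  carrier := {c | ∀ k, 1 ≤ k.1 → c k = 0}
  add_mem' := fun ha hb k hk => by rw [PiLp.add_apply, ha k hk, hb k hk, add_zero]
  zero_mem' := fun k _ => rfl
  smul_mem' := fun r c hc k hk => by rw [PiLp.smul_apply, hc k hk, smul_zero]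

theorem eq_zero_of_mem_nonposModes_orthogonal {y : Coef n N} (hy : y ∈ (nonposModes n N)ᗮ)
    (k : Finset.Icc (-(N : ℤ)) N) (hk : k.1 ≤ 0) : y k = 0 := by
  have h1 := (Submodule.mem_orthogonal _ _).mp hy (PiLp.single 2 k (y k)) fun l hl => by
    rw [PiLp.single_apply, if_neg]
    rintro rfl
    omega
  rw [PiLp.inner_apply, Finset.sum_eq_single k] at h1
  · simpa using h1
  · intro l _ hl
    rw [PiLp.single_apply, if_neg hl, inner_zero_left]
  · simp

variable {b : Fin n → ℝ} {i₀ : Fin n} {H : Cn n → ℝ} {G : Cn n → Cn n} {K M M' C γ δ : ℝ}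

theorem IsAsympQuadratic.le_actN (h : IsAsympQuadratic b i₀ H G K M M' C γ δ) (c : Coef n N)
    (hc : ∀ k : Finset.Icc (-(N : ℤ)) N, k.1 ≤ 0 → c k = 0) :
    π * ∑ k, (k.1 : ℝ) * ‖c k‖ ^ 2 - M' * (∑ k, (k.1 : ℝ) * ‖c k‖ ^ 2) ^ 2 ≤ actN H c := by
  have hH := h.contH
  have h1 : ∫ t in (0 : ℝ)..1, H (trig c t) ≤ ∫ t in (0 : ℝ)..1, M' * ∑ i, ‖trig c t i‖ ^ 4 :=
    intervalIntegral.integral_mono_on zero_le_one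
      (Continuous.intervalIntegrable (by fun_prop) _ _)
      (Continuous.intervalIntegrable (by fun_prop) _ _) fun t _ => h.upper _
  rw [intervalIntegral.integral_const_mul] at h1
  have := mul_le_mul_of_nonneg_left (sum_pow_four_le c hc) h.posM'.le
  rw [actN]
  linarith

theorem IsAsympQuadratic.actN_le (h : IsAsympQuadratic b i₀ H G K M M' C γ δ) (c : Coef n N) :
    actN H c ≤ C + ∑ k, (π * (k.1 : ℝ) * ‖c k‖ ^ 2 - ∑ i, b i * ‖c k i‖ ^ 2) := by
  have hH := h.contH
  have h1 : ∫ t in (0 : ℝ)..1, (inner ℝ (diagMul b (trig c t)) (trig c t) - C) ≤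
      ∫ t in (0 : ℝ)..1, H (trig c t) :=
    intervalIntegral.integral_mono_on zero_le_one
      (Continuous.intervalIntegrable (by fun_prop) _ _)
      (Continuous.intervalIntegrable (by fun_prop) _ _) fun t _ => by
        rw [inner_diagMul_self]; exact h.lower _
  rw [intervalIntegral.integral_sub (Continuous.intervalIntegrable (by fun_prop) _ _) (by simp)]
    at h1
  simp only [diagMul_trig] at h1
  rw [integral_inner_trig_trig, PiLp.inner_apply] at h1
  simp only [inner_diagMul_self, intervalIntegral.integral_const, sub_zero, one_smul] at h1
  rw [actN, Finset.sum_sub_distrib, Finset.mul_sum]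
  simp only [← mul_assoc] at h1 ⊢
  linarith

theorem IsAsympQuadratic.exists_critical (h : IsAsympQuadratic b i₀ H G K M M' C γ δ)
    (hN : 1 ≤ N) :
    ∃ c : Coef n N, gradN G c = 0 ∧ π ^ 2 / (4 * M') / 2 ≤ actN H c ∧ actN H c ≤ C := by
  have hM' := h.posM'
  have h1N : (1 : ℤ) ∈ Finset.Icc (-(N : ℤ)) N := by simp only [Finset.mem_Icc]; omega
  let k₁ : Finset.Icc (-(N : ℤ)) N := ⟨1, h1N⟩
  let v₀ : Cn n := EuclideanSpace.single i₀ 1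
  let e : Coef n N := PiLp.single 2 k₁ v₀
  have hv₀ : ‖v₀‖ = 1 := by simp [v₀]
  have hek : ∀ k, k ≠ k₁ → e k = 0 := fun k hk => by rw [PiLp.single_apply, if_neg hk]
  have hek₁ : e k₁ = v₀ := by rw [PiLp.single_apply, if_pos rfl]
  have hbound : ∀ x ∈ nonposModes n N, ∀ s : ℝ, 0 ≤ s →
      actN H (x + s • e) ≤ C - δ * ‖x + s • e‖ ^ 2 := by
    intro x hx s hs
    refine (h.actN_le _).trans ?_
    rw [sub_eq_add_neg, add_le_add_iff_left, PiLp.norm_sq_eq_of_L2, Finset.mul_sum,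
      ← Finset.sum_neg_distrib]
    refine Finset.sum_le_sum fun k _ => ?_
    rw [PiLp.add_apply, PiLp.smul_apply]
    rcases le_or_gt k.1 0 with hk | hk
    · rw [hek k (by rintro rfl; simp [k₁] at hk), smul_zero, add_zero]
      have h1 : δ * ‖x k‖ ^ 2 ≤ ∑ i, b i * ‖x k i‖ ^ 2 := by
        rw [Cn.norm_sq, Finset.mul_sum]
        refine Finset.sum_le_sum fun i _ => ?_
        gcongr
        exact h.low i
      have h2 : (k.1 : ℝ) ≤ 0 := by exact_mod_cast hk
      have h3 := mul_nonpos_of_nonpos_of_nonneg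
        (mul_nonpos_of_nonneg_of_nonpos Real.pi_pos.le h2) (sq_nonneg ‖x k‖)
      linarith
    · rw [hx k hk, zero_add]
      by_cases hkk : k = k₁
      · subst hkk
        rw [hek₁]
        have h1 : ∑ i, b i * ‖(s • v₀) i‖ ^ 2 = b i₀ * s ^ 2 := by
          rw [Finset.sum_eq_single i₀]
          · simp [v₀]
          · intro i _ hi
            simp [v₀, hi]
          · simp
        rw [h1, norm_smul, hv₀, mul_one, Real.norm_eq_abs, sq_abs]
        have h2 := mul_le_mul_of_nonneg_right h.high (sq_nonneg s)
        simp only [k₁, Int.cast_one, mul_one]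
        linarith
      · rw [hek k hkk, smul_zero]; simp
  have hα : 0 < √(π / (2 * M')) := Real.sqrt_pos.mpr (by positivity)
  refine exists_critical_of_linking (f := actN H) (g := gradN G) (A := 1 / γ) (B := M / γ)
    (continuous_actN h.contH) (continuous_gradN h.contG) (K := π * N + K)
    (by have := h.posK; positivity) h.actN_add_le (by have := h.posγ; positivity)
    (fun x => ?_) (nonposModes n N) (e := e) ?_ ?_
    (p := fun y => √(∑ k, (k.1 : ℝ) * ‖y k‖ ^ 2)) (by fun_prop) (fun s hs => ?_)
    (α := √(π / (2 * M'))) (R := √(C / δ)) hα (by positivity)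
    (fun y hy hp => ?_) (fun x hx => ?_) (fun x hx s hs => ?_) (fun x hx s hs hR => ?_)
  · rw [one_div_mul_eq_div, ← add_div, le_div_iff₀ h.posγ, mul_comm]
    exact h.norm_le_gradN x
  · refine (Submodule.mem_orthogonal _ _).mpr fun x hx => ?_
    rw [PiLp.inner_apply]
    refine Finset.sum_eq_zero fun k _ => ?_
    by_cases hk : k = k₁
    · rw [hk, hx k₁ le_rfl, inner_zero_left]
    · rw [hek k hk, inner_zero_right]
  · rw [PiLp.norm_single, hv₀]
  · rw [Finset.sum_eq_single k₁]
    · rw [PiLp.smul_apply, hek₁, norm_smul, hv₀]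
      simp [k₁, hs]
    · intro k _ hk
      rw [PiLp.smul_apply, hek k hk]; simp
    · simp
  · have h1 := h.le_actN y fun k hk => eq_zero_of_mem_nonposModes_orthogonal hy k hk
    have h2 : ∑ k : Finset.Icc (-(N : ℤ)) N, (k.1 : ℝ) * ‖y k‖ ^ 2 = π / (2 * M') :=
      Real.sqrt_inj (Real.sqrt_ne_zero'.mp (hp ▸ hα).ne' |>.le) (by positivity) |>.mp hp
    rw [h2] at h1
    refine le_trans (le_of_eq ?_) h1
    field_simp
    ring
  · rw [actN]
    have h1 : ∑ k : Finset.Icc (-(N : ℤ)) N, (k.1 : ℝ) * ‖x k‖ ^ 2 ≤ 0 := by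
      refine Finset.sum_nonpos fun k _ => ?_
      rcases le_or_gt k.1 0 with hk | hk
      · have h2 : (k.1 : ℝ) ≤ 0 := by exact_mod_cast hk
        exact mul_nonpos_of_nonpos_of_nonneg h2 (sq_nonneg _)
      · rw [hx k hk]; simp
    have h2 := mul_nonpos_of_nonneg_of_nonpos Real.pi_pos.le h1
    have h3 : 0 ≤ ∫ t in (0 : ℝ)..1, H (trig x t) :=
      intervalIntegral.integral_nonneg zero_le_one fun t _ => h.nonneg _
    linarith
  · have := hbound x hx s hs
    have := mul_nonneg h.posδ.le (sq_nonneg ‖x + s • e‖)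
    linarith
  · have h1 := hbound x hx s hs
    have h2 : C / δ ≤ ‖x + s • e‖ ^ 2 := by
      rw [← Real.sq_sqrt (div_nonneg h.posC h.posδ.le)]
      gcongr
    rw [div_le_iff₀ h.posδ] at h2
    linarith

end GalerkinCritical

section PeriodicOrbit

variable {n N : ℕ}

theorem Cn.eq_zero_of_fc_eq_zero {d : ℝ → Cn n} (hd : Continuous d) (hper : ∀ t, d (t + 1) = d t)
    (hfc : ∀ k, fc d k = 0) (t : ℝ) : d t = 0 := by
  ext i
  have hper' : Function.Periodic (fun t => d t i) 1 := fun t => by simp only [hper]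
  let f : C(UnitAddCircle, ℂ) := ⟨hper'.lift, by
    refine continuous_coinduced_dom.mpr ?_
    exact (by fun_prop : Continuous fun t => d t i)⟩
  have hf : ∀ t : ℝ, f (t : UnitAddCircle) = d t i := fun t => rfl
  have h0 : ∀ k : ℤ, fourierCoeff f k = 0 := by
    intro k
    rw [fourierCoeff_eq_intervalIntegral _ _ 0]
    have h1 : ∀ s : ℝ, fourier (-k) (s : UnitAddCircle) • f (s : UnitAddCircle) =
        (EuclideanSpace.proj (𝕜 := ℂ) i) (expI (-k) s • d s) := by
      intro s
      rw [hf, fourier_coe_apply, map_smul, expI]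
      simp only [Int.cast_neg, Complex.ofReal_one, div_one, smul_eq_mul, EuclideanSpace.proj,
        PiLp.proj_apply]
      congr 2
      ring
    simp only [h1]
    have hc : Continuous fun t => expI (-k) t • d t := (continuous_expI _).smul hd
    rw [zero_add, (EuclideanSpace.proj (𝕜 := ℂ) i).intervalIntegral_comp_comm
      (hc.intervalIntegrable _ _)]
    have := hfc k
    rw [fc] at this
    rw [this, map_zero, smul_zero]
  have hs := has_pointwise_sum_fourier_series_of_summable (f := f)
    (by simpa only [funext h0] using summable_zero) t
  simp only [h0, zero_smul] at hs
  rw [← hf]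
  exact hs.unique hasSum_zero

theorem Cn.exists_norm_diagMul_le (b : Fin n → ℝ) : ∃ L, 0 ≤ L ∧ ∀ z, ‖diagMul b z‖ ≤ L * ‖z‖ := by
  refine ⟨√(∑ i, b i ^ 2), Real.sqrt_nonneg _, fun z => ?_⟩
  refine abs_le_of_sq_le_sq' ?_ (by positivity) |>.2
  rw [mul_pow, Real.sq_sqrt (Finset.sum_nonneg fun i _ => sq_nonneg _), Cn.norm_sq, Cn.norm_sq,
    Finset.mul_sum]
  refine Finset.sum_le_sum fun i _ => ?_
  have : ‖diagMul b z i‖ ^ 2 = b i ^ 2 * ‖z i‖ ^ 2 := by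
    simp only [diagMul, norm_mul, Complex.norm_real, mul_pow, Real.norm_eq_abs, sq_abs]
  rw [this]
  gcongr
  exact Finset.single_le_sum (f := fun i => b i ^ 2) (fun j _ => sq_nonneg _) (Finset.mem_univ i)

theorem norm_trig_sub_le (c : Coef n N) {A : ℝ}
    (hA : ‖(WithLp.toLp 2 fun k => (2 * π * k.1 : ℝ) • c k : Coef n N)‖ ^ 2 ≤ A) {s t : ℝ}
    (hs : s ∈ Icc (0 : ℝ) 1) (ht : t ∈ Icc (0 : ℝ) 1) :
    ‖trig c t - trig c s‖ ≤ (A + 1) / 2 * √|t - s| := by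
  wlog hst : s ≤ t generalizing s t
  · rw [norm_sub_rev, abs_sub_comm]
    exact this ht hs (le_of_not_ge hst)
  rcases hst.eq_or_lt with rfl | hst
  · simp
  set w : Coef n N := WithLp.toLp 2 fun k => (2 * π * k.1 : ℝ) • c k with hw
  have h1 : ∫ r in s..t, Complex.I • trig w r = trig c t - trig c s :=
    intervalIntegral.integral_eq_sub_of_hasDerivAt (fun r _ => hasDerivAt_trig c r)
      (Continuous.intervalIntegrable (by fun_prop) _ _)
  have hts : 0 < t - s := sub_pos.mpr hst
  set l := √(t - s) with hl
  have hl0 : 0 < l := Real.sqrt_pos.mpr hts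
  have hll : l ^ 2 = t - s := Real.sq_sqrt hts.le
  rw [abs_of_pos hts, ← hl, ← h1]
  have h2 : ∀ r, ‖Complex.I • trig w r‖ ≤ l / 2 * ‖trig w r‖ ^ 2 + 1 / (2 * l) := by
    intro r
    rw [norm_smul, Complex.norm_I, one_mul]
    have : l / 2 * ‖trig w r‖ ^ 2 + 1 / (2 * l) - ‖trig w r‖ = (l * ‖trig w r‖ - 1) ^ 2 / (2 * l) := by
      field_simp; ring
    have : 0 ≤ (l * ‖trig w r‖ - 1) ^ 2 / (2 * l) := by positivity
    linarith
  refine (intervalIntegral.norm_integral_le_of_norm_le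
    (g := fun r => l / 2 * ‖trig w r‖ ^ 2 + 1 / (2 * l)) hst.le
    (Filter.Eventually.of_forall fun r _ => h2 r)
    (Continuous.intervalIntegrable (by fun_prop) _ _)).trans ?_
  have h3 : ∫ r in s..t, ‖trig w r‖ ^ 2 ≤ A := by
    refine le_trans ?_ hA
    rw [← integral_norm_trig_sq w]
    exact intervalIntegral.integral_mono_interval hs.1 hst.le ht.2
      (Filter.Eventually.of_forall fun r => sq_nonneg _)
      (Continuous.intervalIntegrable (by fun_prop) _ _)
  rw [intervalIntegral.integral_add (Continuous.intervalIntegrable (by fun_prop) _ _) (by simp),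
    intervalIntegral.integral_const_mul, intervalIntegral.integral_const, ← hll, smul_eq_mul]
  have h4 : l ^ 2 * (1 / (2 * l)) = 1 / 2 * l := by field_simp
  rw [h4]
  have := mul_le_mul_of_nonneg_left h3 (half_pos hl0).le
  linarith

theorem norm_trig_le (c : Coef n N) {A B : ℝ} (hA0 : 0 ≤ A)
    (hA : ‖(WithLp.toLp 2 fun k => (2 * π * k.1 : ℝ) • c k : Coef n N)‖ ^ 2 ≤ A)
    (hB : ‖c‖ ≤ B) {t : ℝ} (ht : t ∈ Icc (0 : ℝ) 1) : ‖trig c t‖ ≤ (A + 1) / 2 + B := by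
  have h1 : ∀ s ∈ Icc (0 : ℝ) 1, ‖trig c t‖ ≤ (A + 1) / 2 + ‖trig c s‖ := by
    intro s hs
    have h2 := norm_trig_sub_le c hA hs ht
    have h3 : √|t - s| ≤ 1 := by
      rw [Real.sqrt_le_one, abs_le]
      constructor <;> linarith [hs.1, hs.2, ht.1, ht.2]
    have h4 := mul_le_mul_of_nonneg_left h3 (by linarith : 0 ≤ (A + 1) / 2)
    have h5 := norm_sub_norm_le (trig c t) (trig c s)
    linarith
  have h2 : ∫ s in (0 : ℝ)..1, ‖trig c t‖ ≤ ∫ s in (0 : ℝ)..1, ((A + 1) / 2 + ‖trig c s‖) :=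
    intervalIntegral.integral_mono_on zero_le_one (by simp)
      (Continuous.intervalIntegrable (by fun_prop) _ _) h1
  rw [intervalIntegral.integral_add (by simp) (Continuous.intervalIntegrable (by fun_prop) _ _)] at h2
  simp only [intervalIntegral.integral_const, sub_zero, one_smul] at h2
  linarith [integral_norm_trig_le c]

variable {b : Fin n → ℝ} {i₀ : Fin n} {H : Cn n → ℝ} {G : Cn n → Cn n} {K M M' C γ δ : ℝ}

theorem IsAsympQuadratic.exists_bounds (h : IsAsympQuadratic b i₀ H G K M M' C γ δ) :
    ∃ A B : ℝ, 0 ≤ A ∧ ∀ (N : ℕ) (c : Coef n N), gradN G c = 0 → ‖c‖ ≤ B ∧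
      ‖(WithLp.toLp 2 fun k => (2 * π * k.1 : ℝ) • c k : Coef n N)‖ ^ 2 ≤ A := by
  obtain ⟨L, hL0, hL⟩ := Cn.exists_norm_diagMul_le fun i => 2 * b i
  have hG := h.contG
  refine ⟨2 * M ^ 2 + 2 * L ^ 2 * (M / γ) ^ 2, M / γ, by positivity, fun N c hc => ?_⟩
  have hB : ‖c‖ ≤ M / γ := by
    have := h.norm_le_gradN c
    rw [hc, norm_zero, zero_add] at this
    rwa [le_div_iff₀ h.posγ, mul_comm]
  refine ⟨hB, ?_⟩
  set w : Coef n N := WithLp.toLp 2 fun k => (2 * π * k.1 : ℝ) • c k with hw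
  have h1 := inner_gradN hG c w
  rw [hc, inner_zero_left] at h1
  have h2 : 2 * π * ∑ k : Finset.Icc (-(N : ℤ)) N, (k.1 : ℝ) * inner ℝ (c k) (w k) = ‖w‖ ^ 2 := by
    rw [← real_inner_self_eq_norm_sq, PiLp.inner_apply, Finset.mul_sum]
    refine Finset.sum_congr rfl fun k _ => ?_
    conv_rhs => rw [hw]
    simp only [real_inner_smul_left]
    ring
  have h3 : ∫ t in (0 : ℝ)..1, inner ℝ (G (trig c t)) (trig w t) ≤
      ∫ t in (0 : ℝ)..1, (1 / 2 * (2 * M ^ 2 + 2 * L ^ 2 * ‖trig c t‖ ^ 2) +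
        1 / 2 * ‖trig w t‖ ^ 2) := by
    refine intervalIntegral.integral_mono_on zero_le_one
      (Continuous.intervalIntegrable (by fun_prop) _ _)
      (Continuous.intervalIntegrable (by fun_prop) _ _) fun t _ => ?_
    set z := trig c t
    have h4 : ‖G z‖ ≤ M + L * ‖z‖ := by
      have h5 := h.asymp z
      have h6 := norm_sub_norm_le (G z) (diagMul (fun i => 2 * b i) z)
      have h7 := hL z
      linarith
    have h5 : ‖G z‖ ^ 2 ≤ (M + L * ‖z‖) ^ 2 := by gcongr
    have h6 := real_inner_le_norm (G z) (trig w t)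
    nlinarith [sq_nonneg (‖G z‖ - ‖trig w t‖), sq_nonneg (M - L * ‖z‖)]
  rw [intervalIntegral.integral_add (Continuous.intervalIntegrable (by fun_prop) _ _)
    (Continuous.intervalIntegrable (by fun_prop) _ _), intervalIntegral.integral_const_mul,
    intervalIntegral.integral_const_mul, integral_norm_trig_sq,
    intervalIntegral.integral_add (by simp) (Continuous.intervalIntegrable (by fun_prop) _ _),
    intervalIntegral.integral_const_mul, intervalIntegral.integral_const_mul (2 * L ^ 2),
    integral_norm_trig_sq] at h3
  simp only [intervalIntegral.integral_const, sub_zero, one_smul] at h3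
  have h4 : 2 * L ^ 2 * ‖c‖ ^ 2 ≤ 2 * L ^ 2 * (M / γ) ^ 2 := by gcongr
  linarith

end PeriodicOrbit

section Limit

variable {n : ℕ} {b : Fin n → ℝ} {i₀ : Fin n} {H : Cn n → ℝ} {G : Cn n → Cn n}
  {K M M' C γ δ : ℝ}

theorem trig_add_one {N : ℕ} (c : Coef n N) (t : ℝ) : trig c (t + 1) = trig c t := by
  simp only [trig, expI_add_one]

theorem trig_fract {N : ℕ} (c : Coef n N) (t : ℝ) : trig c (Int.fract t) = trig c t := by
  have h : Function.Periodic (trig c) 1 := trig_add_one c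
  have h1 := h.sub_int_mul_eq (x := t) ⌊t⌋
  rwa [mul_one] at h1

/-- Galerkin solutions have a pointwise convergent subsequence. -/
theorem exists_tendsto_trig {A B : ℝ} (hA0 : 0 ≤ A) {deg : ℕ → ℕ} (c : ∀ m : ℕ, Coef n (deg m))
    (hB : ∀ m, ‖c m‖ ≤ B)
    (hA : ∀ m, ‖(WithLp.toLp 2 fun k => (2 * π * k.1 : ℝ) • c m k : Coef n (deg m))‖ ^ 2 ≤ A) :
    ∃ x : ℝ → Cn n, Continuous x ∧ (∀ t, x (t + 1) = x t) ∧ ∃ φ : ℕ → ℕ, StrictMono φ ∧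
      ∀ t, Tendsto (fun m => trig (c (φ m)) t) atTop (𝓝 (x t)) := by
  let F : ℕ → BoundedContinuousFunction (Icc (0 : ℝ) 1) (Cn n) := fun m =>
    BoundedContinuousFunction.mkOfCompact ⟨fun t => trig (c m) t, by fun_prop⟩
  have hF : ∀ m t, F m t = trig (c m) t := fun m t => rfl
  have hcpt := BoundedContinuousFunction.arzela_ascoli (closedBall (0 : Cn n) ((A + 1) / 2 + B))
    (isCompact_closedBall _ _) (range F) (by
      rintro _ t ⟨m, rfl⟩
      rw [hF, mem_closedBall_zero_iff]
      exact norm_trig_le (c m) hA0 (hA m) (hB m) t.2) (by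
      refine (Metric.uniformEquicontinuous_of_continuity_modulus
        (fun r => (A + 1) / 2 * √r) ?_ _ ?_).equicontinuous
      · have : Continuous fun r : ℝ => (A + 1) / 2 * √r := by fun_prop
        simpa using this.tendsto 0
      · rintro s t ⟨_, m, rfl⟩
        simp only [hF]
        rw [dist_eq_norm, Subtype.dist_eq, Real.dist_eq]
        exact norm_trig_sub_le (c m) (hA m) t.2 s.2)
  obtain ⟨f, -, φ, hφ, hlim⟩ := hcpt.tendsto_subseq fun m => subset_closure (mem_range_self (f := F) m)
  have hpt : ∀ t : Icc (0 : ℝ) 1, Tendsto (fun m => trig (c (φ m)) t) atTop (𝓝 (f t)) := fun t =>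
    ((BoundedContinuousFunction.lipschitz_eval_const t).continuous.tendsto f).comp hlim
  let x₀ : ℝ → Cn n := IccExtend zero_le_one f
  have hx₀ : Continuous x₀ := f.continuous.Icc_extend'
  have hpt' : ∀ t ∈ Icc (0 : ℝ) 1, Tendsto (fun m => trig (c (φ m)) t) atTop (𝓝 (x₀ t)) := by
    intro t ht
    rw [show x₀ t = f ⟨t, ht⟩ from IccExtend_of_mem _ _ ht]
    exact hpt ⟨t, ht⟩
  have h01 : x₀ 0 = x₀ 1 := by
    refine tendsto_nhds_unique (hpt' 0 (by simp)) ?_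
    have := hpt' 1 (by simp)
    refine this.congr fun m => ?_
    rw [← trig_add_one (c (φ m)) 0, zero_add]
  refine ⟨x₀ ∘ Int.fract, ContinuousOn.comp_fract'' hx₀.continuousOn h01, fun t => ?_, φ, hφ,
    fun t => ?_⟩
  · simp only [Function.comp, Int.fract_add_one]
  · simp only [← trig_fract (c _) t]
    exact hpt' _ ⟨Int.fract_nonneg t, (Int.fract_lt_one t).le⟩

theorem fc_eq_of_hasDerivAt {y u : ℝ → Cn n} (hu : Continuous u)
    (hy : ∀ t, HasDerivAt y (u t) t) (hper : y 1 = y 0) (k : ℤ) :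
    fc u k = ((2 * π * k : ℝ) * Complex.I) • fc y k := by
  have hyc : Continuous y := continuous_iff_continuousAt.mpr fun t => (hy t).continuousAt
  have h1 : ∀ t, HasDerivAt (fun t => expI (-k) t • y t)
      (expI (-k) t • u t + ((2 * π * (-k : ℤ) : ℝ) * Complex.I * expI (-k) t) • y t) t := fun t =>
    (hasDerivAt_expI (-k) t).smul (hy t)
  have hc := continuous_expI (-k)
  have h2 := intervalIntegral.integral_eq_sub_of_hasDerivAt (a := 0) (b := 1) (fun t _ => h1 t)
    (Continuous.intervalIntegrable (by fun_prop) _ _)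
  have h3 : expI (-k) 1 = 1 := by
    rw [← zero_add (1 : ℝ), expI_add_one, expI_zero_right]
  simp only [h3, expI_zero_right, hper, sub_self, mul_smul] at h2
  rw [intervalIntegral.integral_add (Continuous.intervalIntegrable (by fun_prop) _ _)
    (Continuous.intervalIntegrable (by fun_prop) _ _), intervalIntegral.integral_smul,
    intervalIntegral.integral_smul] at h2
  have h4 : fc u k + ((2 * π * (-k : ℤ) : ℝ) : ℂ) • Complex.I • fc y k = 0 := h2
  rw [eq_neg_of_add_eq_zero_left h4, ← neg_smul, mul_smul]
  push_cast
  congr 1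
  ring

theorem tendsto_integral_comp {E : Type*} [NormedAddCommGroup E] [NormedSpace ℝ E]
    {F : ℝ × Cn n → E} (hF : Continuous F) {u : ℕ → ℝ → Cn n} (hu : ∀ m, Continuous (u m))
    {x : ℝ → Cn n} {ρ : ℝ} (hρ : ∀ m t, ‖u m t‖ ≤ ρ)
    (hlim : ∀ t, Tendsto (fun m => u m t) atTop (𝓝 (x t))) :
    Tendsto (fun m => ∫ t in (0 : ℝ)..1, F (t, u m t)) atTop
      (𝓝 (∫ t in (0 : ℝ)..1, F (t, x t))) := by
  obtain ⟨B, hB⟩ := (isCompact_Icc (a := (0 : ℝ)) (b := 1)).prod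
    (isCompact_closedBall (0 : Cn n) ρ) |>.exists_bound_of_continuousOn hF.continuousOn
  refine intervalIntegral.tendsto_integral_filter_of_dominated_convergence (fun _ => B)
    (Filter.Eventually.of_forall fun m => Continuous.aestronglyMeasurable ?_)
    (Filter.Eventually.of_forall fun m => Filter.Eventually.of_forall fun t ht => ?_) (by simp)
    (Filter.Eventually.of_forall fun t _ => ?_)
  · have := hu m
    fun_prop
  · rw [uIoc_of_le zero_le_one] at ht
    exact hB _ ⟨⟨ht.1.le, ht.2⟩, by simpa using hρ m t⟩
  · exact (hF.tendsto _).comp (tendsto_const_nhds.prodMk_nhds (hlim t))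

/-- An asymptotically quadratic Hamiltonian has a `1`-periodic orbit with positive action. -/
theorem IsAsympQuadratic.exists_periodic_orbit (h : IsAsympQuadratic b i₀ H G K M M' C γ δ) :
    ∃ x : ℝ → Cn n, (∀ t, HasDerivAt x (Complex.I • G (x t)) t) ∧ (∀ t, x (t + 1) = x t) ∧
      0 < ∫ t in (0 : ℝ)..1, (1 / 2 * inner ℝ (G (x t)) (x t) - H (x t)) ∧
      ∫ t in (0 : ℝ)..1, (1 / 2 * inner ℝ (G (x t)) (x t) - H (x t)) ≤ C := by
  have hG := h.contG
  have hH := h.contH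
  obtain ⟨A, B, hA0, hAB⟩ := h.exists_bounds
  have hex : ∀ m : ℕ, ∃ c : Coef n (m + 1), gradN G c = 0 ∧ π ^ 2 / (4 * M') / 2 ≤ actN H c ∧
      actN H c ≤ C := fun m => h.exists_critical (Nat.le_add_left 1 m)
  choose c hc0 hcl hcu using hex
  have hB := fun m => (hAB (m + 1) (c m) (hc0 m)).1
  have hA := fun m => (hAB (m + 1) (c m) (hc0 m)).2
  obtain ⟨x, hx, hper, φ, hφ, hlim⟩ := exists_tendsto_trig hA0 c hB hA
  have hbd : ∀ m t, ‖trig (c (φ m)) t‖ ≤ (A + 1) / 2 + B := fun m t => by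
    rw [← trig_fract]
    exact norm_trig_le _ hA0 (hA _) (hB _) ⟨Int.fract_nonneg t, (Int.fract_lt_one t).le⟩
  have hGx : Continuous fun t => G (x t) := hG.comp hx
  have hfc : ∀ k : ℤ, (2 * π * k : ℝ) • fc x k = fc (fun t => G (x t)) k := by
    intro k
    have hk := continuous_expI (-k)
    have h1 := tendsto_integral_comp (F := fun q => expI (-k) q.1 • q.2)
      (by fun_prop) (fun m => continuous_trig (c (φ m))) hbd hlim
    have h2 := tendsto_integral_comp (F := fun q => expI (-k) q.1 • G q.2)
      (by fun_prop) (fun m => continuous_trig (c (φ m))) hbd hlim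
    refine tendsto_nhds_unique (h1.const_smul (2 * π * k : ℝ)) (h2.congr' ?_)
    filter_upwards [eventually_ge_atTop k.natAbs] with m hm
    have hm' : k.natAbs ≤ φ m + 1 := hm.trans (hφ.le_apply.trans (Nat.le_succ _))
    have hmem : k ∈ Finset.Icc (-((φ m + 1 : ℕ) : ℤ)) ((φ m + 1 : ℕ) : ℤ) := by
      rw [Finset.mem_Icc]; omega
    have h3 : gradN G (c (φ m)) ⟨k, hmem⟩ = 0 := by rw [hc0]; rfl
    have h4 := fc_trig (c (φ m)) ⟨k, hmem⟩
    have h5 : (2 * π * k : ℝ) • c (φ m) ⟨k, hmem⟩ - fc (fun t => G (trig (c (φ m)) t)) k = 0 := h3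
    rw [← h4] at h5
    exact (sub_eq_zero.mp h5).symm
  have hval : ∀ m, actN H (c m) = ∫ t in (0 : ℝ)..1,
      (1 / 2 * inner ℝ (G (trig (c m) t)) (trig (c m) t) - H (trig (c m) t)) := by
    intro m
    have h1 := inner_gradN hG (c m) (c m)
    rw [hc0, inner_zero_left] at h1
    simp only [real_inner_self_eq_norm_sq] at h1
    rw [intervalIntegral.integral_sub (Continuous.intervalIntegrable (by fun_prop) _ _)
      (Continuous.intervalIntegrable (by fun_prop) _ _), intervalIntegral.integral_const_mul, actN]
    linarith
  have hact := tendsto_integral_comp (F := fun q => 1 / 2 * inner ℝ (G q.2) q.2 - H q.2)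
    (by fun_prop) (fun m => continuous_trig (c (φ m))) hbd hlim
  simp only [← hval] at hact
  have hpos : 0 < π ^ 2 / (4 * M') / 2 := by have := h.posM'; positivity
  refine ⟨x, ?_, hper, hpos.trans_le (ge_of_tendsto' hact fun m => hcl _),
    le_of_tendsto' hact fun m => hcu _⟩
  have hu : Continuous fun t => Complex.I • G (x t) := by fun_prop
  let y : ℝ → Cn n := fun t => ∫ s in (0 : ℝ)..t, Complex.I • G (x s)
  have hy : ∀ t, HasDerivAt y (Complex.I • G (x t)) t := fun t =>
    intervalIntegral.integral_hasDerivAt_right (hu.intervalIntegrable _ _)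
      (hu.stronglyMeasurableAtFilter _ _) hu.continuousAt
  have hyc : Continuous y := continuous_iff_continuousAt.mpr fun t => (hy t).continuousAt
  have hfcu : ∀ k, fc (fun t => Complex.I • G (x t)) k = Complex.I • fc (fun t => G (x t)) k := by
    intro k
    simp only [fc, smul_comm _ Complex.I]
    exact intervalIntegral.integral_smul _ _
  have h01 : ∫ s in (0 : ℝ)..1, Complex.I • G (x s) = 0 := by
    have h1 := hfcu 0
    rw [← hfc 0] at h1
    simpa [fc, expI_zero_left] using h1
  have hyper : ∀ t, y (t + 1) = y t := by
    intro t
    have hp : Function.Periodic (fun s => Complex.I • G (x s)) 1 := fun s => by simp only [hper]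
    have h1 := intervalIntegral.integral_add_adjacent_intervals (a := 0) (b := t) (c := t + 1)
      (hu.intervalIntegrable (μ := volume) _ _) (hu.intervalIntegrable _ _)
    rw [hp.intervalIntegral_add_eq t 0, zero_add, h01, add_zero] at h1
    exact h1.symm
  have hy1 : y 1 = y 0 := by rw [← zero_add (1 : ℝ), hyper]
  let d : ℝ → Cn n := fun t => x t - y t - (fc x 0 - fc y 0)
  have hd0 : ∀ t, d t = 0 := by
    refine Cn.eq_zero_of_fc_eq_zero (by fun_prop) (fun t => by simp only [d, hper, hyper])
      fun k => ?_
    have h1 : fc d k = fc x k - fc y k - (∫ t in (0 : ℝ)..1, expI (-k) t) • (fc x 0 - fc y 0) := by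
      have hk := continuous_expI (-k)
      simp only [fc, d, smul_sub (expI (-k) _)]
      rw [intervalIntegral.integral_sub (Continuous.intervalIntegrable (by fun_prop) _ _)
        (Continuous.intervalIntegrable (by fun_prop) _ _),
        intervalIntegral.integral_sub (Continuous.intervalIntegrable (by fun_prop) _ _)
        (Continuous.intervalIntegrable (by fun_prop) _ _),
        intervalIntegral.integral_sub (Continuous.intervalIntegrable (by fun_prop) _ _)
        (Continuous.intervalIntegrable (by fun_prop) _ _), intervalIntegral.integral_smul_const,
        intervalIntegral.integral_smul_const, smul_sub]
    rw [h1, integral_expI]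
    by_cases hk : k = 0
    · subst hk; simp
    · rw [if_neg (by omega), zero_smul, sub_zero]
      have h2 := fc_eq_of_hasDerivAt hu hy hy1 k
      rw [hfcu, ← hfc, mul_comm ((2 * π * k : ℝ) : ℂ), mul_smul Complex.I] at h2
      have h3 : ((2 * π * k : ℝ) : ℂ) ≠ 0 := by
        simp [Real.pi_ne_zero, hk]
      have h4 := smul_right_injective _ Complex.I_ne_zero h2
      rw [Complex.coe_smul] at h4
      have h5 : (2 * π * k : ℝ) ≠ 0 := by exact_mod_cast h3
      rw [smul_right_injective _ h5 h4, sub_self]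
  have hxy : x = fun t => y t + (fc x 0 - fc y 0) := by
    funext t
    have := sub_eq_zero.mp (hd0 t)
    rw [← this]; abel
  intro t
  have := (hy t).add_const (fc x 0 - fc y 0)
  rwa [← hxy] at this

end Limit

section Symplectic

variable {n : ℕ}

theorem Cn.inner_I_smul_smul (u v : Cn n) :
    inner ℝ (Complex.I • u) (Complex.I • v) = inner ℝ u v := by
  rw [Cn.inner_def, Cn.inner_def]
  refine Finset.sum_congr rfl fun i _ => ?_
  simp

theorem Cn.inner_I_smul_left (u v : Cn n) :
    inner ℝ (Complex.I • u) v = -inner ℝ u (Complex.I • v) := by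
  rw [Cn.inner_def, Cn.inner_def, ← Finset.sum_neg_distrib]
  refine Finset.sum_congr rfl fun i _ => ?_
  simp
  ring

theorem Cn.inner_I_smul_self (u : Cn n) : inner ℝ (Complex.I • u) u = 0 := by
  have h := Cn.inner_I_smul_left u u
  rw [real_inner_comm (Complex.I • u) u] at h
  linarith

theorem Cn.I_smul_I_smul (u : Cn n) : Complex.I • Complex.I • u = -u := by
  rw [smul_smul, Complex.I_mul_I, neg_one_smul]

/-- The standard symplectic form on `ℂⁿ`. -/
def symp (u v : Cn n) : ℝ := inner ℝ (Complex.I • u) v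

/-- Multiplication by `i` as a real-linear map. -/
def mulI (n : ℕ) : Cn n →L[ℝ] Cn n := Complex.I • ContinuousLinearMap.id ℝ (Cn n)

/-- The standard symplectic form as a continuous bilinear map. -/
def sympL (n : ℕ) : Cn n →L[ℝ] Cn n →L[ℝ] ℝ := (innerSL ℝ).comp (mulI n)

theorem sympL_apply (u v : Cn n) : sympL n u v = symp u v := rfl

theorem symp_swap (u v : Cn n) : symp u v = -symp v u := by
  simp only [symp]
  rw [Cn.inner_I_smul_left, real_inner_comm]

/-- A smooth symplectic embedding of an open set of `ℂⁿ`. -/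
structure IsSymp (φ : Cn n → Cn n) (N : Set (Cn n)) : Prop where
  isOpen : IsOpen N
  smooth : ContDiffOn ℝ ∞ φ N
  inj : InjOn φ N
  symp : ∀ p ∈ N, ∀ v w, symp (fderiv ℝ φ p v) (fderiv ℝ φ p w) = symp v w

theorem injective_of_symp {A : Cn n →L[ℝ] Cn n} (hA : ∀ v w, symp (A v) (A w) = symp v w) :
    Function.Injective A := by
  refine (injective_iff_map_eq_zero A).2 fun v hv => ?_
  have h := hA v (Complex.I • v)
  rw [hv, symp, symp, smul_zero, inner_zero_left, real_inner_self_eq_norm_sq, norm_smul] at h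
  simpa using h.symm

theorem det_comp_real (A B : Cn n →L[ℝ] Cn n) : (A.comp B).det = A.det * B.det :=
  LinearMap.det_comp (A : Cn n →ₗ[ℝ] Cn n) (B : Cn n →ₗ[ℝ] Cn n)

theorem det_adjoint_real (A : Cn n →L[ℝ] Cn n) : (ContinuousLinearMap.adjoint A).det = A.det := by
  let v := stdOrthonormalBasis ℝ (Cn n)
  have h := LinearMap.toMatrix_adjoint v v (A : Cn n →ₗ[ℝ] Cn n)
  have h2 := congrArg Matrix.det h
  rw [Matrix.det_conjTranspose, LinearMap.det_toMatrix, LinearMap.det_toMatrix] at h2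
  rw [LinearMap.adjoint_eq_toCLM_adjoint] at h2
  exact h2

theorem abs_det_of_symp {A : Cn n →L[ℝ] Cn n} (hA : ∀ v w, symp (A v) (A w) = symp v w) :
    |A.det| = 1 := by
  have h : (ContinuousLinearMap.adjoint A).comp ((mulI n).comp A) = mulI n := by
    ext1 v
    refine ext_inner_right ℝ fun w => ?_
    rw [ContinuousLinearMap.comp_apply, ContinuousLinearMap.adjoint_inner_left]
    exact hA v w
  have hI : (mulI n).det ≠ 0 := by
    have h2 : (mulI n).comp (mulI n) = -ContinuousLinearMap.id ℝ (Cn n) := by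
      ext1 v
      exact Cn.I_smul_I_smul v
    intro h0
    have h3 := det_comp_real (mulI n) (mulI n)
    rw [h0, mul_zero, h2, ContinuousLinearMap.det] at h3
    have h4 : ((-ContinuousLinearMap.id ℝ (Cn n) : Cn n →L[ℝ] Cn n) : Cn n →ₗ[ℝ] Cn n) =
      (-1 : ℝ) • LinearMap.id := by ext1 v; simp
    rw [h4, LinearMap.det_smul] at h3
    simp at h3
  have h5 := congrArg ContinuousLinearMap.det h
  rw [det_comp_real, det_comp_real, det_adjoint_real] at h5
  have h7 : A.det ^ 2 = 1 := by
    apply mul_right_cancel₀ hI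
    linear_combination h5
  rcases sq_eq_one_iff.1 h7 with h8 | h8 <;> simp [h8]

namespace IsSymp

variable {φ : Cn n → Cn n} {N : Set (Cn n)}

theorem contDiffAt (hφ : IsSymp φ N) {w : Cn n} (hw : w ∈ N) : ContDiffAt ℝ ∞ φ w :=
  hφ.smooth.contDiffAt (hφ.isOpen.mem_nhds hw)

theorem hasFDerivAt (hφ : IsSymp φ N) {w : Cn n} (hw : w ∈ N) : HasFDerivAt φ (fderiv ℝ φ w) w :=
  ((hφ.contDiffAt hw).differentiableAt (by simp)).hasFDerivAt

theorem exists_equiv (hφ : IsSymp φ N) {w : Cn n} (hw : w ∈ N) :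
    ∃ A : Cn n ≃L[ℝ] Cn n, (A : Cn n →L[ℝ] Cn n) = fderiv ℝ φ w :=
  ⟨(LinearEquiv.ofInjectiveEndo (fderiv ℝ φ w : Cn n →ₗ[ℝ] Cn n)
    (injective_of_symp (hφ.symp w hw))).toContinuousLinearEquiv, by ext1 v; rfl⟩

theorem map_nhds (hφ : IsSymp φ N) {w : Cn n} (hw : w ∈ N) : map φ (𝓝 w) = 𝓝 (φ w) := by
  obtain ⟨A, hA⟩ := hφ.exists_equiv hw
  have h : HasStrictFDerivAt φ (A : Cn n →L[ℝ] Cn n) w := by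
    rw [hA]
    exact (hφ.contDiffAt hw).hasStrictFDerivAt (by simp)
  exact h.map_nhds_eq_of_equiv

theorem exists_chart (hφ : IsSymp φ N) : ∃ e : OpenPartialHomeomorph (Cn n) (Cn n),
    (∀ w, e w = φ w) ∧ e.source = N ∧ e.target = φ '' N ∧
      ∀ z ∈ e.target, ContDiffAt ℝ ∞ e.symm z := by
  let p := hφ.inj.bijOn_image.toPartialEquiv
  have hcont : ContinuousOn p p.source := hφ.smooth.continuousOn
  have hopen : IsOpenMap (p.source.domRestrict p) := by
    rw [isOpenMap_iff_nhds_le]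
    rintro ⟨w, hw⟩
    have h1 : map (p.source.domRestrict p) (𝓝 ⟨w, hw⟩) = map φ (map Subtype.val (𝓝 ⟨w, hw⟩)) := rfl
    have h2 : map Subtype.val (𝓝 (⟨w, hw⟩ : p.source)) = 𝓝 w :=
      map_nhds_subtype_coe_eq_nhds hw (hφ.isOpen.mem_nhds hw)
    rw [h1, h2, hφ.map_nhds hw]
    exact le_rfl
  let e := OpenPartialHomeomorph.ofContinuousOpenRestrict p hcont hopen hφ.isOpen
  refine ⟨e, fun w => rfl, rfl, rfl, fun z hz => ?_⟩
  have hs : e.symm z ∈ N := e.map_target hz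
  obtain ⟨A, hA⟩ := hφ.exists_equiv hs
  refine e.contDiffAt_symm (f₀' := A) hz ?_ (hφ.contDiffAt hs)
  rw [hA]
  exact hφ.hasFDerivAt hs

end IsSymp

end Symplectic

section Periods

theorem continuous_slice {X Y Z : Type*} [TopologicalSpace X] [TopologicalSpace Y]
    [TopologicalSpace Z] {F : X × Y → Z} {s : Set X} (hF : ContinuousOn F (s ×ˢ univ)) {x : X}
    (hx : x ∈ s) : Continuous fun t => F (x, t) :=
  continuousOn_univ.1 (hF.comp (Continuous.prodMk_right x).continuousOn fun _ _ => ⟨hx, mem_univ _⟩)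

variable {E : Type*} [NormedAddCommGroup E] [NormedSpace ℂ E] [NormedSpace ℝ E]
  [IsScalarTower ℝ ℂ E]

/-- The family of linear maps `id + (e^{2πit} - 1) P`. -/
def circ (P : E →L[ℂ] E) (t : ℝ) : E →L[ℝ] E :=
  ContinuousLinearMap.id ℝ E + (expI 1 t - 1) • P.restrictScalars ℝ

theorem circ_apply (P : E →L[ℂ] E) (t : ℝ) (w : E) :
    circ P t w = w + (expI 1 t - 1) • P w := rfl

theorem continuous_circ (P : E →L[ℂ] E) : Continuous (circ P) := by
  have := continuous_expI 1
  unfold circ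
  fun_prop

/-- The velocity of `circ P t`. -/
def circVel (P : E →L[ℂ] E) (t : ℝ) : E →L[ℝ] E :=
  (2 * π * Complex.I * expI 1 t) • P.restrictScalars ℝ

theorem circVel_apply (P : E →L[ℂ] E) (t : ℝ) (w : E) :
    circVel P t w = (2 * π * Complex.I * expI 1 t) • P w := rfl

theorem continuous_circVel (P : E →L[ℂ] E) : Continuous (circVel P) := by
  have := continuous_expI 1
  unfold circVel
  fun_prop

theorem hasDerivAt_circ (P : E →L[ℂ] E) (t : ℝ) (w : E) :
    HasDerivAt (fun t => circ P t w) (circVel P t w) t := by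
  have h := (((hasDerivAt_expI 1 t).sub_const 1).smul_const (P w)).const_add w
  refine h.congr_deriv ?_
  rw [circVel_apply]
  push_cast
  rw [mul_one]

theorem circ_zero (P : E →L[ℂ] E) (w : E) : circ P 0 w = w := by
  simp [circ_apply, expI_zero_right]

theorem circ_one (P : E →L[ℂ] E) (w : E) : circ P 1 w = w := by
  have := expI_add_one 1 0
  rw [zero_add, expI_zero_right] at this
  simp [circ_apply, this]

/-- The period of a one-form along the loops `t ↦ circ P t w`. -/
def period (η : E → E →L[ℝ] ℝ) (P : E →L[ℂ] E) (w : E) : ℝ :=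
  ∫ t in (0 : ℝ)..1, η (circ P t w) (circVel P t w)

variable {η : E → E →L[ℝ] ℝ} {N : Set E} {P : E →L[ℂ] E}

theorem hasFDerivAt_period [FiniteDimensional ℝ E] (hN : IsOpen N) (hη : ContDiffOn ℝ 1 η N)
    (hsymm : ∀ w ∈ N, ∀ u v, fderiv ℝ η w u v = fderiv ℝ η w v u)
    (hP : ∀ t, MapsTo (circ P t) N N) {w : E} (hw : w ∈ N) :
    HasFDerivAt (period η P) (0 : E →L[ℝ] ℝ) w := by
  have hd : ∀ x ∈ N, HasFDerivAt η (fderiv ℝ η x) x := fun x hx =>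
    ((hη.contDiffAt (hN.mem_nhds hx)).differentiableAt (by simp)).hasFDerivAt
  have hηc : ContinuousOn η N := hη.continuousOn
  have hdc : ContinuousOn (fderiv ℝ η) N := hη.continuousOn_fderiv_of_isOpen hN le_rfl
  obtain ⟨r, hr, hrN⟩ := Metric.nhds_basis_closedBall.mem_iff.1 (hN.mem_nhds hw)
  let D : E → ℝ → E →L[ℝ] ℝ := fun x t =>
    ((fderiv ℝ η (circ P t x)).comp (circ P t)).flip (circVel P t x) +
      (η (circ P t x)).comp (circVel P t)
  have hcirc : Continuous fun p : E × ℝ => circ P p.2 p.1 :=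
    ((continuous_circ P).comp continuous_snd).clm_apply continuous_fst
  have hvel : Continuous fun p : E × ℝ => circVel P p.2 p.1 :=
    ((continuous_circVel P).comp continuous_snd).clm_apply continuous_fst
  have hmap : MapsTo (fun p : E × ℝ => circ P p.2 p.1) (N ×ˢ univ) N := fun p hp => hP _ hp.1
  have hDc : ContinuousOn (fun p : E × ℝ => D p.1 p.2) (N ×ˢ univ) := by
    have h1 : ContinuousOn (fun p : E × ℝ => fderiv ℝ η (circ P p.2 p.1)) (N ×ˢ univ) :=
      hdc.comp hcirc.continuousOn hmap
    have h2 : ContinuousOn (fun p : E × ℝ => η (circ P p.2 p.1)) (N ×ˢ univ) :=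
      hηc.comp hcirc.continuousOn hmap
    have h3 : Continuous fun p : E × ℝ => circ P p.2 := (continuous_circ P).comp continuous_snd
    have h4 : Continuous fun p : E × ℝ => circVel P p.2 :=
      (continuous_circVel P).comp continuous_snd
    have h5 := h1.clm_comp h3.continuousOn
    have h6 := (ContinuousLinearMap.flipₗᵢ ℝ E E ℝ).continuous.comp_continuousOn h5
    have h7 := h6.clm_apply hvel.continuousOn
    exact h7.add (h2.clm_comp h4.continuousOn)
  have hFc : ContinuousOn (fun p : E × ℝ => η (circ P p.2 p.1) (circVel P p.2 p.1))
      (N ×ˢ univ) := (hηc.comp hcirc.continuousOn hmap).clm_apply hvel.continuousOn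
  have hslice : ∀ x ∈ N, Continuous fun t : ℝ => η (circ P t x) (circVel P t x) := fun x hx =>
    continuous_slice hFc hx
  have hDslice : Continuous fun t : ℝ => D w t := continuous_slice hDc hw
  obtain ⟨B, hB⟩ := ((isCompact_closedBall w r).prod (isCompact_Icc (a := (0 : ℝ)) (b := 1))
    ).exists_bound_of_continuousOn (hDc.mono (prod_mono hrN (subset_univ _)))
  have key := intervalIntegral.hasFDerivAt_integral_of_dominated_of_fderiv_le (𝕜 := ℝ)
    (μ := volume) (a := 0) (b := 1) (F := fun x t => η (circ P t x) (circVel P t x)) (F' := D)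
    (bound := fun _ => B) (closedBall_mem_nhds w hr)
    (Filter.eventually_of_mem (hN.mem_nhds hw) fun x hx => (hslice x hx).aestronglyMeasurable)
    ((hslice w hw).intervalIntegrable _ _) hDslice.aestronglyMeasurable
    (Filter.Eventually.of_forall fun t ht x hx => hB (x, t) ⟨hx, by
      rw [uIoc_of_le zero_le_one] at ht
      exact ⟨ht.1.le, ht.2⟩⟩) intervalIntegrable_const
    (Filter.Eventually.of_forall fun t _ x hx => by
      have h1 := (hd _ (hP t (hrN hx))).comp x (circ P t).hasFDerivAt
      have h2 := h1.clm_apply (circVel P t).hasFDerivAt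
      refine h2.congr_fderiv ?_
      ext v
      exact add_comm (η (circ P t x) (circVel P t v))
        (fderiv ℝ η (circ P t x) (circ P t v) (circVel P t x)))
  suffices h0 : ∫ t in (0 : ℝ)..1, D w t = 0 by
    rw [h0] at key
    exact key
  refine ContinuousLinearMap.ext fun v => ?_
  have hDint : IntervalIntegrable (fun t => D w t) volume 0 1 := hDslice.intervalIntegrable _ _
  rw [ContinuousLinearMap.intervalIntegral_apply hDint]
  have hderiv : ∀ t ∈ uIcc (0 : ℝ) 1,
      HasDerivAt (fun t => η (circ P t w) (circ P t v)) (D w t v) t := by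
    intro t _
    have h1 := (hd _ (hP t hw)).comp_hasDerivAt t (hasDerivAt_circ P t w)
    have h2 := h1.clm_apply (hasDerivAt_circ P t v)
    refine h2.congr_deriv ?_
    change _ = fderiv ℝ η (circ P t w) (circ P t v) (circVel P t w) + _
    rw [hsymm _ (hP t hw)]
    rfl
  rw [intervalIntegral.integral_eq_sub_of_hasDerivAt hderiv
    ((hDslice.clm_apply continuous_const).intervalIntegrable _ _)]
  simp only [circ_zero, circ_one, sub_self]
  rfl

theorem period_eq [FiniteDimensional ℝ E] (hN : IsOpen N) (hNc : IsPreconnected N) (hη : ContDiffOn ℝ 1 η N)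
    (hsymm : ∀ w ∈ N, ∀ u v, fderiv ℝ η w u v = fderiv ℝ η w v u)
    (hP : ∀ t, MapsTo (circ P t) N N) {w w' : E} (hw : w ∈ N) (hw' : w' ∈ N) :
    period η P w = period η P w' :=
  hN.is_const_of_fderiv_eq_zero (𝕜 := ℝ) hNc
    (fun _ hx => (hasFDerivAt_period hN hη hsymm hP hx).differentiableAt.differentiableWithinAt)
    (fun _ hx => (hasFDerivAt_period hN hη hsymm hP hx).fderiv) hw hw'

end Periods

section Primitive

theorem two_le_smooth : (1 : ℕ∞ω) + 1 ≤ (∞ : ℕ∞ω) := by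
  exact WithTop.coe_le_coe.2 (le_top : (2 : ℕ∞) ≤ ⊤)

variable {E : Type*} [NormedAddCommGroup E] [NormedSpace ℝ E]

/-- The difference of the pull-back under `φ` of the radial primitive of the form `B` and the
primitive itself. -/
def primDiff (B : E →L[ℝ] E →L[ℝ] ℝ) (φ : E → E) (w : E) : E →L[ℝ] ℝ :=
  (1 / 2 : ℝ) • ((B (φ w)).comp (fderiv ℝ φ w) - B w)

variable {B : E →L[ℝ] E →L[ℝ] ℝ} {φ : E → E} {N : Set E}

theorem primDiff_apply (w v : E) :
    primDiff B φ w v = 1 / 2 * (B (φ w) (fderiv ℝ φ w v) - B w v) := rfl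

theorem contDiffOn_primDiff (hN : IsOpen N) (hφ : ContDiffOn ℝ ∞ φ N) :
    ContDiffOn ℝ 1 (primDiff B φ) N := by
  have h1 : ContDiffOn ℝ 1 (fderiv ℝ φ) N := hφ.fderiv_of_isOpen hN two_le_smooth
  have h2 : ContDiffOn ℝ 1 φ N := hφ.of_le (by exact_mod_cast le_top)
  have h3 : ContDiffOn ℝ 1 (fun w => B (φ w)) N := B.contDiff.comp_contDiffOn h2
  exact ((h3.clm_comp h1).sub B.contDiff.contDiffOn).const_smul _

theorem fderiv_primDiff_symm (hN : IsOpen N) (hφ : ContDiffOn ℝ ∞ φ N)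
    (hB : ∀ p ∈ N, ∀ v w, B (fderiv ℝ φ p v) (fderiv ℝ φ p w) = B v w) {w : E} (hw : w ∈ N)
    (u v : E) : fderiv ℝ (primDiff B φ) w u v = fderiv ℝ (primDiff B φ) w v u := by
  have hφw := hφ.contDiffAt (hN.mem_nhds hw)
  have h1 : ContDiffOn ℝ 1 (fderiv ℝ φ) N := hφ.fderiv_of_isOpen hN two_le_smooth
  have hd2 : HasFDerivAt (fderiv ℝ φ) (fderiv ℝ (fderiv ℝ φ) w) w :=
    ((h1.contDiffAt (hN.mem_nhds hw)).differentiableAt (by simp)).hasFDerivAt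
  have hd1 : HasFDerivAt φ (fderiv ℝ φ w) w := (hφw.differentiableAt (by simp)).hasFDerivAt
  have hBφ : HasFDerivAt (fun x => B (φ x)) (B.comp (fderiv ℝ φ w)) w := B.hasFDerivAt.comp w hd1
  have key : ∀ u v, fderiv ℝ (primDiff B φ) w u v =
      1 / 2 * B (φ w) (fderiv ℝ (fderiv ℝ φ) w u v) := by
    intro u v
    have h2 := (((hBφ.clm_comp hd2).sub B.hasFDerivAt).const_smul (1 / 2 : ℝ)).fderiv
    have h3 := DFunLike.congr_fun (DFunLike.congr_fun h2 u) v
    have h4 : fderiv ℝ (primDiff B φ) w u v = 1 / 2 * ((B (φ w) (fderiv ℝ (fderiv ℝ φ) w u v) +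
      B (fderiv ℝ φ w u) (fderiv ℝ φ w v)) - B u v) := h3
    rw [h4, hB w hw]
    ring
  rw [key, key, (hφw.isSymmSndFDerivAt (by
    rw [minSmoothness_of_isRCLikeNormedField, ← one_add_one_eq_two]
    exact two_le_smooth)).eq]

end Primitive

section Shell

variable {n : ℕ}

/-- The open spherical shell of points with squared norm in `(α, β)`. -/
def shell (n : ℕ) (α β : ℝ) : Set (Cn n) := (fun w => ‖w‖ ^ 2) ⁻¹' Ioo α β

theorem mem_shell {α β : ℝ} {w : Cn n} : w ∈ shell n α β ↔ α < ‖w‖ ^ 2 ∧ ‖w‖ ^ 2 < β := Iff.rfl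

theorem isOpen_shell (α β : ℝ) : IsOpen (shell n α β) :=
  isOpen_Ioo.preimage (by fun_prop)

theorem one_lt_rank_Cn (hn : 1 ≤ n) : 1 < Module.rank ℝ (Cn n) := by
  have h : Module.finrank ℝ (Cn n) = 2 * n := by
    rw [← Module.finrank_mul_finrank ℝ ℂ (Cn n), finrank_euclideanSpace_fin,
      Complex.finrank_real_complex]
  rw [← Module.finrank_eq_rank, h]
  exact_mod_cast (by omega : 1 < 2 * n)

theorem isPreconnected_norm_mem (hn : 1 ≤ n) {S : Set ℝ} (hS : IsPreconnected S)
    (hpos : ∀ s ∈ S, 0 < s) : IsPreconnected {w : Cn n | ‖w‖ ∈ S} := by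
  have h := (hS.prod (isPreconnected_sphere (one_lt_rank_Cn hn) (0 : Cn n) 1)).image
    (fun p : ℝ × Cn n => p.1 • p.2) (by fun_prop)
  convert h using 1
  ext w
  constructor
  · intro hw
    have hw0 : 0 < ‖w‖ := hpos _ hw
    refine ⟨(‖w‖, ‖w‖⁻¹ • w), ⟨hw, ?_⟩, ?_⟩
    · simp [norm_smul, hw0.ne']
    · simp [smul_smul, hw0.ne']
  · rintro ⟨⟨s, v⟩, ⟨hs, hv⟩, rfl⟩
    have hv1 : ‖v‖ = 1 := by simpa using hv
    have hs0 := hpos s hs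
    simpa [norm_smul, hv1, abs_of_pos hs0] using hs

theorem isPreconnected_shell (hn : 1 ≤ n) {α β : ℝ} (hα : 0 ≤ α) :
    IsPreconnected (shell n α β) := by
  convert isPreconnected_norm_mem hn (isPreconnected_Ioo (a := √α) (b := √β))
    (fun s hs => (Real.sqrt_nonneg α).trans_lt hs.1) using 1
  ext w
  have h : α < ‖w‖ ^ 2 ∧ ‖w‖ ^ 2 < β ↔ √α < ‖w‖ ∧ ‖w‖ < √β := by
    rw [Real.sqrt_lt hα (norm_nonneg w), Real.lt_sqrt (norm_nonneg w)]
  exact h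

/-- The projection to a complex coordinate axis. -/
def coordProj (i : Fin n) : Cn n →L[ℂ] Cn n :=
  (EuclideanSpace.proj i : Cn n →L[ℂ] ℂ).smulRight (EuclideanSpace.single i 1)

theorem coordProj_apply (i j : Fin n) (w : Cn n) :
    coordProj i w j = if j = i then w i else 0 := by
  simp [coordProj]

theorem norm_circ_id (t : ℝ) (w : Cn n) : ‖circ (ContinuousLinearMap.id ℂ (Cn n)) t w‖ = ‖w‖ := by
  have h : circ (ContinuousLinearMap.id ℂ (Cn n)) t w = expI 1 t • w := by
    rw [circ_apply, ContinuousLinearMap.id_apply, sub_smul, one_smul, add_sub_cancel]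
  rw [h, norm_smul, norm_expI, one_mul]

theorem norm_circ_coordProj (i : Fin n) (t : ℝ) (w : Cn n) : ‖circ (coordProj i) t w‖ = ‖w‖ := by
  have h : ‖circ (coordProj i) t w‖ ^ 2 = ‖w‖ ^ 2 := by
    rw [Cn.norm_sq, Cn.norm_sq]
    refine Finset.sum_congr rfl fun j _ => ?_
    have h : circ (coordProj i) t w j = w j + (expI 1 t - 1) * coordProj i w j := rfl
    rw [h, coordProj_apply]
    split_ifs with hj
    · rw [hj]
      have : w i + (expI 1 t - 1) * w i = expI 1 t * w i := by ring
      rw [this, norm_mul, norm_expI, one_mul]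
    · simp
  exact (sq_eq_sq₀ (norm_nonneg _) (norm_nonneg _)).1 h

theorem period_id_eq_zero (hn : 2 ≤ n) {α β : ℝ} (hα : 0 ≤ α) {η : Cn n → Cn n →L[ℝ] ℝ}
    (hη : ContDiffOn ℝ 1 η (shell n α β))
    (hsymm : ∀ w ∈ shell n α β, ∀ u v, fderiv ℝ η w u v = fderiv ℝ η w v u) {w : Cn n}
    (hw : w ∈ shell n α β) : period η (ContinuousLinearMap.id ℂ (Cn n)) w = 0 := by
  let i : Fin n := ⟨0, by omega⟩
  let j : Fin n := ⟨1, by omega⟩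
  have hij : j ≠ i := by simp [i, j, Fin.ext_iff]
  have hmem : ∀ k : Fin n, EuclideanSpace.single k (‖w‖ : ℂ) ∈ shell n α β := by
    intro k
    have : ‖EuclideanSpace.single k (‖w‖ : ℂ)‖ = ‖w‖ := by simp
    simpa only [mem_shell, this] using hw
  have hN := isOpen_shell (n := n) α β
  have hNc := isPreconnected_shell (n := n) (β := β) (by omega) hα
  have h1 : ∀ t, MapsTo (circ (ContinuousLinearMap.id ℂ (Cn n)) t) (shell n α β) (shell n α β) := by
    intro t v hv
    simpa only [mem_shell, norm_circ_id] using hv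
  have h2 : ∀ t, MapsTo (circ (coordProj i) t) (shell n α β) (shell n α β) := by
    intro t v hv
    simpa only [mem_shell, norm_circ_coordProj] using hv
  have e1 : coordProj i (EuclideanSpace.single i (‖w‖ : ℂ)) = EuclideanSpace.single i (‖w‖ : ℂ) := by
    ext k
    rw [coordProj_apply]
    by_cases hk : k = i <;> simp [hk]
  have e2 : coordProj i (EuclideanSpace.single j (‖w‖ : ℂ)) = 0 := by
    ext k
    rw [coordProj_apply]
    simp [hij.symm]
  rw [period_eq hN hNc hη hsymm h1 hw (hmem i)]
  have h3 : period η (ContinuousLinearMap.id ℂ (Cn n)) (EuclideanSpace.single i (‖w‖ : ℂ)) =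
      period η (coordProj i) (EuclideanSpace.single i (‖w‖ : ℂ)) := by
    simp only [period, circ_apply, circVel_apply, e1, ContinuousLinearMap.id_apply]
  rw [h3, period_eq hN hNc hη hsymm h2 (hmem i) (hmem j)]
  simp only [period, circVel_apply, e2, smul_zero, map_zero, intervalIntegral.integral_zero]

end Shell

section Extension

variable {E : Type*} [NormedAddCommGroup E] [NormedSpace ℝ E]

theorem eq_empty_of_isClopen_of_disjoint {X : Type*} [TopologicalSpace X] [PreconnectedSpace X]
    {S T : Set X} (hS : IsClopen S) (hT : T.Nonempty) (hST : Disjoint S T) : S = ∅ := by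
  rcases isClopen_iff.1 hS with h | h
  · exact h
  · obtain ⟨x, hx⟩ := hT
    exact absurd hx (Set.disjoint_left.1 hST (by rw [h]; trivial))

/-- A function on the image of a chart that is locally constant with two values outside a compact
set extends to the whole space with the same two values. -/
theorem exists_extension (e : OpenPartialHomeomorph E E)
    (he : ∀ z ∈ e.target, ContDiffAt ℝ ∞ e.symm z) (hpre : IsPreconnected e.source)
    {K : Set E} (hK : IsCompact K) (hKe : K ⊆ e.source) (hKne : K.Nonempty) {F : E → ℝ} {m : ℝ}
    (hF : ContDiff ℝ ∞ F)
    (hFK : ∀ w ∈ e.source, w ∉ K → (∀ᶠ x in 𝓝 w, F x = 0) ∨ (∀ᶠ x in 𝓝 w, F x = m)) :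
    ∃ H : E → ℝ, ContDiff ℝ 2 H ∧ (∀ w ∈ e.source, H (e w) = F w) ∧
      (∀ z ∉ e '' K, H z = 0 ∨ H z = m) ∧ (∀ z ∉ e '' K, fderiv ℝ H z = 0) := by
  classical
  let f : E → ℝ := F ∘ e.symm
  have hf : ∀ z ∈ e.target, ContDiffAt ℝ ∞ f z := fun z hz => hF.contDiffAt.comp z (he z hz)
  have hfo : ContDiffOn ℝ ∞ f e.target := fun z hz => (hf z hz).contDiffWithinAt
  let α : E → E →L[ℝ] ℝ := fun z => if z ∈ e.target then fderiv ℝ f z else 0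
  have hαt : ∀ z ∈ e.target, α =ᶠ[𝓝 z] fderiv ℝ f := fun z hz =>
    Filter.eventually_of_mem (e.open_target.mem_nhds hz) fun x hx => if_pos hx
  have hKc : IsClosed (e '' K) := (hK.image_of_continuousOn (e.continuousOn.mono hKe)).isClosed
  have hfK : ∀ z ∈ e.target, z ∉ e '' K →
      (∀ᶠ x in 𝓝 z, f x = 0) ∨ (∀ᶠ x in 𝓝 z, f x = m) := by
    intro z hz hzK
    have hw : e.symm z ∉ K := fun h => hzK ⟨_, h, e.right_inv hz⟩
    have hc : Tendsto e.symm (𝓝 z) (𝓝 (e.symm z)) := (he z hz).continuousAt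
    exact (hFK _ (e.map_target hz) hw).imp (fun h => hc.eventually h) fun h => hc.eventually h
  have hα0 : ∀ z ∉ e '' K, α z = 0 := by
    intro z hzK
    by_cases hz : z ∈ e.target
    · have h1 : α z = fderiv ℝ f z := if_pos hz
      rw [h1]
      rcases hfK z hz hzK with h | h
      · rw [Filter.EventuallyEq.fderiv_eq (f := fun _ => (0 : ℝ)) h, fderiv_const_apply]
      · rw [Filter.EventuallyEq.fderiv_eq (f := fun _ => m) h, fderiv_const_apply]
    · exact if_neg hz
  have hα0' : ∀ z ∉ e '' K, α =ᶠ[𝓝 z] fun _ => 0 := fun z hz =>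
    Filter.eventually_of_mem (hKc.isOpen_compl.mem_nhds hz) hα0
  have hcov : ∀ z, z ∈ e.target ∨ z ∉ e '' K := by
    intro z
    by_cases hz : z ∈ e '' K
    · obtain ⟨w, hw, rfl⟩ := hz
      exact Or.inl (e.map_source (hKe hw))
    · exact Or.inr hz
  have hα1 : ContDiff ℝ 1 α := by
    refine contDiff_iff_contDiffAt.2 fun z => ?_
    rcases hcov z with hz | hz
    · exact ((hfo.fderiv_of_isOpen e.open_target two_le_smooth).contDiffAt
        (e.open_target.mem_nhds hz)).congr_of_eventuallyEq (hαt z hz)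
    · exact contDiffAt_const.congr_of_eventuallyEq (hα0' z hz)
  have hsymm : ∀ z ∈ (univ : Set E), ∀ x y, fderiv ℝ α z x y = fderiv ℝ α z y x := by
    intro z _ x y
    rcases hcov z with hz | hz
    · rw [(hαt z hz).fderiv_eq]
      refine ((hf z hz).isSymmSndFDerivAt ?_).eq x y
      rw [minSmoothness_of_isRCLikeNormedField, ← one_add_one_eq_two]
      exact two_le_smooth
    · rw [(hα0' z hz).fderiv_eq, fderiv_const_apply]
      rfl
  obtain ⟨H₁, hH₁⟩ := convex_univ.exists_forall_hasFDerivAt_of_fderiv_symmetric isOpen_univ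
    (hα1.differentiable (by simp)).differentiableOn hsymm
  obtain ⟨w₀, hw₀⟩ := hKne
  let H : E → ℝ := fun z => H₁ z + (F w₀ - H₁ (e w₀))
  have hH : ∀ z, HasFDerivAt H (α z) z := fun z => (hH₁ z (mem_univ z)).add_const _
  have hHf : ∀ z ∈ e.target, H z = f z := by
    have htp : IsPreconnected e.target := by
      rw [← e.image_source_eq_target]
      exact hpre.image e e.continuousOn
    have hd : ∀ z ∈ e.target, HasFDerivAt (fun z => H z - f z) (0 : E →L[ℝ] ℝ) z := by
      intro z hz
      have h1 := (hH z).sub ((hf z hz).differentiableAt (by simp)).hasFDerivAt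
      have h2 : α z = fderiv ℝ f z := if_pos hz
      rw [h2, sub_self] at h1
      exact h1
    intro z hz
    have h := e.open_target.is_const_of_fderiv_eq_zero (𝕜 := ℝ) htp
      (fun x hx => (hd x hx).differentiableAt.differentiableWithinAt)
      (fun x hx => (hd x hx).fderiv) hz (e.map_source (hKe hw₀))
    have h3 : f (e w₀) = F w₀ := congrArg F (e.left_inv (hKe hw₀))
    simp only [H, h3] at h
    simp only [H]
    linarith
  have hHc : Continuous H := continuous_iff_continuousAt.2 fun z => (hH z).continuousAt
  have hloc : ∀ z ∉ e '' K, ∀ᶠ x in 𝓝 z, H x = H z := by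
    intro z hz
    obtain ⟨r, hr, hrK⟩ := Metric.mem_nhds_iff.1 (hKc.isOpen_compl.mem_nhds hz)
    filter_upwards [ball_mem_nhds z hr] with x hx
    refine isOpen_ball.is_const_of_fderiv_eq_zero (𝕜 := ℝ) (convex_ball z r).isPreconnected
      (fun y hy => (hH y).differentiableAt.differentiableWithinAt) (fun y hy => ?_) hx
      (mem_ball_self hr)
    rw [(hH y).fderiv, hα0 y (hrK hy)]
    rfl
  refine ⟨H, ?_, fun w hw => ?_, ?_, fun z hz => by rw [(hH z).fderiv, hα0 z hz]⟩
  · rw [← one_add_one_eq_two]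
    exact contDiff_succ_iff_hasFDerivAt.2 ⟨α, hα1, hH⟩
  · rw [hHf _ (e.map_source hw)]
    exact congrArg F (e.left_inv hw)
  · let S : Set E := {z | z ∉ e '' K ∧ H z ≠ 0 ∧ H z ≠ m}
    suffices h : S = ∅ by
      intro z hz
      by_contra! hcon
      exact Set.eq_empty_iff_forall_notMem.1 h z ⟨hz, hcon⟩
    refine eq_empty_of_isClopen_of_disjoint (T := e '' K) ⟨?_, ?_⟩ ⟨_, mem_image_of_mem e hw₀⟩ ?_
    · refine isOpen_compl_iff.1 (isOpen_iff_mem_nhds.2 fun z hz => ?_)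
      rcases hcov z with hzt | hzK
      · filter_upwards [e.open_target.mem_nhds hzt] with x hx hxS
        rcases hfK x hx hxS.1 with h | h
        · exact hxS.2.1 (by rw [hHf x hx]; exact h.self_of_nhds)
        · exact hxS.2.2 (by rw [hHf x hx]; exact h.self_of_nhds)
      · filter_upwards [hloc z hzK] with x hx hxS
        exact hz ⟨hzK, by rw [← hx]; exact hxS.2.1, by rw [← hx]; exact hxS.2.2⟩
    · refine isOpen_iff_mem_nhds.2 fun z hz => ?_
      filter_upwards [hloc z hz.1, hKc.isOpen_compl.mem_nhds hz.1] with x hx hxK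
      exact ⟨hxK, by rw [hx]; exact hz.2.1, by rw [hx]; exact hz.2.2⟩
    · exact Set.disjoint_left.2 fun z hz => hz.1

end Extension

section Volume

theorem finrank_mul_integral_eq {E : Type*} [NormedAddCommGroup E] [InnerProductSpace ℝ E]
    [FiniteDimensional ℝ E] [MeasurableSpace E] [BorelSpace E] {u : E → ℝ} (hu : ContDiff ℝ 1 u)
    (hc : HasCompactSupport u) :
    Module.finrank ℝ E * ∫ z, u z = -∫ z, fderiv ℝ u z z := by
  let b := stdOrthonormalBasis ℝ E
  have hdc : Continuous (fderiv ℝ u) := hu.continuous_fderiv (by simp)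
  have hdsupp : HasCompactSupport (fderiv ℝ u) := hc.fderiv ℝ
  have hi : ∀ i, Integrable (fun z => fderiv ℝ u z (b i) * inner ℝ (b i) z) := by
    intro i
    refine Continuous.integrable_of_hasCompactSupport (by fun_prop) ?_
    refine hdsupp.mono fun z hz h0 => hz ?_
    simp [h0]
  have key : ∀ i, ∫ z, u z = -∫ z, fderiv ℝ u z (b i) * inner ℝ (b i) z := by
    intro i
    have hfd : ∀ z, fderiv ℝ (fun z => inner ℝ (b i) z) z = innerSL ℝ (b i) := fun z =>
      (innerSL ℝ (b i)).hasFDerivAt.fderiv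
    have h1 : ∀ z, fderiv ℝ (fun z => inner ℝ (b i) z) z (b i) = 1 := by
      intro z
      rw [hfd]
      have : inner ℝ (b i) (b i) = (1 : ℝ) := by
        rw [real_inner_self_eq_norm_sq, b.norm_eq_one, one_pow]
      exact this
    rw [← integral_mul_fderiv_eq_neg_fderiv_mul_of_integrable (v := b i) (hi i)]
    · simp only [h1, mul_one]
    · simp only [h1, mul_one]
      exact hu.continuous.integrable_of_hasCompactSupport hc
    · exact Continuous.integrable_of_hasCompactSupport (hu.continuous.mul (by fun_prop))
        hc.mul_right
    · exact fun z _ => (hu.differentiable (by simp)) z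
    · exact fun z _ => (innerSL ℝ (b i)).differentiableAt
  have hsum : ∀ z, fderiv ℝ u z z = ∑ i, fderiv ℝ u z (b i) * inner ℝ (b i) z := by
    intro z
    rw [← congrArg (fderiv ℝ u z) (b.sum_repr' z), map_sum]
    refine Finset.sum_congr rfl fun i _ => ?_
    rw [map_smul, smul_eq_mul, mul_comm]
  simp only [hsum]
  rw [integral_finsetSum _ fun i _ => hi i, ← Finset.sum_neg_distrib,
    Finset.sum_congr rfl fun i _ => (key i).symm]
  simp

variable {n : ℕ}

theorem period_id (η : Cn n → Cn n →L[ℝ] ℝ) (w : Cn n) :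
    period η (ContinuousLinearMap.id ℂ (Cn n)) w =
      ∫ t in (0 : ℝ)..1, η (expI 1 t • w) ((2 * π * Complex.I) • expI 1 t • w) := by
  have h : ∀ t, circ (ContinuousLinearMap.id ℂ (Cn n)) t w = expI 1 t • w := fun t => by
    rw [circ_apply, ContinuousLinearMap.id_apply, sub_smul, one_smul, add_sub_cancel]
  simp only [period, h, circVel_apply, ContinuousLinearMap.id_apply, smul_smul]

theorem integral_expI_smul (g : Cn n → ℝ) (t : ℝ) : ∫ w, g (expI 1 t • w) = ∫ w, g w := by
  let L : Cn n →ₗᵢ[ℝ] Cn n :=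
    { toLinearMap := expI 1 t • LinearMap.id
      norm_map' := fun w => by
        change ‖expI 1 t • w‖ = ‖w‖
        rw [norm_smul, norm_expI, one_mul] }
  let e : Cn n ≃ₗᵢ[ℝ] Cn n := L.toLinearIsometryEquiv rfl
  exact e.measurePreserving.integral_comp e.toHomeomorph.measurableEmbedding g

/-- A function whose averages over all circles `e^{2πit} w` vanish has integral zero. -/
theorem integral_eq_zero_of_circle_average {g : Cn n → ℝ} (hg : Continuous g)
    (hc : HasCompactSupport g) (h0 : ∀ w, ∫ t in (0 : ℝ)..1, g (expI 1 t • w) = 0) :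
    ∫ w, g w = 0 := by
  obtain ⟨R, hR⟩ := hc.isCompact.isBounded.subset_closedBall (0 : Cn n)
  have hG : Continuous fun p : ℝ × Cn n => g (expI 1 p.1 • p.2) := by
    have := continuous_expI 1
    fun_prop
  have h_int : Integrable (fun p : ℝ × Cn n => g (expI 1 p.1 • p.2))
      ((volume.restrict (Ioc (0 : ℝ) 1)).prod volume) := by
    have h1 : IntegrableOn (fun p : ℝ × Cn n => g (expI 1 p.1 • p.2))
        (Ioc (0 : ℝ) 1 ×ˢ closedBall 0 R) (volume.prod volume) :=
      (hG.continuousOn.integrableOn_compact (isCompact_Icc.prod (isCompact_closedBall 0 R))).mono_set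
        (prod_mono Ioc_subset_Icc_self le_rfl)
    have h2 : IntegrableOn (fun p : ℝ × Cn n => g (expI 1 p.1 • p.2))
        (Ioc (0 : ℝ) 1 ×ˢ univ) (volume.prod volume) := by
      refine h1.of_forall_sdiff_eq_zero (measurableSet_Ioc.prod MeasurableSet.univ) ?_
      rintro ⟨t, w⟩ ⟨⟨ht, -⟩, hn⟩
      by_contra hne
      refine hn ⟨ht, ?_⟩
      have := hR (subset_tsupport g hne)
      simpa [norm_smul, norm_expI] using this
    rw [IntegrableOn, ← Measure.prod_restrict, Measure.restrict_univ] at h2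
    exact h2
  have hswap := integral_integral_swap (f := fun t w => g (expI 1 t • w)) h_int
  have h1 : ∫ t in Ioc (0 : ℝ) 1, ∫ w, g (expI 1 t • w) = ∫ w, g w := by
    simp only [integral_expI_smul]
    simp
  rw [h1] at hswap
  rw [hswap]
  have h2 : ∀ w, ∫ t in Ioc (0 : ℝ) 1, g (expI 1 t • w) = 0 := fun w => by
    rw [← intervalIntegral.integral_of_le zero_le_one]
    exact h0 w
  simp only [h2, integral_zero]

end Volume

section Collar

variable {n : ℕ}

/-- The closed spherical shell of points with squared norm in `[α, β]`. -/
def closedShell (n : ℕ) (α β : ℝ) : Set (Cn n) := (fun w => ‖w‖ ^ 2) ⁻¹' Icc α β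

theorem mem_closedShell {α β : ℝ} {w : Cn n} :
    w ∈ closedShell n α β ↔ α ≤ ‖w‖ ^ 2 ∧ ‖w‖ ^ 2 ≤ β := Iff.rfl

theorem isClosed_closedShell (α β : ℝ) : IsClosed (closedShell n α β) :=
  isClosed_Icc.preimage (by fun_prop)

theorem isCompact_closedShell (α β : ℝ) : IsCompact (closedShell n α β) := by
  refine (isCompact_closedBall (0 : Cn n) √β).of_isClosed_subset (isClosed_closedShell α β) ?_
  intro w hw
  rw [mem_closedBall_zero_iff]
  exact Real.le_sqrt_of_sq_le hw.2

/-- A Hamiltonian `H` which in a symplectic collar `φ` of a sphere is a function `ρ` of the radius,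
and is locally constant outside of the collar. -/
structure IsCollarHam (φ : Cn n → Cn n) (α α' β' β m : ℝ) (ρ : ℝ → ℝ) (H : Cn n → ℝ) : Prop where
  nonneg : 0 ≤ α
  lt₁ : α < α'
  lt₂ : α' < β'
  lt₃ : β' < β
  symp : IsSymp φ (shell n α β)
  smooth : ContDiff ℝ ∞ ρ
  eq_zero : ∀ s ≤ α', ρ s = 0
  eq_m : ∀ s, β' ≤ s → ρ s = m
  contDiff : ContDiff ℝ 2 H
  comp : ∀ w ∈ shell n α β, H (φ w) = ρ (‖w‖ ^ 2)
  off : ∀ z ∉ φ '' closedShell n α' β', H z = 0 ∨ H z = m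
  fderiv_off : ∀ z ∉ φ '' closedShell n α' β', fderiv ℝ H z = 0

namespace IsCollarHam

variable {φ : Cn n → Cn n} {α α' β' β m : ℝ} {ρ : ℝ → ℝ} {H : Cn n → ℝ}

theorem closedShell_subset (h : IsCollarHam φ α α' β' β m ρ H) :
    closedShell n α' β' ⊆ shell n α β :=
  fun _ hw => ⟨h.lt₁.trans_le hw.1, hw.2.trans_lt h.lt₃⟩

theorem deriv_eq_zero (h : IsCollarHam φ α α' β' β m ρ H) {w : Cn n}
    (hw : w ∉ closedShell n α' β') : deriv ρ (‖w‖ ^ 2) = 0 := by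
  rw [mem_closedShell, not_and_or, not_le, not_le] at hw
  rcases hw with hw | hw
  · have h1 : ρ =ᶠ[𝓝 (‖w‖ ^ 2)] fun _ => 0 := by
      filter_upwards [eventually_lt_nhds hw] with s hs using h.eq_zero s hs.le
    rw [h1.deriv_eq, deriv_const]
  · have h1 : ρ =ᶠ[𝓝 (‖w‖ ^ 2)] fun _ => m := by
      filter_upwards [eventually_gt_nhds hw] with s hs using h.eq_m s hs.le
    rw [h1.deriv_eq, deriv_const]

theorem continuous_deriv (h : IsCollarHam φ α α' β' β m ρ H) : Continuous (deriv ρ) :=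
  h.smooth.continuous_deriv (by simp)

theorem hasFDerivAt_radial (h : IsCollarHam φ α α' β' β m ρ H) (w : Cn n) :
    HasFDerivAt (fun w : Cn n => ρ (‖w‖ ^ 2))
      ((2 * deriv ρ (‖w‖ ^ 2)) • (innerSL ℝ w : Cn n →L[ℝ] ℝ)) w := by
  have h1 : HasFDerivAt (fun w : Cn n => ‖w‖ ^ 2) ((2 : ℝ) • (innerSL ℝ w : Cn n →L[ℝ] ℝ)) w := by
    exact (hasStrictFDerivAt_norm_sq w).hasFDerivAt.congr_fderiv (ofNat_smul_eq_nsmul ℝ 2 _).symm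
  have h2 : HasDerivAt ρ (deriv ρ (‖w‖ ^ 2)) (‖w‖ ^ 2) :=
    (h.smooth.differentiable (by simp) _).hasDerivAt
  have h3 := h2.comp_hasFDerivAt w h1
  rw [smul_smul, mul_comm] at h3
  exact h3

theorem fderiv_comp (h : IsCollarHam φ α α' β' β m ρ H) {w : Cn n} (hw : w ∈ shell n α β)
    (v : Cn n) : fderiv ℝ H (φ w) (fderiv ℝ φ w v) = 2 * deriv ρ (‖w‖ ^ 2) * inner ℝ w v := by
  have h1 : HasFDerivAt H (fderiv ℝ H (φ w)) (φ w) :=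
    (h.contDiff.differentiable (by simp) _).hasFDerivAt
  have h2 := h1.comp w (h.symp.hasFDerivAt hw)
  have h3 : H ∘ φ =ᶠ[𝓝 w] fun w => ρ (‖w‖ ^ 2) :=
    Filter.eventually_of_mem ((isOpen_shell α β).mem_nhds hw) h.comp
  have h4 := h2.unique ((h.hasFDerivAt_radial w).congr_of_eventuallyEq h3)
  exact DFunLike.congr_fun h4 v

theorem fderiv_radial (h : IsCollarHam φ α α' β' β m ρ H) {w : Cn n} (hw : w ∈ shell n α β) :
    fderiv ℝ H (φ w) (φ w) = 4 * deriv ρ (‖w‖ ^ 2) * primDiff (sympL n) φ w (Complex.I • w) +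
      2 * deriv ρ (‖w‖ ^ 2) * ‖w‖ ^ 2 := by
  obtain ⟨A, hA⟩ := h.symp.exists_equiv hw
  obtain ⟨v, hv⟩ := A.surjective (φ w)
  have hv' : fderiv ℝ φ w v = φ w := by rw [← hA]; exact hv
  have h1 := h.fderiv_comp hw v
  rw [hv'] at h1
  have h2 := h.symp.symp w hw (Complex.I • w) v
  rw [hv', symp_swap] at h2
  have h3 : _root_.symp (Complex.I • w) v = -inner ℝ w v := by
    rw [_root_.symp, Cn.I_smul_I_smul, inner_neg_left]
  have h4 : _root_.symp w (Complex.I • w) = ‖w‖ ^ 2 := by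
    rw [_root_.symp, Cn.inner_I_smul_smul, real_inner_self_eq_norm_sq]
  rw [h1, primDiff_apply, sympL_apply, sympL_apply, h4]
  rw [h3] at h2
  linear_combination 2 * deriv ρ (‖w‖ ^ 2) * h2

theorem contDiffOn_primDiff (h : IsCollarHam φ α α' β' β m ρ H) :
    ContDiffOn ℝ 1 (primDiff (sympL n) φ) (shell n α β) :=
  _root_.contDiffOn_primDiff (isOpen_shell α β) h.symp.smooth

theorem period_eq_zero (h : IsCollarHam φ α α' β' β m ρ H) (hn : 2 ≤ n) {w : Cn n}
    (hw : w ∈ shell n α β) :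
    ∫ t in (0 : ℝ)..1, primDiff (sympL n) φ (expI 1 t • w) (Complex.I • expI 1 t • w) = 0 := by
  have h1 := period_id_eq_zero hn h.nonneg h.contDiffOn_primDiff
    (fun w hw u v => fderiv_primDiff_symm (isOpen_shell α β) h.symp.smooth h.symp.symp hw u v) hw
  rw [period_id] at h1
  have h2 : ∀ t, primDiff (sympL n) φ (expI 1 t • w) ((2 * π * Complex.I) • expI 1 t • w) =
      2 * π * primDiff (sympL n) φ (expI 1 t • w) (Complex.I • expI 1 t • w) := by
    intro t
    have h3 : (2 * π * Complex.I) • expI 1 t • w =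
        (2 * π : ℝ) • (Complex.I • expI 1 t • w : Cn n) := by
      rw [← smul_smul, ← Complex.coe_smul]
      push_cast
      rfl
    rw [h3, map_smul, smul_eq_mul]
  simp only [h2, intervalIntegral.integral_const_mul] at h1
  exact (mul_eq_zero.1 h1).resolve_left (by positivity)

theorem integral_primDiff (h : IsCollarHam φ α α' β' β m ρ H) (hn : 2 ≤ n) :
    (∫ w, deriv ρ (‖w‖ ^ 2) * primDiff (sympL n) φ w (Complex.I • w) = 0) ∧
      Integrable fun w => deriv ρ (‖w‖ ^ 2) * primDiff (sympL n) φ w (Complex.I • w) := by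
  have hc : HasCompactSupport fun w =>
      deriv ρ (‖w‖ ^ 2) * primDiff (sympL n) φ w (Complex.I • w) :=
    HasCompactSupport.intro (isCompact_closedShell α' β') fun w hw => by
      rw [h.deriv_eq_zero hw, zero_mul]
  have hcont : Continuous fun w =>
      deriv ρ (‖w‖ ^ 2) * primDiff (sympL n) φ w (Complex.I • w) := by
    refine continuous_iff_continuousAt.2 fun w => ?_
    by_cases hw : w ∈ closedShell n α' β'
    · have h1 := h.contDiffOn_primDiff.continuousOn.continuousAt
        ((isOpen_shell α β).mem_nhds (h.closedShell_subset hw))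
      have h2 : Continuous fun w : Cn n => deriv ρ (‖w‖ ^ 2) := h.continuous_deriv.comp (by fun_prop)
      exact h2.continuousAt.mul (h1.clm_apply (mulI n).continuous.continuousAt)
    · refine (continuousAt_const (y := (0 : ℝ))).congr ?_
      filter_upwards [(isClosed_closedShell α' β').isOpen_compl.mem_nhds hw] with x hx
      rw [h.deriv_eq_zero hx, zero_mul]
  refine ⟨integral_eq_zero_of_circle_average hcont hc fun w => ?_,
    hcont.integrable_of_hasCompactSupport hc⟩
  have h1 : ∀ t, ‖expI 1 t • w‖ = ‖w‖ := fun t => by rw [norm_smul, norm_expI, one_mul]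
  simp only [h1, intervalIntegral.integral_const_mul]
  by_cases hw : w ∈ closedShell n α' β'
  · rw [h.period_eq_zero hn (h.closedShell_subset hw), mul_zero]
  · rw [h.deriv_eq_zero hw, zero_mul]

theorem integral_eq (h : IsCollarHam φ α α' β' β m ρ H) (hn : 2 ≤ n) {c R : ℝ}
    (hR : ∀ z, R ≤ ‖z‖ → H z = c) :
    ∫ z, (c - H z) = ∫ w : Cn n, (m - ρ (‖w‖ ^ 2)) := by
  have hrad := fun w => h.hasFDerivAt_radial w
  have hc1 : HasCompactSupport fun z => c - H z := by
    refine HasCompactSupport.intro (isCompact_closedBall (0 : Cn n) R) fun z hz => ?_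
    rw [mem_closedBall_zero_iff, not_le] at hz
    rw [hR z hz.le, sub_self]
  have hc2 : HasCompactSupport fun w : Cn n => m - ρ (‖w‖ ^ 2) := by
    refine HasCompactSupport.intro (isCompact_closedBall (0 : Cn n) √β') fun z hz => ?_
    rw [mem_closedBall_zero_iff, not_le] at hz
    rw [h.eq_m _ ((Real.sqrt_le_left (norm_nonneg z)).1 hz.le), sub_self]
  have e1 := finrank_mul_integral_eq
    ((contDiff_const (c := c)).sub (h.contDiff.of_le (by norm_num))) hc1
  have hC2 : ContDiff ℝ 1 fun w : Cn n => m - ρ (‖w‖ ^ 2) :=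
    contDiff_const.sub ((h.smooth.of_le (by simp)).comp (contDiff_norm_sq ℝ))
  have e2 := finrank_mul_integral_eq hC2 hc2
  have f1 : ∀ z, fderiv ℝ (fun z => c - H z) z z = -fderiv ℝ H z z := fun z => by
    rw [fderiv_const_sub]; rfl
  have f2 : ∀ w : Cn n, fderiv ℝ (fun w : Cn n => m - ρ (‖w‖ ^ 2)) w w =
      -(2 * deriv ρ (‖w‖ ^ 2) * ‖w‖ ^ 2) := fun w => by
    rw [((hrad w).const_sub m).fderiv]
    change -(2 * deriv ρ (‖w‖ ^ 2) * inner ℝ w w) = _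
    rw [real_inner_self_eq_norm_sq]
  simp only [f1, integral_neg, neg_neg] at e1
  simp only [f2, integral_neg, neg_neg] at e2
  have hd : (Module.finrank ℝ (Cn n) : ℝ) ≠ 0 := by
    have := one_lt_rank_Cn (n := n) (by omega)
    rw [← Module.finrank_eq_rank] at this
    have h2 : 1 < Module.finrank ℝ (Cn n) := by exact_mod_cast this
    positivity
  refine mul_left_cancel₀ hd (e1.trans (Eq.trans ?_ e2.symm))
  have hsub : ∫ z in φ '' shell n α β, fderiv ℝ H z z = ∫ z, fderiv ℝ H z z := by
    refine setIntegral_eq_integral_of_forall_compl_eq_zero fun z hz => ?_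
    rw [h.fderiv_off z fun hz' => hz (image_mono h.closedShell_subset hz')]
    rfl
  rw [← hsub, integral_image_eq_integral_abs_det_fderiv_smul volume
    (isOpen_shell α β).measurableSet
    (fun w hw => (h.symp.hasFDerivAt hw).hasFDerivWithinAt) h.symp.inj]
  have hset : ∫ w in shell n α β, |(fderiv ℝ φ w).det| • fderiv ℝ H (φ w) (φ w) =
      ∫ w in shell n α β, (4 * (deriv ρ (‖w‖ ^ 2) * primDiff (sympL n) φ w (Complex.I • w)) +
      2 * deriv ρ (‖w‖ ^ 2) * ‖w‖ ^ 2) := by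
    refine setIntegral_congr_fun (isOpen_shell α β).measurableSet fun w hw => ?_
    rw [abs_det_of_symp (h.symp.symp w hw), one_smul, h.fderiv_radial hw, mul_assoc]
  rw [hset, setIntegral_eq_integral_of_forall_compl_eq_zero]
  · rw [integral_add, integral_const_mul, (h.integral_primDiff hn).1, mul_zero, zero_add]
    · exact (h.integral_primDiff hn).2.const_mul 4
    · refine Continuous.integrable_of_hasCompactSupport ?_ ?_
      · have h1 : Continuous fun w : Cn n => ‖w‖ ^ 2 := by fun_prop
        exact (continuous_const.mul (h.continuous_deriv.comp h1)).mul h1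
      · refine HasCompactSupport.intro (isCompact_closedShell α' β') fun w hw => ?_
        rw [h.deriv_eq_zero hw]
        ring
  · intro w hw
    rw [h.deriv_eq_zero fun hw' => hw (h.closedShell_subset hw')]
    ring

end IsCollarHam

end Collar

section CollarOrbit

variable {n : ℕ}

theorem expI_eq_expI_one (k : ℤ) (t : ℝ) : expI k t = expI 1 (k * t) := by
  simp only [expI]
  congr 1
  push_cast
  ring

/-- A closed orbit of `y' = i c y` which is not constantly zero has `c ∈ 2πℤ`. -/
theorem exists_expI_of_hasDerivAt {y : ℝ → Cn n} {c : ℝ}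
    (hy : ∀ t, HasDerivAt y (c • (Complex.I • y t)) t) (hper : ∀ t, y (t + 1) = y t)
    (h0 : y 0 ≠ 0) : ∃ k : ℤ, c = 2 * π * k ∧ ∀ t, y t = expI k t • y 0 := by
  have h1 : ∀ t : ℝ, HasDerivAt (fun t : ℝ => Complex.exp (-(c * Complex.I) * t))
      (Complex.exp (-(c * Complex.I) * t) * (-(c * Complex.I))) t := fun t => by
    have h := ((hasDerivAt_id (t : ℂ)).const_mul (-(c * Complex.I))).cexp.comp_ofReal
    refine h.congr_deriv ?_
    simp
  have h2 : ∀ t, HasDerivAt (fun t : ℝ => Complex.exp (-(c * Complex.I) * t) • y t) 0 t := fun t => by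
    refine ((h1 t).smul (hy t)).congr_deriv ?_
    rw [← Complex.coe_smul, smul_smul, smul_smul, ← add_smul]
    rw [show Complex.exp (-(c * Complex.I) * t) * c * Complex.I +
      Complex.exp (-(c * Complex.I) * t) * (-(c * Complex.I)) = 0 by ring, zero_smul]
  have h3 : ∀ t, y t = Complex.exp (c * Complex.I * t) • y 0 := fun t => by
    have h := is_const_of_deriv_eq_zero (fun t => (h2 t).differentiableAt) (fun t => (h2 t).deriv) t 0
    simp only [Complex.ofReal_zero, mul_zero, Complex.exp_zero, one_smul] at h
    rw [← h, smul_smul, ← Complex.exp_add, show c * Complex.I * t + -(c * Complex.I) * t = 0 by ring,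
      Complex.exp_zero, one_smul]
  have h4 : Complex.exp (c * Complex.I) = 1 := by
    have h := h3 1
    rw [← zero_add (1 : ℝ), hper 0, zero_add, Complex.ofReal_one, mul_one] at h
    have h5 : (Complex.exp (c * Complex.I) - 1) • y 0 = 0 := by
      rw [sub_smul, one_smul, ← h, sub_self]
    exact sub_eq_zero.1 ((smul_eq_zero.1 h5).resolve_right h0)
  obtain ⟨k, hk⟩ := Complex.exp_eq_one_iff.1 h4
  have h5 : (c : ℂ) = ((2 * π * k : ℝ) : ℂ) := by
    have : (c : ℂ) * Complex.I = ((2 * π * k : ℝ) : ℂ) * Complex.I := by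
      rw [hk]; push_cast; ring
    exact mul_right_cancel₀ Complex.I_ne_zero this
  have h6 : c = 2 * π * k := by exact_mod_cast h5
  refine ⟨k, h6, fun t => ?_⟩
  rw [h3 t, expI, h5]
  congr 2
  push_cast
  ring

namespace IsCollarHam

variable {φ : Cn n → Cn n} {α α' β' β m : ℝ} {ρ : ℝ → ℝ} {H : Cn n → ℝ}

theorem expI_smul_mem {α β : ℝ} {w : Cn n} (hw : w ∈ shell n α β) (k : ℤ) (t : ℝ) :
    expI k t • w ∈ shell n α β := by
  rw [mem_shell, norm_smul, norm_expI, one_mul]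
  exact hw

theorem integral_primDiff_expI (h : IsCollarHam φ α α' β' β m ρ H) (hn : 2 ≤ n) {w : Cn n}
    (hw : w ∈ shell n α β) {k : ℤ} (hk : k ≠ 0) :
    ∫ t in (0 : ℝ)..1, primDiff (sympL n) φ (expI k t • w) (Complex.I • expI k t • w) = 0 := by
  let f : ℝ → ℝ := fun t => primDiff (sympL n) φ (expI 1 t • w) (Complex.I • expI 1 t • w)
  have hexp := continuous_expI 1
  have hf : Continuous f := by
    have h1 : Continuous fun t => primDiff (sympL n) φ (expI 1 t • w) :=
      h.contDiffOn_primDiff.continuousOn.comp_continuous (by fun_prop) fun t => expI_smul_mem hw 1 t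
    have h2 : Continuous fun t => Complex.I • expI 1 t • w := by fun_prop
    exact h1.clm_apply h2
  have hper : Function.Periodic f 1 := fun t => by simp only [f, expI_add_one]
  have hk' : (k : ℝ) ≠ 0 := by exact_mod_cast hk
  have h1 := hper.intervalIntegral_add_zsmul_eq k 0 fun _ _ => hf.intervalIntegrable _ _
  have h2 : ∫ t in (0 : ℝ)..1, f t = 0 := h.period_eq_zero hn hw
  rw [zero_add, zero_add, h2, smul_zero, zsmul_one] at h1
  have h3 := intervalIntegral.integral_comp_mul_left (a := 0) (b := 1) f hk'
  rw [mul_zero, mul_one, h1, smul_zero] at h3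
  simp only [expI_eq_expI_one k]
  exact h3

theorem exists_action_eq (h : IsCollarHam φ α α' β' β m ρ H) (hn : 2 ≤ n) {G : Cn n → Cn n}
    (hG : ∀ w ∈ shell n α β, ∀ v, inner ℝ (G (φ w)) v = fderiv ℝ H (φ w) v) {x : ℝ → Cn n}
    (hx : ∀ t, HasDerivAt x (Complex.I • G (x t)) t) (hper : ∀ t, x (t + 1) = x t) {t₀ : ℝ}
    (ht₀ : x t₀ ∈ φ '' shell n α β) :
    ∃ s, ∃ k : ℤ, (∀ t, x t ∈ φ '' shell n α β) ∧ α < s ∧ s < β ∧ deriv ρ s = k * π ∧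
      ∫ t in (0 : ℝ)..1, (1 / 2 * inner ℝ (G (x t)) (x t) - H (x t)) = k * π * s - ρ s := by
  obtain ⟨e, he, hes, het, hesymm⟩ := h.symp.exists_chart
  have hxc : Continuous x := continuous_iff_continuousAt.2 fun t => (hx t).continuousAt
  have hsub : ∀ {w}, w ∈ shell n α β → e.symm (φ w) = w := fun {w} hw => by
    rw [← he]; exact e.left_inv (hes ▸ hw)
  have hy : ∀ t, x t ∈ φ '' shell n α β → HasDerivAt (fun t => e.symm (x t))
      ((2 * deriv ρ (‖e.symm (x t)‖ ^ 2)) • (Complex.I • e.symm (x t))) t := by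
    intro t ht
    have hmem : x t ∈ e.target := het ▸ ht
    have h1 := ((hesymm _ hmem).differentiableAt (by simp)).hasFDerivAt.comp_hasDerivAt t (hx t)
    refine h1.congr_deriv ?_
    set y' := fderiv ℝ e.symm (x t) (Complex.I • G (x t)) with hy'
    obtain ⟨w, hw, hwx⟩ := ht
    rw [← hwx, hsub hw]
    rw [← hwx] at hmem
    have h2 : fderiv ℝ φ w y' = Complex.I • G (φ w) := by
      have h3 : HasFDerivAt e.symm (fderiv ℝ e.symm (φ w)) (φ w) :=
        ((hesymm _ hmem).differentiableAt (by simp)).hasFDerivAt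
      have h4 : HasFDerivAt φ (fderiv ℝ φ w) (e.symm (φ w)) := by
        rw [hsub hw]; exact h.symp.hasFDerivAt hw
      have h5 := h4.comp (φ w) h3
      have h6 : φ ∘ e.symm =ᶠ[𝓝 (φ w)] id := by
        filter_upwards [e.open_target.mem_nhds hmem] with z hz
        rw [Function.comp_apply, ← he, e.right_inv hz, id]
      have h7 := h5.unique ((hasFDerivAt_id _).congr_of_eventuallyEq h6)
      have h8 := DFunLike.congr_fun h7 (Complex.I • G (φ w))
      rw [hy', ← hwx]
      exact h8
    have h3 : Complex.I • y' = -((2 * deriv ρ (‖w‖ ^ 2)) • w) := by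
      refine ext_inner_right ℝ fun v => ?_
      have h4 := h.symp.symp w hw y' v
      rw [h2, _root_.symp, _root_.symp, Cn.I_smul_I_smul, inner_neg_left, hG w hw,
        h.fderiv_comp hw] at h4
      rw [← h4, inner_neg_left, real_inner_smul_left]
    have h4 := congrArg (fun z => Complex.I • z) h3
    simp only [Cn.I_smul_I_smul, smul_neg, neg_inj] at h4
    rw [h4, smul_comm]
  set s := ‖e.symm (x t₀)‖ ^ 2 with hs
  obtain ⟨w₀, hw₀, hwx₀⟩ := ht₀
  have hs₀ : s = ‖w₀‖ ^ 2 := by rw [hs, ← hwx₀, hsub hw₀]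
  have hKs : closedShell n s s ⊆ shell n α β := fun w hw =>
    ⟨hw₀.1.trans_le (hs₀.symm.trans_le hw.1), (hw.2.trans_eq hs₀).trans_lt hw₀.2⟩
  have hK : IsCompact (φ '' closedShell n s s) :=
    (isCompact_closedShell s s).image_of_continuousOn (h.symp.smooth.continuousOn.mono hKs)
  have hstay : ∀ t, x t ∈ φ '' closedShell n s s := by
    have hcl : IsClopen (x ⁻¹' (φ '' closedShell n s s)) := by
      refine ⟨hK.isClosed.preimage hxc, isOpen_iff_mem_nhds.2 fun t ht => ?_⟩
      have ht' : x t ∈ φ '' shell n α β := image_mono hKs ht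
      have hU : IsOpen (x ⁻¹' (φ '' shell n α β)) := (het ▸ e.open_target).preimage hxc
      obtain ⟨ε, hε, hb⟩ := Metric.isOpen_iff.1 hU t ht'
      have hd : ∀ t' ∈ ball t ε, HasDerivAt (fun t => ‖e.symm (x t)‖ ^ 2) 0 t' := fun t' ht' => by
        refine (hy t' (hb ht')).norm_sq.congr_deriv ?_
        rw [real_inner_smul_right, real_inner_comm, Cn.inner_I_smul_self, mul_zero, mul_zero]
      filter_upwards [ball_mem_nhds t hε] with t' ht'
      have h1 : ‖e.symm (x t')‖ ^ 2 = ‖e.symm (x t)‖ ^ 2 :=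
        isOpen_ball.is_const_of_deriv_eq_zero (convex_ball t ε).isPreconnected
          (fun u hu => (hd u hu).differentiableAt.differentiableWithinAt) (fun u hu => (hd u hu).deriv)
          ht' (mem_ball_self hε)
      obtain ⟨w, hw, hwx⟩ := ht
      obtain ⟨w', hw', hwx'⟩ := hb ht'
      rw [← hwx, ← hwx', hsub hw', hsub (hKs hw)] at h1
      exact ⟨w', ⟨hw.1.trans_eq h1.symm, h1.trans_le hw.2⟩, hwx'⟩
    have := hcl.eq_univ ⟨t₀, w₀, ⟨hs₀.le, hs₀.ge⟩, hwx₀⟩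
    intro t
    exact (this ▸ mem_univ t : t ∈ x ⁻¹' (φ '' closedShell n s s))
  have hstay' : ∀ t, x t ∈ φ '' shell n α β := fun t => image_mono hKs (hstay t)
  have hns : ∀ t, ‖e.symm (x t)‖ ^ 2 = s := fun t => by
    obtain ⟨w, hw, hwx⟩ := hstay t
    rw [← hwx, hsub (hKs hw)]
    exact le_antisymm hw.2 hw.1
  have hspos : 0 < s := by rw [hs₀]; exact h.nonneg.trans_lt hw₀.1
  obtain ⟨k, hk, hyk⟩ := exists_expI_of_hasDerivAt (y := fun t => e.symm (x t))
    (c := 2 * deriv ρ s) (fun t => by have := hy t (hstay' t); rwa [hns] at this)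
    (fun t => by rw [hper]) (fun h0 => by
      have := hns 0
      rw [h0, norm_zero] at this
      norm_num at this
      exact hspos.ne this)
  set y₀ := e.symm (x 0)
  have hy₀ : y₀ ∈ shell n α β := by
    rw [mem_shell, hns, hs₀]; exact hw₀
  have h_int : ∀ t, 1 / 2 * inner ℝ (G (x t)) (x t) - H (x t) =
      2 * deriv ρ s * primDiff (sympL n) φ (expI k t • y₀) (Complex.I • expI k t • y₀) +
        (deriv ρ s * s - ρ s) := fun t => by
    obtain ⟨w, hw, hwx⟩ := hstay' t
    have h1 : expI k t • y₀ = w := by rw [← hyk t, ← hwx, hsub hw]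
    have h2 : ‖w‖ ^ 2 = s := by rw [← hns t, ← hwx, hsub hw]
    rw [h1, ← hwx, hG w hw, h.fderiv_radial hw, h.comp w hw, h2]
    ring
  have hρk : deriv ρ s = k * π := by linarith
  refine ⟨s, k, hstay', hs₀ ▸ hw₀.1, hs₀ ▸ hw₀.2, hρk, ?_⟩
  simp only [h_int]
  rcases eq_or_ne k 0 with rfl | hk0
  · have h0 : deriv ρ s = 0 := by rw [hρk]; simp
    simp [h0]
  · have hexp := continuous_expI k
    have h1 : Continuous fun t => primDiff (sympL n) φ (expI k t • y₀) :=
      h.contDiffOn_primDiff.continuousOn.comp_continuous (by fun_prop)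
        fun t => expI_smul_mem hy₀ k t
    have h2 : Continuous fun t => Complex.I • expI k t • y₀ := by fun_prop
    have h3 : Continuous fun t => 2 * deriv ρ s *
        primDiff (sympL n) φ (expI k t • y₀) (Complex.I • expI k t • y₀) :=
      continuous_const.mul (h1.clm_apply h2)
    rw [intervalIntegral.integral_add (h3.intervalIntegrable _ _)
      intervalIntegrable_const, intervalIntegral.integral_const_mul,
      h.integral_primDiff_expI hn hy₀ hk0, hρk]
    simp

end IsCollarHam

end CollarOrbit

section AsympQuadratic

theorem abs_taylor_le {E : Type*} [NormedAddCommGroup E] [NormedSpace ℝ E] {P : E → ℝ}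
    (hP : Differentiable ℝ P) {K : NNReal} (hK : LipschitzWith K (fderiv ℝ P)) (z w : E) :
    |P (z + w) - P z - fderiv ℝ P z w| ≤ K * ‖w‖ ^ 2 := by
  have h := (convex_closedBall z ‖w‖).norm_image_sub_le_of_norm_fderiv_le' (f := P)
    (φ := fderiv ℝ P z) (C := K * ‖w‖) (x := z) (y := z + w) (fun x _ => hP x) (fun x hx => ?_)
    (mem_closedBall_self (norm_nonneg w)) (by simp)
  · rw [add_sub_cancel_left] at h
    calc _ ≤ K * ‖w‖ * ‖w‖ := h
      _ = K * ‖w‖ ^ 2 := by ring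
  · rw [← dist_eq_norm]
    exact (hK.dist_le_mul x z).trans (by gcongr; exact hx)

variable {n : ℕ}

/-- The quadratic form with coefficients `b`. -/
def Cn.quad (b : Fin n → ℝ) (z : Cn n) : ℝ := ∑ i, b i * ‖z i‖ ^ 2

theorem contDiff_quad {k : ℕ∞ω} (b : Fin n → ℝ) : ContDiff ℝ k (Cn.quad b) := by
  unfold Cn.quad
  refine ContDiff.sum fun i _ => contDiff_const.mul ?_
  exact (contDiff_norm_sq ℝ).comp ((EuclideanSpace.proj i : Cn n →L[ℂ] ℂ).restrictScalars ℝ).contDiff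

/-- `diagMul` as a continuous real-linear map. -/
def diagMulL (b : Fin n → ℝ) : Cn n →L[ℝ] Cn n :=
  LinearMap.toContinuousLinearMap
    { toFun := diagMul b
      map_add' := fun z w => by ext i; simp [diagMul, mul_add]
      map_smul' := fun c z => by ext i; simp [diagMul]; ring }

theorem diagMulL_apply (b : Fin n → ℝ) (z : Cn n) : diagMulL b z = diagMul b z := rfl

theorem inner_diagMul_comm (b : Fin n → ℝ) (z w : Cn n) :
    inner ℝ (diagMul b z) w = inner ℝ (diagMul b w) z := by
  rw [inner_diagMul, inner_diagMul]
  refine Finset.sum_congr rfl fun i _ => ?_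
  simp
  ring_nf
  simp

theorem quad_eq_inner (b : Fin n → ℝ) (z : Cn n) : Cn.quad b z = inner ℝ (diagMulL b z) z :=
  (inner_diagMul_self b z).symm

theorem quad_add (b : Fin n → ℝ) (z w : Cn n) :
    Cn.quad b (z + w) = Cn.quad b z + 2 * inner ℝ (diagMul b z) w + Cn.quad b w := by
  simp only [quad_eq_inner, map_add, inner_add_left, inner_add_right, diagMulL_apply]
  rw [inner_diagMul_comm b w z]
  ring

theorem fderiv_quad (b : Fin n → ℝ) (z v : Cn n) :
    fderiv ℝ (Cn.quad b) z v = 2 * inner ℝ (diagMul b z) v := by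
  have h : HasFDerivAt (fun z => inner ℝ (diagMulL b z) z) _ z :=
    (diagMulL b).hasFDerivAt.inner ℝ (hasFDerivAt_id z)
  have h2 : Cn.quad b = fun z => inner ℝ (diagMulL b z) z := funext (quad_eq_inner b)
  rw [h2, h.fderiv]
  change inner ℝ (diagMul b z) v + inner ℝ (diagMul b v) z = _
  rw [inner_diagMul_comm b v z]
  ring

theorem exists_abs_quad_le (b : Fin n → ℝ) : ∃ B, 0 ≤ B ∧ ∀ z, |Cn.quad b z| ≤ B * ‖z‖ ^ 2 := by
  obtain ⟨B, hB0, hB⟩ := Cn.exists_norm_diagMul_le b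
  refine ⟨B, hB0, fun z => ?_⟩
  rw [quad_eq_inner]
  calc _ ≤ ‖diagMul b z‖ * ‖z‖ := abs_real_inner_le_norm _ _
    _ ≤ B * ‖z‖ * ‖z‖ := by gcongr; exact hB z
    _ = B * ‖z‖ ^ 2 := by ring

theorem inner_gradient_eq {f : Cn n → ℝ} (z v : Cn n) :
    inner ℝ (gradient f z) v = fderiv ℝ f z v :=
  InnerProductSpace.toDual_symm_apply

theorem exists_pos_forall_le {ι : Type*} [Finite ι] {f : ι → ℝ} (hf : ∀ i, 0 < f i) :
    ∃ δ > 0, ∀ i, δ ≤ f i := by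
  cases isEmpty_or_nonempty ι with
  | inl _ => exact ⟨1, one_pos, fun i => isEmptyElim i⟩
  | inr _ =>
    obtain ⟨i, hi⟩ := Finite.exists_min f
    exact ⟨f i, hf i, hi⟩

theorem exists_gap {b : Fin n → ℝ} (hb : ∀ i, ∃ j : ℤ, j * π < b i ∧ b i < (j + 1) * π) :
    ∃ γ > 0, ∀ (k : ℤ) i, γ ≤ |2 * π * k - 2 * b i| := by
  choose j hj using hb
  obtain ⟨δ, hδ, hδ'⟩ := exists_pos_forall_le
    (f := fun i => min (b i - j i * π) ((j i + 1) * π - b i))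
    fun i => lt_min (by linarith [(hj i).1]) (by linarith [(hj i).2])
  refine ⟨δ, hδ, fun k i => ?_⟩
  have h1 := (hδ' i).trans (min_le_left _ _)
  have h2 := (hδ' i).trans (min_le_right _ _)
  rcases le_or_gt k (j i) with hk | hk
  · have hk' : (k : ℝ) ≤ j i := by exact_mod_cast hk
    have := mul_le_mul_of_nonneg_right hk' pi_pos.le
    rw [abs_sub_comm]
    refine le_trans ?_ (le_abs_self _)
    linarith
  · have hk' : (j i : ℝ) + 1 ≤ k := by exact_mod_cast hk
    have := mul_le_mul_of_nonneg_right hk' pi_pos.le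
    refine le_trans ?_ (le_abs_self _)
    linarith

theorem norm_pow_four_le (z : Cn n) : ‖z‖ ^ 4 ≤ n * ∑ i, ‖z i‖ ^ 4 := by
  have h := sq_sum_le_card_mul_sum_sq (s := Finset.univ) (f := fun i => ‖z i‖ ^ 2)
  rw [← Cn.norm_sq, Finset.card_univ, Fintype.card_fin] at h
  calc ‖z‖ ^ 4 = (‖z‖ ^ 2) ^ 2 := by ring
    _ ≤ _ := h
    _ = _ := by simp only [← pow_mul]

theorem exists_isAsympQuadratic {b : Fin n → ℝ} {i₀ : Fin n} {f : Cn n → ℝ} {c C R r : ℝ}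
    (hf : ContDiff ℝ 2 f) (hinf : ∀ z, R ≤ ‖z‖ → f z = Cn.quad b z + c)
    (hnonneg : ∀ z, 0 ≤ f z) (hlow : ∀ z, Cn.quad b z - C ≤ f z) (hr : 0 < r)
    (hzero : ∀ z, ‖z‖ ≤ r → f z = 0) (hb : ∀ i ≠ i₀, 0 < b i ∧ b i < π)
    (hb₀ : π < b i₀ ∧ b i₀ < 2 * π) (hC : 0 ≤ C) :
    ∃ K M M' γ δ, IsAsympQuadratic b i₀ f (gradient f) K M M' C γ δ := by
  let P : Cn n → ℝ := fun z => f z - Cn.quad b z - c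
  have hP : ContDiff ℝ 2 P := (hf.sub (contDiff_quad b)).sub contDiff_const
  have hPc : HasCompactSupport P := by
    refine HasCompactSupport.intro (isCompact_closedBall (0 : Cn n) R) fun z hz => ?_
    rw [mem_closedBall_zero_iff, not_le] at hz
    simp only [P, hinf z hz.le]
    ring
  have hP1 : ContDiff ℝ 1 (fderiv ℝ P) := hP.fderiv_right (by norm_num)
  obtain ⟨K, hK⟩ := ContDiff.lipschitzWith_of_hasCompactSupport (hPc.fderiv ℝ) hP1 one_ne_zero
  obtain ⟨M, hM⟩ := (hPc.fderiv ℝ).exists_bound_of_continuous hP1.continuous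
  obtain ⟨K₀, hK₀⟩ := hPc.exists_bound_of_continuous hP.continuous
  obtain ⟨B, hB0, hB⟩ := exists_abs_quad_le b
  have hfd : ∀ z v, fderiv ℝ f z v = fderiv ℝ P z v + 2 * inner ℝ (diagMul b z) v := fun z v => by
    have h1 : f = fun z => P z + Cn.quad b z + c := by funext z; simp only [P]; ring
    have h2 : HasFDerivAt f (fderiv ℝ P z + fderiv ℝ (Cn.quad b) z) z := by
      refine HasFDerivAt.congr_of_eventuallyEq ?_ (Eventually.of_forall fun z => congrFun h1 z)
      exact ((hP.differentiable (by simp) z).hasFDerivAt.add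
        (((contDiff_quad (k := 1) b).differentiable (by simp) z).hasFDerivAt)).add_const c
    rw [h2.fderiv, ← fderiv_quad]
    rfl
  have hpi := pi_pos
  have hbj : ∀ i, ∃ j : ℤ, j * π < b i ∧ b i < (j + 1) * π := fun i => by
    by_cases hi : i = i₀
    · exact ⟨1, by subst hi; push_cast; constructor <;> linarith [hb₀.1, hb₀.2]⟩
    · exact ⟨0, by push_cast; constructor <;> linarith [(hb i hi).1, (hb i hi).2]⟩
  obtain ⟨γ, hγ, hgap⟩ := exists_gap hbj
  have hbpos : ∀ i, 0 < b i := fun i => by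
    by_cases hi : i = i₀
    · subst hi; linarith [hb₀.1]
    · exact (hb i hi).1
  obtain ⟨δ, hδ, hδ'⟩ := exists_pos_forall_le hbpos
  have hgrad : ∀ z, gradient f z - diagMul (fun i => 2 * b i) z = gradient P z := fun z => by
    refine ext_inner_right ℝ fun v => ?_
    have h1 : inner ℝ (diagMul (fun i => 2 * b i) z) v = 2 * inner ℝ (diagMul b z) v := by
      simp only [inner_diagMul, Finset.mul_sum, mul_assoc]
    rw [inner_sub_left, inner_gradient_eq, inner_gradient_eq, hfd, h1]
    ring
  have hcap : ∀ z, f z ≤ B * ‖z‖ ^ 2 + (|c| + K₀) := fun z => by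
    have h1 := (le_abs_self _).trans (hB z)
    have h2 : |P z| ≤ K₀ := hK₀ z
    have h3 := (le_abs_self _).trans h2
    have h4 := le_abs_self c
    simp only [P] at h3
    linarith
  have hK₀0 : 0 ≤ K₀ := (norm_nonneg _).trans (hK₀ 0)
  refine ⟨K + B + 1, max M 0, ((B * r ^ 2 + (|c| + K₀)) / r ^ 4 + 1) * (n + 1), γ,
    min δ (b i₀ - π), ?_⟩
  refine ⟨hf.continuous, ?_, ?_, ?_, hnonneg, hlow, ?_, hgap, fun i => (min_le_left _ _).trans (hδ' i),
    min_le_right _ _, by positivity, le_max_right _ _, by positivity, hC, hγ,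
    lt_min hδ (by linarith [hb₀.1])⟩
  · exact (InnerProductSpace.toDual ℝ (Cn n)).symm.continuous.comp
      (hf.continuous_fderiv (by norm_num))
  · intro z w
    rw [inner_gradient_eq, hfd]
    have h1 := abs_taylor_le (hP.differentiable (by simp)) hK z w
    have h2 := hB w
    have h3 : f (z + w) - f z - (fderiv ℝ P z w + 2 * inner ℝ (diagMul b z) w) =
        (P (z + w) - P z - fderiv ℝ P z w) + Cn.quad b w := by
      simp only [P, quad_add]; ring
    rw [h3]
    refine (abs_add_le _ _).trans ?_
    nlinarith [sq_nonneg ‖w‖]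
  · intro z
    rw [hgrad, gradient, LinearIsometryEquiv.norm_map]
    exact (hM z).trans (le_max_left _ _)
  · intro z
    have h4 : 0 ≤ ∑ i, ‖z i‖ ^ 4 := Finset.sum_nonneg fun i _ => by positivity
    rcases le_or_gt ‖z‖ r with hz | hz
    · rw [hzero z hz]
      positivity
    · have h5 := norm_pow_four_le z
      have h6 : 1 ≤ ‖z‖ ^ 2 / r ^ 2 := by
        rw [one_le_div (by positivity)]; gcongr
      have h7 : B * ‖z‖ ^ 2 + (|c| + K₀) ≤ (B * r ^ 2 + (|c| + K₀)) / r ^ 4 * ‖z‖ ^ 4 := by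
        have e1 : (B * r ^ 2 + (|c| + K₀)) / r ^ 4 * ‖z‖ ^ 4 =
            B * ‖z‖ ^ 2 * (‖z‖ ^ 2 / r ^ 2) +
              (|c| + K₀) * ((‖z‖ ^ 2 / r ^ 2) * (‖z‖ ^ 2 / r ^ 2)) := by
          field_simp
        rw [e1]
        have e2 : B * ‖z‖ ^ 2 * 1 ≤ B * ‖z‖ ^ 2 * (‖z‖ ^ 2 / r ^ 2) := by gcongr
        have e3 : (|c| + K₀) * (1 * 1) ≤ (|c| + K₀) * ((‖z‖ ^ 2 / r ^ 2) * (‖z‖ ^ 2 / r ^ 2)) := by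
          gcongr
        linarith
      refine (hcap z).trans (h7.trans ?_)
      set D := (B * r ^ 2 + (|c| + K₀)) / r ^ 4
      have hD : 0 ≤ D := by positivity
      calc D * ‖z‖ ^ 4 ≤ D * (n * ∑ i, ‖z i‖ ^ 4) := by gcongr
        _ ≤ (D + 1) * ((n + 1) * ∑ i, ‖z i‖ ^ 4) := by gcongr <;> linarith
        _ = _ := by ring

end AsympQuadratic

section Growth

/-- A smooth convex function vanishing for `s ≤ C` and affine of slope one for `C + d ≤ s`. -/
def growth (C d s : ℝ) : ℝ := ∫ u in (0 : ℝ)..s, smoothTransition ((u - C) / d)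

variable {C d : ℝ}

theorem continuous_growth_integrand : Continuous fun u => smoothTransition ((u - C) / d) :=
  smoothTransition.continuous.comp (by fun_prop)

theorem hasDerivAt_growth (s : ℝ) :
    HasDerivAt (growth C d) (smoothTransition ((s - C) / d)) s :=
  intervalIntegral.integral_hasDerivAt_right
    (continuous_growth_integrand.intervalIntegrable _ _)
    (continuous_growth_integrand.stronglyMeasurableAtFilter _ _)
    continuous_growth_integrand.continuousAt

theorem contDiff_growth : ContDiff ℝ 2 (growth C d) := by
  have h : deriv (growth C d) = fun s => smoothTransition ((s - C) / d) :=
    funext fun s => (hasDerivAt_growth s).deriv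
  have h2 : ContDiff ℝ 1 fun s => smoothTransition ((s - C) / d) :=
    (smoothTransition.contDiff (n := 1)).comp (by fun_prop)
  rw [show (2 : ℕ∞ω) = 1 + 1 by norm_num, contDiff_succ_iff_deriv]
  exact ⟨fun s => (hasDerivAt_growth s).differentiableAt, by simp, h ▸ h2⟩

theorem growth_nonneg {s : ℝ} (hs : 0 ≤ s) : 0 ≤ growth C d s :=
  intervalIntegral.integral_nonneg hs fun _ _ => smoothTransition.nonneg _

theorem growth_eq_zero (hC : 0 ≤ C) (hd : 0 < d) {s : ℝ} (hs : s ≤ C) : growth C d s = 0 := by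
  rw [growth]
  refine (intervalIntegral.integral_congr (g := fun _ => 0) fun u hu => ?_).trans (by simp)
  refine smoothTransition.zero_of_nonpos (div_nonpos_of_nonpos_of_nonneg ?_ hd.le)
  have := hu.2
  have h2 : max 0 s ≤ C := max_le hC hs
  linarith

theorem growth_eq_add (hd : 0 < d) {s : ℝ} (hs : C + d ≤ s) :
    growth C d s = s + (growth C d (C + d) - (C + d)) := by
  have h := intervalIntegral.integral_add_adjacent_intervals
    (continuous_growth_integrand (C := C) (d := d).intervalIntegrable (μ := volume) 0 (C + d))
    (continuous_growth_integrand.intervalIntegrable (C + d) s)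
  have h2 : ∫ u in (C + d)..s, smoothTransition ((u - C) / d) = s - (C + d) := by
    refine (intervalIntegral.integral_congr (g := fun _ => 1) fun u hu => ?_).trans (by simp)
    refine smoothTransition.one_of_one_le ?_
    rw [uIcc_of_le hs] at hu
    rw [one_le_div hd]
    linarith [hu.1]
  rw [h2] at h
  change growth C d (C + d) + _ = growth C d s at h
  linarith

theorem sub_le_growth (hC : 0 ≤ C) (hd : 0 < d) {s : ℝ} (hs : 0 ≤ s) :
    s - (C + d) ≤ growth C d s := by
  rcases le_total s (C + d) with h | h
  · linarith [growth_nonneg (C := C) (d := d) hs]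
  · rw [growth_eq_add hd h]
    linarith [growth_nonneg (C := C) (d := d) (s := C + d) (by linarith)]

theorem mul_growth_deriv_sub_le (hC : 0 ≤ C) (hd : 0 < d) {s : ℝ} (hs : 0 ≤ s) :
    smoothTransition ((s - C) / d) * s - growth C d s ≤ C + d := by
  have h1 := mul_le_of_le_one_left hs (smoothTransition.le_one ((s - C) / d))
  linarith [sub_le_growth hC hd hs]

end Growth

section Contradiction

variable {n : ℕ}

theorem exists_le_quad {b : Fin n → ℝ} (hb : ∀ i, 0 < b i) :
    ∃ δ > 0, ∀ z, δ * ‖z‖ ^ 2 ≤ Cn.quad b z := by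
  obtain ⟨δ, hδ, hδ'⟩ := exists_pos_forall_le hb
  refine ⟨δ, hδ, fun z => ?_⟩
  rw [Cn.norm_sq, Finset.mul_sum]
  exact Finset.sum_le_sum fun i _ => by gcongr; exact hδ' i

namespace IsCollarHam

variable {φ : Cn n → Cn n} {α α' β' β m : ℝ} {ρ : ℝ → ℝ} {H : Cn n → ℝ}

theorem mem_Icc (h : IsCollarHam φ α α' β' β m ρ H) (hm : 0 ≤ m) (hρ : ∀ s, ρ s ∈ Icc 0 m)
    (z : Cn n) : H z ∈ Icc 0 m := by
  by_cases hz : z ∈ φ '' closedShell n α' β'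
  · obtain ⟨w, hw, rfl⟩ := hz
    rw [h.comp w (h.closedShell_subset hw)]
    exact hρ _
  · rcases h.off z hz with h1 | h1 <;> rw [h1]
    exacts [⟨le_rfl, hm⟩, ⟨hm, le_rfl⟩]

theorem exists_slope (h : IsCollarHam φ α α' β' β m ρ H) (hn : 2 ≤ n) {b : Fin n → ℝ} {i₀ : Fin n}
    {C d r : ℝ} (hb : ∀ i ≠ i₀, 0 < b i ∧ b i < π) (hb₀ : π < b i₀ ∧ b i₀ < 2 * π) (hC : 0 < C)
    (hd : 0 < d) (hφ : ∀ w ∈ shell n α β, Cn.quad b (φ w) ≤ C)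
    (hH : ∀ z, C < Cn.quad b z → H z = m) (hr : 0 < r) (hr0 : ∀ z, ‖z‖ ≤ r → H z = 0)
    (hm : C + d ≤ m) (hρ : ∀ s, ρ s ∈ Icc 0 m) :
    ∃ s, ∃ k : ℤ, α < s ∧ s < β ∧ deriv ρ s = k * π ∧
      0 < k * π * s - ρ s ∧ k * π * s - ρ s ≤ C + d := by
  have hpi := pi_pos
  have hbpos : ∀ i, 0 < b i := fun i => by
    by_cases hi : i = i₀
    · subst hi; linarith [hb₀.1]
    · exact (hb i hi).1
  obtain ⟨δ, hδ, hquad⟩ := exists_le_quad hbpos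
  obtain ⟨B, hB0, hB⟩ := exists_abs_quad_le b
  have hq0 : ∀ z, 0 ≤ Cn.quad b z := fun z => le_trans (by positivity) (hquad z)
  have hHm := h.mem_Icc (by linarith) hρ
  let f : Cn n → ℝ := fun z => H z + growth C d (Cn.quad b z)
  have hf : ContDiff ℝ 2 f := h.contDiff.add (contDiff_growth.comp (contDiff_quad b))
  have hfd : ∀ z v, fderiv ℝ f z v = fderiv ℝ H z v +
      smoothTransition ((Cn.quad b z - C) / d) * (2 * inner ℝ (diagMul b z) v) := fun z v => by
    have h1 : HasFDerivAt (Cn.quad b) (fderiv ℝ (Cn.quad b) z) z :=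
      ((contDiff_quad (k := 1) b).differentiable (by simp) z).hasFDerivAt
    have h2 := (h.contDiff.differentiable (by simp) z).hasFDerivAt.add
      ((hasDerivAt_growth (C := C) (d := d) (Cn.quad b z)).comp_hasFDerivAt z h1)
    have h3 : fderiv ℝ f z = _ := h2.fderiv
    rw [h3, ← fderiv_quad]
    rfl
  have hσ0 : ∀ z, Cn.quad b z ≤ C → smoothTransition ((Cn.quad b z - C) / d) = 0 := fun z hz =>
    smoothTransition.zero_of_nonpos (div_nonpos_of_nonpos_of_nonneg (by linarith) hd.le)
  obtain ⟨K, M, M', γ, δ', hA⟩ := exists_isAsympQuadratic (f := f) (b := b) (i₀ := i₀)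
    (c := m + (growth C d (C + d) - (C + d))) (C := C + d) (R := √((C + d) / δ))
    (r := min r √(C / (B + 1))) hf
    (fun z hz => by
      have h1 : (C + d) / δ ≤ ‖z‖ ^ 2 := (Real.sqrt_le_left (norm_nonneg z)).1 hz
      rw [div_le_iff₀ hδ] at h1
      have h2 : C + d ≤ Cn.quad b z := by linarith [hquad z]
      simp only [f, growth_eq_add hd h2, hH z (by linarith)]
      ring)
    (fun z => add_nonneg (hHm z).1 (growth_nonneg (hq0 z)))
    (fun z => by
      have := sub_le_growth hC.le hd (hq0 z)
      have := (hHm z).1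
      simp only [f]
      linarith)
    (lt_min hr (Real.sqrt_pos.2 (by positivity)))
    (fun z hz => by
      have h1 := hz.trans (min_le_right _ _)
      have h2 : ‖z‖ ^ 2 ≤ C / (B + 1) :=
        (Real.le_sqrt (norm_nonneg z) (by positivity)).1 h1
      rw [le_div_iff₀ (by positivity)] at h2
      have h3 := (le_abs_self _).trans (hB z)
      have h4 : Cn.quad b z ≤ C := by nlinarith [sq_nonneg ‖z‖]
      simp only [f, growth_eq_zero hC.le hd h4, hr0 z (hz.trans (min_le_left _ _)), add_zero])
    hb hb₀ (by positivity)
  obtain ⟨x, hx, hper, hpos, hle⟩ := hA.exists_periodic_orbit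
  have hfH : ∀ w ∈ shell n α β, f (φ w) = H (φ w) := fun w hw => by
    simp only [f, growth_eq_zero hC.le hd (hφ w hw), add_zero]
  by_cases hcase : ∃ t₀, x t₀ ∈ φ '' shell n α β
  · obtain ⟨t₀, ht₀⟩ := hcase
    obtain ⟨s, k, hmem, hs1, hs2, hk, hact⟩ := h.exists_action_eq hn (G := gradient f)
      (fun w hw v => by rw [inner_gradient_eq, hfd, hσ0 _ (hφ w hw), zero_mul, add_zero]) hx hper ht₀
    have hact' : ∫ t in (0 : ℝ)..1, (1 / 2 * inner ℝ (gradient f (x t)) (x t) - f (x t)) =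
        k * π * s - ρ s := by
      rw [← hact]
      refine intervalIntegral.integral_congr fun t _ => ?_
      obtain ⟨w, hw, hwx⟩ := hmem t
      simp only [← hwx, hfH w hw]
    rw [hact'] at hpos hle
    exact ⟨s, k, hs1, hs2, hk, hpos, hle⟩
  · push Not at hcase
    exfalso
    have h_int : ∀ t, 1 / 2 * inner ℝ (gradient f (x t)) (x t) - f (x t) ≤ 0 := fun t => by
      have hoff : x t ∉ φ '' closedShell n α' β' :=
        fun ht => hcase t (image_mono h.closedShell_subset ht)
      rw [inner_gradient_eq, hfd, h.fderiv_off _ hoff, _root_.zero_apply,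
        inner_diagMul_self]
      change 1 / 2 * (0 + smoothTransition ((Cn.quad b (x t) - C) / d) * (2 * Cn.quad b (x t))) -
        (H (x t) + growth C d (Cn.quad b (x t))) ≤ 0
      rcases le_or_gt (Cn.quad b (x t)) C with hq | hq
      · rw [hσ0 _ hq, growth_eq_zero hC.le hd hq]
        linarith [(hHm (x t)).1]
      · rw [hH _ hq]
        linarith [mul_growth_deriv_sub_le hC.le hd (hq0 (x t))]
    have h1 : 0 ≤ ∫ t in (0 : ℝ)..1, -(1 / 2 * inner ℝ (gradient f (x t)) (x t) - f (x t)) :=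
      intervalIntegral.integral_nonneg zero_le_one fun t _ => by linarith [h_int t]
    rw [intervalIntegral.integral_neg] at h1
    linarith

end IsCollarHam

end Contradiction

section Profile

theorem exists_unit_profile {ε : ℝ} (hε : 0 < ε) : ∃ T : ℝ → ℝ, ContDiff ℝ ∞ T ∧
    (∀ x ≤ 0, T x = 0) ∧ (∀ x, 1 ≤ x → T x = 1) ∧ (∀ x, T x ∈ Icc 0 1) ∧
      ∀ x, T x ≤ ε ∨ 1 - ε ≤ T x ∨ 1 ≤ deriv T x := by
  obtain ⟨κ, hκ, hκ4, hκε⟩ : ∃ κ : ℝ, 0 < κ ∧ κ ≤ 1 / 4 ∧ 2 * κ ≤ ε :=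
    ⟨min (ε / 2) (1 / 4), lt_min (by linarith) (by norm_num), min_le_right _ _,
      by linarith [min_le_left (ε / 2) (1 / 4)]⟩
  let g : ℝ → ℝ := fun u => smoothTransition (u / κ) * smoothTransition ((1 - u) / κ)
  have hg : ContDiff ℝ ∞ g := (smoothTransition.contDiff.comp (contDiff_id.div_const κ)).mul
    (smoothTransition.contDiff.comp ((contDiff_const.sub contDiff_id).div_const κ))
  have hg0 : ∀ u, 0 ≤ g u := fun u => mul_nonneg (smoothTransition.nonneg _) (smoothTransition.nonneg _)
  have hg1 : ∀ u, g u ≤ 1 := fun u => mul_le_one₀ (smoothTransition.le_one _)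
    (smoothTransition.nonneg _) (smoothTransition.le_one _)
  have hgl : ∀ u ≤ 0, g u = 0 := fun u hu => by
    simp only [g, smoothTransition.zero_of_nonpos (div_nonpos_of_nonpos_of_nonneg hu hκ.le), zero_mul]
  have hgr : ∀ u, 1 ≤ u → g u = 0 := fun u hu => by
    simp only [g, smoothTransition.zero_of_nonpos
      (div_nonpos_of_nonpos_of_nonneg (sub_nonpos.2 hu) hκ.le), mul_zero]
  have hgm : ∀ u, κ ≤ u → u ≤ 1 - κ → g u = 1 := fun u hu hu' => by
    simp only [g]
    rw [smoothTransition.one_of_one_le ((one_le_div hκ).2 hu),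
      smoothTransition.one_of_one_le ((one_le_div hκ).2 (by linarith)), one_mul]
  let G : ℝ → ℝ := fun x => ∫ u in (0 : ℝ)..x, g u
  have hG : ∀ x, HasDerivAt G (g x) x := fun x =>
    intervalIntegral.integral_hasDerivAt_right (hg.continuous.intervalIntegrable _ _)
      (hg.continuous.stronglyMeasurableAtFilter _ _) hg.continuous.continuousAt
  have hGd : deriv G = g := funext fun x => (hG x).deriv
  have hGc : ContDiff ℝ ∞ G := contDiff_infty_iff_deriv.2
    ⟨fun x => (hG x).differentiableAt, hGd ▸ hg⟩
  have hmono : Monotone G := monotone_of_hasDerivAt_nonneg hG hg0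
  have hmono' : Monotone fun x => x - G x :=
    monotone_of_hasDerivAt_nonneg (fun x => (hasDerivAt_id x).sub (hG x)) fun x => sub_nonneg.2 (hg1 x)
  have hadd : ∀ x y, G x + ∫ u in x..y, g u = G y := fun x y =>
    intervalIntegral.integral_add_adjacent_intervals (hg.continuous.intervalIntegrable _ _)
      (hg.continuous.intervalIntegrable _ _)
  have hG0 : G 0 = 0 := intervalIntegral.integral_same
  have hGl : ∀ x ≤ 0, G x = 0 := fun x hx => by
    refine (intervalIntegral.integral_congr (g := fun _ => 0) fun u hu => ?_).trans (by simp)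
    rw [uIcc_of_ge hx] at hu
    exact hgl u hu.2
  have hGr : ∀ x, 1 ≤ x → G x = G 1 := fun x hx => by
    rw [← hadd 1 x, add_eq_left]
    refine (intervalIntegral.integral_congr (g := fun _ => 0) fun u hu => ?_).trans (by simp)
    rw [uIcc_of_le hx] at hu
    exact hgr u hu.1
  have hmid : G κ + (1 - 2 * κ) = G (1 - κ) := by
    rw [← hadd κ (1 - κ), add_right_inj]
    refine Eq.symm <| (intervalIntegral.integral_congr (g := fun _ => 1) fun u hu => ?_).trans ?_
    · rw [uIcc_of_le (by linarith)] at hu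
      exact hgm u hu.1 hu.2
    · simp; ring
  have hκ0 : 0 ≤ G κ := hG0 ▸ hmono hκ.le
  have hκκ : G κ ≤ κ := by
    have := hmono' hκ.le
    simp only [hG0] at this
    linarith
  have hZ1 : G 1 ≤ 1 := by
    have := hmono' (zero_le_one (α := ℝ))
    simp only [hG0] at this
    linarith
  have hZκ : G 1 - G (1 - κ) ≤ κ := by
    have := hmono' (show 1 - κ ≤ 1 by linarith)
    simp only at this
    linarith
  have hZ2 : 1 / 2 ≤ G 1 := by
    have := hmono (show 1 - κ ≤ 1 by linarith)
    linarith
  have hZ : 0 < G 1 := by linarith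
  have hGle : ∀ x, G x ≤ G 1 := fun x => by
    rcases le_total x 1 with h | h
    exacts [hmono h, (hGr x h).le]
  have hGnn : ∀ x, 0 ≤ G x := fun x => by
    rcases le_total 0 x with h | h
    exacts [hG0 ▸ hmono h, (hGl x h).ge]
  refine ⟨fun x => G x / G 1, hGc.div_const _, fun x hx => by simp only [hGl x hx, zero_div],
    fun x hx => by simp only [hGr x hx, div_self hZ.ne'],
    fun x => ⟨div_nonneg (hGnn x) hZ.le, (div_le_one hZ).2 (hGle x)⟩, fun x => ?_⟩
  have hκε' : κ ≤ ε * G 1 := by nlinarith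
  rcases le_total x κ with hx | hx
  · left
    rw [div_le_iff₀ hZ]
    linarith [hmono hx]
  rcases le_total x (1 - κ) with hx' | hx'
  · right; right
    rw [((hG x).div_const (G 1)).deriv, hgm x hx hx', one_le_div hZ]
    exact hZ1
  · right; left
    rw [le_div_iff₀ hZ]
    linarith [hmono hx']

theorem exists_profile {α β m η : ℝ} (hαβ : α < β) (hη : 0 < η) (hm : π * (β - α) < m) :
    ∃ ρ : ℝ → ℝ, ContDiff ℝ ∞ ρ ∧ (∀ s ≤ α, ρ s = 0) ∧ (∀ s, β ≤ s → ρ s = m) ∧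
      (∀ s, ρ s ∈ Icc 0 m) ∧ ∀ s, deriv ρ s = π → ρ s ≤ η ∨ m - η ≤ ρ s := by
  have hw : 0 < β - α := sub_pos.2 hαβ
  have hm0 : 0 < m := lt_trans (by positivity) hm
  obtain ⟨T, hT, hT0, hT1, hTI, hTd⟩ := exists_unit_profile (ε := η / m) (by positivity)
  have hd : ∀ s, HasDerivAt (fun s => m * T ((s - α) / (β - α)))
      (m * (deriv T ((s - α) / (β - α)) * (1 / (β - α)))) s := fun s =>
    ((hT.differentiable (by simp) _).hasDerivAt.comp s
      (((hasDerivAt_id s).sub_const α).div_const (β - α))).const_mul m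
  refine ⟨fun s => m * T ((s - α) / (β - α)), ?_, fun s hs => ?_, fun s hs => ?_, fun s => ?_,
    fun s hs => ?_⟩
  · exact contDiff_const.mul (hT.comp ((contDiff_id.sub contDiff_const).div_const _))
  · change m * T ((s - α) / (β - α)) = 0
    rw [hT0 _ (div_nonpos_of_nonpos_of_nonneg (sub_nonpos.2 hs) hw.le), mul_zero]
  · change m * T ((s - α) / (β - α)) = m
    rw [hT1 _ ((one_le_div hw).2 (by linarith)), mul_one]
  · exact ⟨mul_nonneg hm0.le (hTI _).1, mul_le_of_le_one_right hm0.le (hTI _).2⟩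
  · rw [(hd s).deriv] at hs
    rcases hTd ((s - α) / (β - α)) with h | h | h
    · left
      rwa [le_div_iff₀ hm0, mul_comm] at h
    · right
      have h2 := mul_le_mul_of_nonneg_left h hm0.le
      rwa [mul_sub, mul_one, mul_div_cancel₀ _ hm0.ne'] at h2
    · exfalso
      have h2 : m * (1 * (1 / (β - α))) ≤ π := by rw [← hs]; gcongr
      rw [one_mul, mul_one_div, div_le_iff₀ hw] at h2
      linarith

end Profile

section Ellipsoid

variable {n : ℕ}

/-- The quadratic form whose unit sublevel set is the ellipsoid with half axes `a`. -/
def ellForm (a : Fin n → ℝ) : Cn n → ℝ := Cn.quad fun i => (a i ^ 2)⁻¹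

variable {a : Fin n → ℝ}

theorem continuous_ellForm : Continuous (ellForm a) := (contDiff_quad (k := 0) _).continuous

theorem ellForm_diagMul (ha : ∀ i, 0 < a i) (w : Cn n) : ellForm a (diagMul a w) = ‖w‖ ^ 2 := by
  rw [Cn.norm_sq, ellForm, Cn.quad]
  refine Finset.sum_congr rfl fun i _ => ?_
  have := (ha i).ne'
  simp only [diagMul, norm_mul, Complex.norm_real, mul_pow, Real.norm_eq_abs, sq_abs]
  field_simp

theorem diagMul_inv (ha : ∀ i, 0 < a i) (z : Cn n) : diagMul a (diagMul (fun i => (a i)⁻¹) z) = z := by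
  ext i
  have : (a i : ℂ) ≠ 0 := by exact_mod_cast (ha i).ne'
  simp only [diagMul, Complex.ofReal_inv]
  field_simp

theorem preimage_ellForm (ha : ∀ i, 0 < a i) (S : Set ℝ) :
    ellForm a ⁻¹' S = diagMulL a '' ((fun w : Cn n => ‖w‖ ^ 2) ⁻¹' S) := by
  ext z
  refine ⟨fun hz => ⟨diagMul (fun i => (a i)⁻¹) z, ?_, diagMul_inv ha z⟩, ?_⟩
  · rw [mem_preimage, ← ellForm_diagMul ha, diagMul_inv ha]
    exact hz
  · rintro ⟨w, hw, rfl⟩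
    rw [mem_preimage, diagMulL_apply, ellForm_diagMul ha]
    exact hw

theorem preimage_norm_sq_Iio (t : ℝ) : (fun w : Cn n => ‖w‖ ^ 2) ⁻¹' Iio t = ball 0 √t := by
  ext w
  rw [mem_ball_zero_iff, Real.lt_sqrt (norm_nonneg w)]
  rfl

theorem preimage_norm_sq_Iic {t : ℝ} (ht : 0 ≤ t) :
    (fun w : Cn n => ‖w‖ ^ 2) ⁻¹' Iic t = closedBall 0 √t := by
  ext w
  rw [mem_closedBall_zero_iff, Real.le_sqrt (norm_nonneg w) ht]
  rfl

theorem isPreconnected_ellForm_Iic (ha : ∀ i, 0 < a i) {t : ℝ} (ht : 0 ≤ t) :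
    IsPreconnected (ellForm a ⁻¹' Iic t) := by
  rw [preimage_ellForm ha, preimage_norm_sq_Iic ht]
  exact (convex_closedBall 0 √t).isPreconnected.image _ (diagMulL a).continuous.continuousOn

theorem isPreconnected_ellForm_Ici (hn : 1 ≤ n) (ha : ∀ i, 0 < a i) {t : ℝ} (ht : 0 < t) :
    IsPreconnected (ellForm a ⁻¹' Ici t) := by
  rw [preimage_ellForm ha]
  have h : (fun w : Cn n => ‖w‖ ^ 2) ⁻¹' Ici t = {w : Cn n | ‖w‖ ∈ Ici √t} := by
    ext w
    exact (Real.sqrt_le_left (norm_nonneg w)).symm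
  rw [h]
  exact (isPreconnected_norm_mem hn isPreconnected_Ici fun s hs => (Real.sqrt_pos.2 ht).trans_le hs).image _
    (diagMulL a).continuous.continuousOn

/-- The volume of the ellipsoid with half axes `a`. -/
def ellVol (a : Fin n → ℝ) : ℝ := volume.real (ellForm a ⁻¹' Iio 1)

theorem Cn.volume_real_ball {r : ℝ} (hr : 0 < r) :
    volume.real (ball (0 : Cn n) r) =
      r ^ Module.finrank ℝ (Cn n) * volume.real (ball (0 : Cn n) 1) := by
  rw [Measure.real, Measure.addHaar_ball_of_pos _ _ hr, ENNReal.toReal_mul, ENNReal.toReal_ofReal (by positivity)]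
  rfl

theorem volume_real_image (s : Set (Cn n)) :
    volume.real (diagMulL a '' s) = |(diagMulL a).det| * volume.real s := by
  rw [Measure.real, Measure.addHaar_image_continuousLinearMap, ENNReal.toReal_mul,
    ENNReal.toReal_ofReal (abs_nonneg _)]
  rfl

theorem volume_real_ellForm_Iio (ha : ∀ i, 0 < a i) {t : ℝ} (ht : 0 < t) :
    volume.real (ellForm a ⁻¹' Iio t) = √t ^ Module.finrank ℝ (Cn n) * ellVol a := by
  rw [ellVol, preimage_ellForm ha, preimage_ellForm ha, preimage_norm_sq_Iio, preimage_norm_sq_Iio,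
    volume_real_image, volume_real_image, Cn.volume_real_ball (Real.sqrt_pos.2 ht), Real.sqrt_one]
  ring

theorem volume_real_ellForm_Iic (ha : ∀ i, 0 < a i) {t : ℝ} (ht : 0 < t) :
    volume.real (ellForm a ⁻¹' Iic t) = √t ^ Module.finrank ℝ (Cn n) * ellVol a := by
  rw [← volume_real_ellForm_Iio ha ht, preimage_ellForm ha, preimage_ellForm ha, preimage_norm_sq_Iio,
    preimage_norm_sq_Iic ht.le, volume_real_image, volume_real_image, Measure.real, Measure.real,
    Measure.addHaar_closedBall _ _ (Real.sqrt_nonneg t), Measure.addHaar_ball_of_pos _ _ (Real.sqrt_pos.2 ht)]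

theorem isCompact_ellForm_Iic (ha : ∀ i, 0 < a i) {t : ℝ} (ht : 0 ≤ t) :
    IsCompact (ellForm a ⁻¹' Iic t) := by
  rw [preimage_ellForm ha, preimage_norm_sq_Iic ht]
  exact (isCompact_closedBall _ _).image (diagMulL a).continuous

theorem volume_ellForm_Iic_ne_top (ha : ∀ i, 0 < a i) {t : ℝ} (ht : 0 ≤ t) :
    volume (ellForm a ⁻¹' Iic t) ≠ ⊤ := (isCompact_ellForm_Iic ha ht).measure_lt_top.ne

theorem volume_real_ellForm_Ioo (ha : ∀ i, 0 < a i) {s t : ℝ} (hs : 0 < s) (hst : s < t) :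
    volume.real (ellForm a ⁻¹' Ioo s t) =
      (√t ^ Module.finrank ℝ (Cn n) - √s ^ Module.finrank ℝ (Cn n)) * ellVol a := by
  have h : ellForm a ⁻¹' Ioo s t = ellForm a ⁻¹' Iio t \ ellForm a ⁻¹' Iic s := by
    ext z
    simp only [mem_preimage, mem_Ioo, Set.mem_sdiff, mem_Iio, mem_Iic, not_le]
    exact and_comm
  have hsub : ellForm a ⁻¹' Iic s ⊆ ellForm a ⁻¹' Iio t := fun z hz => lt_of_le_of_lt hz hst
  rw [h, measureReal_sdiff hsub
    (isClosed_Iic.preimage continuous_ellForm).measurableSet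
    (measure_ne_top_of_subset (preimage_mono Iio_subset_Iic_self)
      (volume_ellForm_Iic_ne_top ha (hs.trans hst).le)), volume_real_ellForm_Iio ha (hs.trans hst), volume_real_ellForm_Iic ha hs]
  ring

theorem ellForm_le {a₀ : ℝ} (h0 : 0 < a₀) (ha : ∀ i, a₀ ≤ a i) (z : Cn n) :
    ellForm a z ≤ ‖z‖ ^ 2 / a₀ ^ 2 := by
  rw [Cn.norm_sq, Finset.sum_div, ellForm, Cn.quad]
  refine Finset.sum_le_sum fun i _ => ?_
  rw [mul_comm, div_eq_mul_inv]
  gcongr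
  exact ha i

theorem lt_ellVol {a₀ : ℝ} (h0 : 0 < a₀) (ha : ∀ i, a₀ ≤ a i) {j : Fin n} (hj : a₀ < a j) :
    a₀ ^ Module.finrank ℝ (Cn n) * volume.real (ball (0 : Cn n) 1) < ellVol a := by
  have ha' : ∀ i, 0 < a i := fun i => h0.trans_le (ha i)
  rw [← Cn.volume_real_ball h0, ellVol]
  have hfin : volume (ellForm a ⁻¹' Iio 1) ≠ ⊤ :=
    measure_ne_top_of_subset (preimage_mono Iio_subset_Iic_self)
      (volume_ellForm_Iic_ne_top ha' zero_le_one)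
  have hball : ball 0 a₀ ⊆ ellForm a ⁻¹' Iio 1 := fun z hz => by
    rw [mem_ball_zero_iff] at hz
    refine (ellForm_le h0 ha z).trans_lt ?_
    rw [div_lt_one (by positivity)]
    gcongr
  let W := ellForm a ⁻¹' Iio 1 ∩ (closedBall 0 a₀)ᶜ
  have hW : IsOpen W := (isOpen_Iio.preimage continuous_ellForm).inter isClosed_closedBall.isOpen_compl
  have hWne : W.Nonempty := by
    refine ⟨EuclideanSpace.single j (((a₀ + a j) / 2 : ℝ) : ℂ), ?_, ?_⟩
    · have h1 : ellForm a (EuclideanSpace.single j (((a₀ + a j) / 2 : ℝ) : ℂ)) =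
          (a j ^ 2)⁻¹ * ((a₀ + a j) / 2) ^ 2 := by
        rw [ellForm, Cn.quad, Finset.sum_eq_single j]
        · simp only [PiLp.single_apply, if_true, Complex.norm_real, Real.norm_eq_abs, sq_abs]
        · intro i _ hij
          simp [hij]
        · simp
      rw [mem_preimage, h1, mem_Iio, inv_mul_lt_one₀ (by have := ha' j; positivity)]
      have : (a₀ + a j) / 2 < a j := by linarith
      have : 0 ≤ (a₀ + a j) / 2 := by linarith [ha' j]
      gcongr
    · rw [mem_compl_iff, mem_closedBall_zero_iff, not_le, PiLp.norm_single,
        Complex.norm_real, Real.norm_eq_abs]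
      exact lt_of_lt_of_le (by linarith) (le_abs_self _)
  have hWpos : 0 < volume.real W :=
    ENNReal.toReal_pos (hW.measure_pos volume hWne).ne'
      (measure_ne_top_of_subset inter_subset_left hfin)
  have hdisj : Disjoint (ball 0 a₀) W :=
    disjoint_left.2 fun z hz hzW => hzW.2 (ball_subset_closedBall hz)
  have hunion := measureReal_union hdisj hW.measurableSet (μ := volume)
    (measure_ne_top_of_subset hball hfin) (measure_ne_top_of_subset inter_subset_left hfin)
  have hle : volume.real (ball 0 a₀ ∪ W) ≤ volume.real (ellForm a ⁻¹' Iio 1) :=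
    measureReal_mono (union_subset hball inter_subset_left) hfin
  linarith

theorem exists_thickness {a₀ : ℝ} (h0 : 0 < a₀) (ha : ∀ i, a₀ ≤ a i) {j : Fin n} (hj : a₀ < a j) :
    ∃ ε, 0 < ε ∧ ε < 1 ∧
      (a₀ * √(1 + 8 * ε)) ^ Module.finrank ℝ (Cn n) * volume.real (ball (0 : Cn n) 1) <
        √(1 - ε) ^ Module.finrank ℝ (Cn n) * ellVol a ∧
      (√(1 + ε) ^ Module.finrank ℝ (Cn n) - √(1 - ε) ^ Module.finrank ℝ (Cn n)) * ellVol a <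
        √(a₀ ^ 2 / 2) ^ Module.finrank ℝ (Cn n) * volume.real (ball (0 : Cn n) 1) := by
  have hv : 0 < volume.real (ball (0 : Cn n) 1) :=
    ENNReal.toReal_pos (measure_ball_pos volume _ one_pos).ne' measure_ball_lt_top.ne
  set d := Module.finrank ℝ (Cn n)
  set v := volume.real (ball (0 : Cn n) 1)
  have c1 : Continuous fun ε : ℝ => (a₀ * √(1 + 8 * ε)) ^ d * v := by fun_prop
  have c2 : Continuous fun ε : ℝ => √(1 - ε) ^ d * ellVol a := by fun_prop
  have c3 : Continuous fun ε : ℝ => (√(1 + ε) ^ d - √(1 - ε) ^ d) * ellVol a := by fun_prop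
  have e1 : ∀ᶠ ε in 𝓝[>] (0 : ℝ), (a₀ * √(1 + 8 * ε)) ^ d * v < √(1 - ε) ^ d * ellVol a :=
    nhdsWithin_le_nhds <| c1.continuousAt.eventually_lt c2.continuousAt (by
      simpa using lt_ellVol h0 ha hj)
  have e2 : ∀ᶠ ε in 𝓝[>] (0 : ℝ), (√(1 + ε) ^ d - √(1 - ε) ^ d) * ellVol a <
      √(a₀ ^ 2 / 2) ^ d * v :=
    nhdsWithin_le_nhds <| c3.continuousAt.eventually_lt continuousAt_const (by
      simp only [add_zero, sub_zero, sub_self, zero_mul]; positivity)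
  have e3 : ∀ᶠ ε in 𝓝[>] (0 : ℝ), ε < 1 := nhdsWithin_le_nhds (eventually_lt_nhds one_pos)
  obtain ⟨ε, h1, h2, h3, h4⟩ := (e1.and (e2.and (e3.and self_mem_nhdsWithin))).exists
  exact ⟨ε, h4, h3, h1, h2⟩

end Ellipsoid

section Nonsqueezing

variable {n : ℕ}

theorem exists_isCollarHam {φ : Cn n → Cn n} {N : Set (Cn n)} (hφ : IsSymp φ N) (hn : 1 ≤ n)
    {α α' β' β m : ℝ} {ρ : ℝ → ℝ} (hα : 0 ≤ α) (h₁ : α < α') (h₂ : α' < β') (h₃ : β' < β)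
    (hN : shell n α β ⊆ N) (hρ : ContDiff ℝ ∞ ρ) (hρ0 : ∀ s ≤ α', ρ s = 0)
    (hρm : ∀ s, β' ≤ s → ρ s = m) : ∃ H, IsCollarHam φ α α' β' β m ρ H := by
  have hs : IsSymp φ (shell n α β) :=
    ⟨isOpen_shell α β, hφ.smooth.mono hN, hφ.inj.mono hN, fun p hp => hφ.symp p (hN hp)⟩
  obtain ⟨e, he, hsrc, -, hsymm⟩ := hs.exists_chart
  have hsub : closedShell n α' β' ⊆ e.source := by
    rw [hsrc]
    exact fun w hw => ⟨h₁.trans_le hw.1, hw.2.trans_lt h₃⟩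
  have hne : (closedShell n α' β').Nonempty := by
    refine ⟨EuclideanSpace.single ⟨0, hn⟩ ((√α' : ℝ) : ℂ), ?_⟩
    have h : ‖(EuclideanSpace.single ⟨0, hn⟩ ((√α' : ℝ) : ℂ) : Cn n)‖ ^ 2 = α' := by
      rw [PiLp.norm_single, Complex.norm_real, Real.norm_eq_abs, sq_abs,
        Real.sq_sqrt (hα.trans h₁.le)]
    rw [mem_closedShell, h]
    exact ⟨le_rfl, h₂.le⟩
  have himg : e '' closedShell n α' β' = φ '' closedShell n α' β' :=
    image_congr fun w _ => he w
  have hc : Continuous fun w : Cn n => ‖w‖ ^ 2 := by fun_prop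
  obtain ⟨H, hH, hcomp, hoff, hfoff⟩ := exists_extension e hsymm
    (hsrc ▸ isPreconnected_shell hn hα) (isCompact_closedShell α' β') hsub hne
    (F := fun w => ρ (‖w‖ ^ 2)) (m := m) (hρ.comp (contDiff_norm_sq ℝ)) (by
      intro w _ hwK
      rw [mem_closedShell, not_and_or, not_le, not_le] at hwK
      refine hwK.imp (fun h => ?_) fun h => ?_
      · filter_upwards [hc.continuousAt.eventually (eventually_lt_nhds h)] with x hx
        exact hρ0 _ hx.le
      · filter_upwards [hc.continuousAt.eventually (eventually_gt_nhds h)] with x hx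
        exact hρm _ hx.le)
  rw [himg] at hoff hfoff
  exact ⟨H, hα, h₁, h₂, h₃, hs, hρ, hρ0, hρm, hH,
    fun w hw => by rw [← he w]; exact hcomp w (by rw [hsrc]; exact hw), hoff, hfoff⟩

theorem IsCollarHam.exists_const {φ : Cn n → Cn n} {α α' β' β m : ℝ} {ρ : ℝ → ℝ} {H : Cn n → ℝ}
    (h : IsCollarHam φ α α' β' β m ρ H) {S : Set (Cn n)} (hS : IsPreconnected S)
    (hd : Disjoint S (φ '' closedShell n α' β')) :
    ∃ c, (c = 0 ∨ c = m) ∧ ∀ z ∈ S, H z = c := by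
  rcases S.eq_empty_or_nonempty with rfl | ⟨z₀, hz₀⟩
  · exact ⟨0, .inl rfl, by simp⟩
  · have hmaps : MapsTo H S {0, m} := fun z hz => h.off z (disjoint_left.1 hd hz)
    exact ⟨H z₀, hmaps hz₀, fun z hz =>
      hS.constant_of_mapsTo (Set.toFinite {0, m}).isDiscrete h.contDiff.continuous.continuousOn hmaps hz hz₀⟩

theorem integrable_of_eq_zero {f : Cn n → ℝ} (hf : Continuous f) {R : ℝ}
    (hR : ∀ z, R ≤ ‖z‖ → f z = 0) : Integrable f := by
  refine hf.integrable_of_hasCompactSupport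
    (HasCompactSupport.intro (isCompact_closedBall 0 R) fun z hz => hR z ?_)
  rw [mem_closedBall_zero_iff, not_le] at hz
  exact hz.le

theorem mul_volume_le_integral {f : Cn n → ℝ} (hf : Integrable f) (hf0 : ∀ z, 0 ≤ f z)
    {A : Set (Cn n)} (hA : MeasurableSet A) (hAfin : volume A ≠ ⊤) {m : ℝ} (hm : ∀ z ∈ A, m ≤ f z) :
    m * volume.real A ≤ ∫ z, f z := by
  have h : ∫ z, A.indicator (fun _ => m) z = m * volume.real A := by
    rw [integral_indicator hA, setIntegral_const, smul_eq_mul, mul_comm]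
  rw [← h]
  refine integral_mono ((integrable_indicator_iff hA).2 (integrableOn_const hAfin)) hf fun z => ?_
  by_cases hz : z ∈ A
  · simpa [hz] using hm z hz
  · simpa [hz] using hf0 z

theorem integral_le_mul_volume {f : Cn n → ℝ} (hf : Integrable f) {A : Set (Cn n)}
    (hA : MeasurableSet A) (hAfin : volume A ≠ ⊤) {m : ℝ} (hm : ∀ z, f z ≤ m)
    (hf0 : ∀ z ∉ A, f z ≤ 0) : ∫ z, f z ≤ m * volume.real A := by
  have h : ∫ z, A.indicator (fun _ => m) z = m * volume.real A := by
    rw [integral_indicator hA, setIntegral_const, smul_eq_mul, mul_comm]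
  rw [← h]
  refine integral_mono hf ((integrable_indicator_iff hA).2 (integrableOn_const hAfin)) fun z => ?_
  by_cases hz : z ∈ A
  · simpa [hz] using hm z
  · simpa [hz] using hf0 z hz

theorem integral_radial_bounds {α β m : ℝ} {ρ : ℝ → ℝ} (hα : 0 < α) (hαβ : α < β)
    (hρ : Continuous ρ) (hρ0 : ∀ s ≤ α, ρ s = 0) (hρm : ∀ s, β ≤ s → ρ s = m)
    (hρI : ∀ s, ρ s ∈ Icc 0 m) :
    m * (√α ^ Module.finrank ℝ (Cn n) * volume.real (ball (0 : Cn n) 1)) ≤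
        ∫ w : Cn n, (m - ρ (‖w‖ ^ 2)) ∧
      ∫ w : Cn n, (m - ρ (‖w‖ ^ 2)) ≤
        m * (√β ^ Module.finrank ℝ (Cn n) * volume.real (ball (0 : Cn n) 1)) := by
  have hβ := hα.trans hαβ
  have h_int : Integrable fun w : Cn n => m - ρ (‖w‖ ^ 2) := by
    refine integrable_of_eq_zero (R := √β) (by fun_prop) fun z hz => ?_
    rw [hρm _ ((Real.sqrt_le_left (norm_nonneg z)).1 hz), sub_self]
  rw [← Cn.volume_real_ball (Real.sqrt_pos.2 hα), ← Cn.volume_real_ball (Real.sqrt_pos.2 hβ)]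
  constructor
  · refine mul_volume_le_integral h_int (fun z => sub_nonneg.2 (hρI _).2) measurableSet_ball
      measure_ball_lt_top.ne fun z hz => ?_
    rw [mem_ball_zero_iff, Real.lt_sqrt (norm_nonneg z)] at hz
    rw [hρ0 _ hz.le, sub_zero]
  · refine integral_le_mul_volume h_int measurableSet_ball measure_ball_lt_top.ne
      (fun z => by linarith [(hρI (‖z‖ ^ 2)).1]) fun z hz => ?_
    rw [mem_ball_zero_iff, Real.lt_sqrt (norm_nonneg z), not_lt] at hz
    rw [hρm _ hz, sub_self]

theorem exists_shell_subset {N : Set (Cn n)} (hN : IsOpen N) {r : ℝ} (hr : 0 < r)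
    (hrN : sphere 0 r ⊆ N) : ∃ σ > 0, ∀ τ ≤ σ, shell n (r ^ 2 - τ) (r ^ 2 + τ) ⊆ N := by
  obtain ⟨δ, hδ, hδN⟩ := (isCompact_sphere (0 : Cn n) r).exists_thickening_subset_open hN hrN
  refine ⟨min (r * δ) (r ^ 2), by positivity, fun τ hτ w hw => hδN ?_⟩
  have hτ1 := hτ.trans (min_le_left _ _)
  have hτ2 := hτ.trans (min_le_right _ _)
  obtain ⟨h1, h2⟩ : r ^ 2 - τ < ‖w‖ ^ 2 ∧ ‖w‖ ^ 2 < r ^ 2 + τ := hw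
  have hw0 : 0 < ‖w‖ := by
    refine (norm_nonneg w).lt_of_ne fun h => ?_
    rw [← h] at h1
    linarith
  rw [mem_thickening_iff]
  refine ⟨(r / ‖w‖) • w, ?_, ?_⟩
  · rw [mem_sphere_zero_iff_norm, norm_smul, Real.norm_eq_abs, abs_of_pos (by positivity)]
    field_simp
  · have h3 : w - (r / ‖w‖) • w = (1 - r / ‖w‖) • w := by rw [sub_smul, one_smul]
    have h4 : ‖w‖ * (1 - r / ‖w‖) = ‖w‖ - r := by field_simp
    rw [dist_eq_norm, h3, norm_smul, mul_comm, ← norm_norm w, ← norm_mul, norm_norm, h4,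
      Real.norm_eq_abs, abs_lt]
    constructor <;> nlinarith

end Nonsqueezing

section EllipsoidalShell

variable {n : ℕ} {a : Fin n → ℝ}

theorem quad_le_ellForm {a₀ ε : ℝ} {b : Fin n → ℝ}
    (hb : ∀ i, b i ≤ π * (1 + ε) * a₀ ^ 2 * (a i ^ 2)⁻¹) (z : Cn n) :
    Cn.quad b z ≤ π * (1 + ε) * a₀ ^ 2 * ellForm a z := by
  rw [ellForm, Cn.quad, Cn.quad, Finset.mul_sum]
  refine Finset.sum_le_sum fun i _ => ?_
  rw [← mul_assoc]
  exact mul_le_mul_of_nonneg_right (hb i) (sq_nonneg _)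

theorem IsCollarHam.slope_contradiction {φ : Cn n → Cn n} {H : Cn n → ℝ} {ρ : ℝ → ℝ} {i₀ : Fin n}
    {q τ ε : ℝ} (hn : 2 ≤ n) (h : IsCollarHam φ (q - 2 * τ) (q - τ) (q + τ) (q + 2 * τ)
      (π * (q + 3 * τ)) ρ H)
    (h0 : 0 < a i₀) (ha : ∀ i, a i₀ ≤ a i) (hτ : 0 < τ) (hε : 0 < ε) (hε1 : ε < 1)
    (hτε : 4 * τ ≤ a i₀ ^ 2 * ε) (hq : a i₀ ^ 2 * (1 + 8 * ε) < q + τ)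
    (hφ : ∀ w ∈ shell n (q - 2 * τ) (q + 2 * τ), ellForm a (φ w) < 1 + ε)
    (hin : ∀ z, ellForm a z ≤ 1 - ε → H z = 0)
    (hout : ∀ z, 1 + ε ≤ ellForm a z → H z = π * (q + 3 * τ))
    (hρ : ∀ s, ρ s ∈ Icc 0 (π * (q + 3 * τ)))
    (hρπ : ∀ s, deriv ρ s = π → ρ s ≤ π * τ ∨ π * (q + 3 * τ) - π * τ ≤ ρ s) : False := by
  have hpi := pi_pos
  have ha' : ∀ i, 0 < a i := fun i => h0.trans_le (ha i)
  set A := a i₀ ^ 2 with hA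
  have hApos : 0 < A := by positivity
  classical
  let b : Fin n → ℝ := fun i => if i = i₀ then π * (1 + ε) else π / 2 * A * (a i ^ 2)⁻¹
  have hratio : ∀ i, A * (a i ^ 2)⁻¹ ≤ 1 := fun i => by
    rw [mul_inv_le_iff₀ (by have := ha' i; positivity), one_mul, hA]
    gcongr
    exact ha i
  have hb₀ : b i₀ = π * (1 + ε) := if_pos rfl
  have hb : ∀ i ≠ i₀, b i = π / 2 * A * (a i ^ 2)⁻¹ := fun i hi => if_neg hi
  have hbE : ∀ i, b i ≤ π * (1 + ε) * A * (a i ^ 2)⁻¹ := fun i => by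
    by_cases hi : i = i₀
    · subst hi
      rw [hb₀, ← hA, mul_assoc _ A, mul_inv_cancel₀ hApos.ne', mul_one]
    · rw [hb i hi]
      have := ha' i
      gcongr
      nlinarith
  have hquad := quad_le_ellForm hbE
  have hAε : 0 < A * ε := by positivity
  have hAε2 : A * ε ^ 2 ≤ A * ε := by nlinarith
  obtain ⟨s, k, hs1, hs2, hk, hpos, hle⟩ := h.exists_slope hn (b := b) (i₀ := i₀)
    (C := π * (1 + ε) ^ 2 * A) (d := π * ε * A) (r := √(1 - ε) * a i₀)
    (fun i hi => by
      have h1 := hratio i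
      have h2 := ha' i
      rw [hb i hi]
      refine ⟨by positivity, ?_⟩
      rw [mul_assoc]
      nlinarith)
    (by rw [hb₀]; constructor <;> nlinarith) (by positivity) (by positivity)
    (fun w hw => (hquad _).trans (by
      have := (hφ w hw).le
      calc π * (1 + ε) * A * ellForm a (φ w) ≤ π * (1 + ε) * A * (1 + ε) := by gcongr
        _ = π * (1 + ε) ^ 2 * A := by ring))
    (fun z hz => hout z (by
      have h1 := hz.trans_le (hquad z)
      by_contra! h2
      have h3 : π * (1 + ε) * A * ellForm a z ≤ π * (1 + ε) * A * (1 + ε) := by gcongr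
      nlinarith))
    (mul_pos (Real.sqrt_pos.2 (by linarith)) h0)
    (fun z hz => hin z ((ellForm_le h0 ha z).trans (by
      rw [div_le_iff₀ (by positivity)]
      calc ‖z‖ ^ 2 ≤ (√(1 - ε) * a i₀) ^ 2 := by gcongr
        _ = (1 - ε) * a i₀ ^ 2 := by rw [mul_pow, Real.sq_sqrt (by linarith)])))
    (by
      have h1 : (1 + ε) ^ 2 * A + ε * A ≤ q + 3 * τ := by nlinarith
      nlinarith) hρ
  have hle' : k * π * s - ρ s ≤ π * (A * (1 + 4 * ε)) := by
    have h1 : (1 + ε) ^ 2 * A + ε * A ≤ A * (1 + 4 * ε) := by nlinarith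
    nlinarith
  have hα : 0 ≤ q - 2 * τ := h.nonneg
  obtain ⟨hρ0, hρ1⟩ := hρ s
  rcases lt_trichotomy k 1 with hk1 | rfl | hk1
  · have hk0 : (k : ℝ) ≤ 0 := by exact_mod_cast Int.lt_add_one_iff.1 hk1
    have h1 : k * (π * s) ≤ 0 := mul_nonpos_of_nonpos_of_nonneg hk0 (by nlinarith)
    nlinarith
  · rw [Int.cast_one, one_mul] at hk hpos hle'
    have hs1' : π * (q - 2 * τ) < π * s := by gcongr
    have hs2' : π * s < π * (q + 2 * τ) := by gcongr
    rcases hρπ s hk with h1 | h1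
    · have h2 : A * (1 + 4 * ε) < q - 3 * τ := by nlinarith
      nlinarith
    · nlinarith
  · have hk2 : (2 : ℝ) ≤ k := by exact_mod_cast hk1
    have hs0 : 0 < s := hα.trans_lt hs1
    have h1 : 2 * (π * s) ≤ k * (π * s) := by gcongr
    have hs1' : π * (q - 2 * τ) < π * s := by gcongr
    have h2 : A * (1 + 4 * ε) < q - 7 * τ := by nlinarith
    nlinarith

/-- A thin neighbourhood of the boundary of an ellipsoid which is not a ball contains no symplectic
sphere of radius comparable to the smallest half axis. -/
theorem exists_sq_radius_le (hn : 2 ≤ n) {i₀ j : Fin n} (h0 : 0 < a i₀) (ha : ∀ i, a i₀ ≤ a i)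
    (hj : a i₀ < a j) : ∃ ε, 0 < ε ∧ ε < 1 ∧ ∀ (r : ℝ) (φ : Cn n → Cn n) (N : Set (Cn n)), 0 < r →
      IsSymp φ N → sphere 0 r ⊆ N → MapsTo φ N (ellForm a ⁻¹' Ioo (1 - ε) (1 + ε)) →
      r ^ 2 ≤ a i₀ ^ 2 / 2 := by
  obtain ⟨ε, hε, hε1, hvol₁, hvol₂⟩ := exists_thickness h0 ha hj
  refine ⟨ε, hε, hε1, fun r φ N hr hφ hrN hmaps => ?_⟩
  by_contra! hlt
  have hpi := pi_pos
  have hn1 : 1 ≤ n := by omega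
  have ha' : ∀ i, 0 < a i := fun i => h0.trans_le (ha i)
  have hv : 0 < volume.real (ball (0 : Cn n) 1) :=
    ENNReal.toReal_pos (measure_ball_pos volume _ one_pos).ne' measure_ball_lt_top.ne
  obtain ⟨σ, hσ, hσN⟩ := exists_shell_subset hφ.isOpen hr hrN
  obtain ⟨τ, hτ, hτσ, hτr, hτε⟩ : ∃ τ > 0, 2 * τ ≤ σ ∧ 2 * τ ≤ r ^ 2 - a i₀ ^ 2 / 2 ∧
      4 * τ ≤ a i₀ ^ 2 * ε := by
    have h1 : 0 < r ^ 2 - a i₀ ^ 2 / 2 := by linarith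
    refine ⟨min (σ / 2) (min ((r ^ 2 - a i₀ ^ 2 / 2) / 2) (a i₀ ^ 2 * ε / 4)), by positivity, ?_, ?_, ?_⟩
    · linarith [min_le_left (σ / 2) (min ((r ^ 2 - a i₀ ^ 2 / 2) / 2) (a i₀ ^ 2 * ε / 4))]
    · linarith [min_le_right (σ / 2) (min ((r ^ 2 - a i₀ ^ 2 / 2) / 2) (a i₀ ^ 2 * ε / 4)),
        min_le_left ((r ^ 2 - a i₀ ^ 2 / 2) / 2) (a i₀ ^ 2 * ε / 4)]
    · linarith [min_le_right (σ / 2) (min ((r ^ 2 - a i₀ ^ 2 / 2) / 2) (a i₀ ^ 2 * ε / 4)),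
        min_le_right ((r ^ 2 - a i₀ ^ 2 / 2) / 2) (a i₀ ^ 2 * ε / 4)]
  set q := r ^ 2
  have hA : 0 < a i₀ ^ 2 := by positivity
  set m := π * (q + 3 * τ) with hm
  have hm0 : 0 < m := mul_pos hpi (by linarith)
  obtain ⟨ρ, hρ, hρ0, hρm, hρI, hρπ⟩ := exists_profile (α := q - τ) (β := q + τ) (m := m)
    (η := π * τ) (by linarith) (by positivity) (by rw [hm]; gcongr; linarith)
  obtain ⟨H, h⟩ := exists_isCollarHam hφ hn1 (by linarith) (by linarith : q - 2 * τ < q - τ)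
    (by linarith) (by linarith : q + τ < q + 2 * τ) (hσN _ hτσ) hρ hρ0 hρm
  have himg : ∀ w ∈ shell n (q - 2 * τ) (q + 2 * τ), 1 - ε < ellForm a (φ w) ∧
      ellForm a (φ w) < 1 + ε := fun w hw => hmaps (hσN _ hτσ hw)
  have hdisj : ∀ S : Set ℝ, (∀ x ∈ S, x ≤ 1 - ε ∨ 1 + ε ≤ x) →
      Disjoint (ellForm a ⁻¹' S) (φ '' closedShell n (q - τ) (q + τ)) := by
    intro S hS
    refine disjoint_left.2 ?_
    rintro _ hz ⟨w, hw, rfl⟩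
    have h1 := himg w (h.closedShell_subset hw)
    rcases hS _ hz with h2 | h2 <;> linarith
  obtain ⟨c₁, hc₁, hin⟩ := h.exists_const (isPreconnected_ellForm_Iic ha' (by linarith : 0 ≤ 1 - ε))
    (hdisj _ fun x hx => .inl hx)
  obtain ⟨c₂, hc₂, hout⟩ := h.exists_const
    (isPreconnected_ellForm_Ici hn1 ha' (by linarith : 0 < 1 + ε)) (hdisj _ fun x hx => .inr hx)
  obtain ⟨R, hR⟩ := (isCompact_ellForm_Iic ha' (by linarith : 0 ≤ 1 + ε)).isBounded.subset_closedBall 0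
  have hfar : ∀ z, R + 1 ≤ ‖z‖ → H z = c₂ := fun z hz => by
    refine hout z ?_
    change 1 + ε ≤ ellForm a z
    by_contra! hz'
    have h1 := hR hz'.le
    rw [mem_closedBall_zero_iff] at h1
    linarith
  have hHm := h.mem_Icc hm0.le hρI
  have hJ := h.integral_eq hn hfar
  obtain ⟨hJ₁, hJ₂⟩ := integral_radial_bounds (n := n) (by linarith : 0 < q - τ)
    (by linarith : q - τ < q + τ) hρ.continuous hρ0 hρm hρI
  set J := ∫ w : Cn n, (m - ρ (‖w‖ ^ 2))
  set v := volume.real (ball (0 : Cn n) 1)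
  set d := Module.finrank ℝ (Cn n)
  have h_int : Integrable fun z => c₂ - H z :=
    integrable_of_eq_zero (continuous_const.sub h.contDiff.continuous) fun z hz => by
      rw [hfar z hz, sub_self]
  have hJ₃ : m * (√(a i₀ ^ 2 / 2) ^ d * v) ≤ J := by
    refine le_trans ?_ hJ₁
    have : a i₀ ^ 2 / 2 ≤ q - τ := by linarith
    gcongr
  rcases hc₂ with rfl | rfl
  · have h1 : ∫ z, (0 - H z) ≤ 0 := integral_nonpos fun z => by
      change 0 - H z ≤ 0
      linarith [(hHm z).1]
    have h2 : 0 < m * (√(a i₀ ^ 2 / 2) ^ d * v) := by positivity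
    linarith
  · rcases hc₁ with rfl | rfl
    · have h1 := mul_volume_le_integral h_int (fun z => sub_nonneg.2 (hHm z).2)
        (isClosed_Iic.preimage continuous_ellForm).measurableSet
        (volume_ellForm_Iic_ne_top ha' (by linarith : 0 ≤ 1 - ε)) (m := m)
        fun z hz => by rw [hin z hz, sub_zero]
      rw [volume_real_ellForm_Iic ha' (by linarith), hJ] at h1
      have h2 : (a i₀ * √(1 + 8 * ε)) ^ d * v < √(q + τ) ^ d * v :=
        hvol₁.trans_le (le_of_mul_le_mul_left (h1.trans hJ₂) hm0)
      have h3 := lt_of_pow_lt_pow_left₀ d (Real.sqrt_nonneg _) (lt_of_mul_lt_mul_right h2 hv.le)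
      have h4 := (Real.lt_sqrt (by positivity)).1 h3
      rw [mul_pow, Real.sq_sqrt (by linarith)] at h4
      exact h.slope_contradiction hn h0 ha hτ hε hε1 hτε h4 (fun w hw => (himg w hw).2)
        (fun z hz => hin z hz) (fun z hz => hout z hz) hρI hρπ
    · have h1 := integral_le_mul_volume h_int
        (isOpen_Ioo.preimage continuous_ellForm).measurableSet
        (measure_ne_top_of_subset (preimage_mono fun x hx => hx.2.le)
          (volume_ellForm_Iic_ne_top ha' (by linarith : 0 ≤ 1 + ε)))
        (A := ellForm a ⁻¹' Ioo (1 - ε) (1 + ε)) (m := m) (fun z => by linarith [(hHm z).1])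
        fun z hz => by
          rw [mem_preimage, mem_Ioo, not_and_or, not_lt, not_lt] at hz
          rcases hz with hz | hz
          · rw [hin z hz, sub_self]
          · rw [hout z hz, sub_self]
      rw [volume_real_ellForm_Ioo ha' (by linarith) (by linarith), hJ] at h1
      have h2 := mul_lt_mul_of_pos_left hvol₂ hm0
      linarith

end EllipsoidalShell

section Transfer

variable {n : ℕ}

/-- The identification of `ℝ^{2n}` with `ℂⁿ` sending `(x, y)` to `x + iy`. -/
def toCn (n : ℕ) : R2n n →ₗ[ℝ] Cn n where
  toFun z := WithLp.toLp 2 fun i =>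
    ⟨z ⟨2 * i.1, by have := i.isLt; omega⟩, z ⟨2 * i.1 + 1, by have := i.isLt; omega⟩⟩
  map_add' u v := by ext i; rfl
  map_smul' c u := by
    ext i
    apply Complex.ext <;> simp

theorem toCn_apply (z : R2n n) (i : Fin n) : toCn n z i =
    ⟨z ⟨2 * i.1, by have := i.isLt; omega⟩, z ⟨2 * i.1 + 1, by have := i.isLt; omega⟩⟩ := rfl

theorem norm_sq_toCn_apply (z : R2n n) (i : Fin n) : ‖toCn n z i‖ ^ 2 =
    z ⟨2 * i.1, by have := i.isLt; omega⟩ ^ 2 + z ⟨2 * i.1 + 1, by have := i.isLt; omega⟩ ^ 2 := by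
  rw [toCn_apply, Complex.sq_norm, Complex.normSq_mk]
  ring

theorem sum_fin_two_mul (f : Fin (2 * n) → ℝ) : ∑ k, f k =
    ∑ i : Fin n, (f ⟨2 * i.1, by have := i.isLt; omega⟩ +
      f ⟨2 * i.1 + 1, by have := i.isLt; omega⟩) := by
  rw [← (finProdFinEquiv.trans (finCongr (mul_comm n 2))).sum_comp, Fintype.sum_prod_type]
  refine Finset.sum_congr rfl fun i _ => ?_
  rw [Fin.sum_univ_two]
  congr 2 <;> ext <;> simp [finProdFinEquiv, add_comm]

theorem norm_toCn (z : R2n n) : ‖toCn n z‖ = ‖z‖ := by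
  rw [← sq_eq_sq₀ (norm_nonneg _) (norm_nonneg _), Cn.norm_sq, EuclideanSpace.norm_sq_eq,
    sum_fin_two_mul]
  refine Finset.sum_congr rfl fun i _ => ?_
  rw [norm_sq_toCn_apply]
  simp only [Real.norm_eq_abs, sq_abs]

/-- The identification of `ℝ^{2n}` with `ℂⁿ` as a linear isometry. -/
def isoCn (n : ℕ) : R2n n ≃ₗᵢ[ℝ] Cn n :=
  LinearIsometry.toLinearIsometryEquiv ⟨toCn n, norm_toCn⟩ (by
    rw [finrank_euclideanSpace_fin, ← Module.finrank_mul_finrank ℝ ℂ (Cn n),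
      finrank_euclideanSpace_fin, Complex.finrank_real_complex])

theorem isoCn_apply (z : R2n n) : isoCn n z = toCn n z := rfl

theorem ellForm_isoCn (a : Fin n → ℝ) (z : R2n n) : ellForm a (isoCn n z) = ellQ n a z := by
  rw [ellForm, Cn.quad, ellQ]
  refine Finset.sum_congr rfl fun i _ => ?_
  rw [isoCn_apply, norm_sq_toCn_apply, div_eq_inv_mul]

theorem symp_isoCn (v w : R2n n) : symp (isoCn n v) (isoCn n w) = sympForm n v w := by
  rw [symp, PiLp.inner_apply, sympForm]
  refine Finset.sum_congr rfl fun i _ => ?_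
  simp only [PiLp.smul_apply, isoCn_apply, toCn_apply, Complex.inner, smul_eq_mul, Complex.mul_re,
    Complex.conj_re, Complex.conj_im, Complex.mul_im, Complex.I_re, Complex.I_im]
  ring

theorem fderiv_conj_isoCn {φ : R2n n → R2n n} {z : Cn n}
    (hφ : DifferentiableAt ℝ φ ((isoCn n).symm z)) (v : Cn n) :
    fderiv ℝ (fun z => isoCn n (φ ((isoCn n).symm z))) z v =
      isoCn n (fderiv ℝ φ ((isoCn n).symm z) ((isoCn n).symm v)) := by
  have h1 := (hφ.hasFDerivAt).comp z (isoCn n).symm.toContinuousLinearEquiv.hasFDerivAt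
  have h2 := (isoCn n).toContinuousLinearEquiv.hasFDerivAt.comp z h1
  have h3 : HasFDerivAt (fun z => isoCn n (φ ((isoCn n).symm z))) _ z := h2
  rw [h3.fderiv]
  rfl

theorem isSymp_conj {N U : Set (R2n n)} {φ : R2n n → R2n n} (h : IsSympEmbOn n N U φ) :
    IsSymp (fun z => isoCn n (φ ((isoCn n).symm z))) ((isoCn n).symm ⁻¹' N) := by
  obtain ⟨hN, hφ, hinj, -, hsymp⟩ := h
  refine ⟨hN.preimage (isoCn n).symm.continuous, ?_, ?_, ?_⟩
  · exact (isoCn n).contDiff.comp_contDiffOn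
      (hφ.comp (isoCn n).symm.contDiff.contDiffOn fun z hz => hz)
  · exact fun z hz w hw hzw => (isoCn n).symm.injective (hinj hz hw ((isoCn n).injective hzw))
  · intro p hp v w
    have hd : DifferentiableAt ℝ φ ((isoCn n).symm p) :=
      (hφ.contDiffAt (hN.mem_nhds hp)).differentiableAt (by simp)
    rw [fderiv_conj_isoCn hd, fderiv_conj_isoCn hd, symp_isoCn, hsymp _ hp, ← symp_isoCn,
      LinearIsometryEquiv.apply_symm_apply, LinearIsometryEquiv.apply_symm_apply]

theorem isSympEmbOn_id {U : Set (R2n n)} (hU : IsOpen U) : IsSympEmbOn n U U id :=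
  ⟨hU, contDiff_id.contDiffOn, injOn_id U, mapsTo_id U, fun p _ v w => by
    rw [fderiv_id]; rfl⟩

end Transfer

/-- Theorem 5 (comparison result): the boundary of an ellipsoid with two different
symplectic half axes has an open neighbourhood `U ⊆ ℝ^(2n)` with `s(U) < e(U)`. -/
theorem spherical_lt_ellipsoidal_capacity
    (n : ℕ) (hn : 2 ≤ n) (a : Fin n → ℝ)
    (hpos : ∀ i, 0 < a i) (hmono : Monotone a)
    (hdiff : ∃ i j, a i ≠ a j) :
    ∃ U : Set (R2n n), IsOpen U ∧ ellipsoidBdry n a ⊆ U ∧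
      sphericalCap n U < ellipsoidalCap n U := by
  have hn0 : 0 < n := by omega
  let i₀ : Fin n := ⟨0, hn0⟩
  have hmin : ∀ i, a i₀ ≤ a i := fun i => hmono (Fin.mk_le_mk.2 (Nat.zero_le i.1))
  obtain ⟨j, hj⟩ : ∃ j, a i₀ < a j := by
    by_contra! hle
    obtain ⟨i, j, hij⟩ := hdiff
    exact hij (((hle i).antisymm (hmin i)).trans ((hle j).antisymm (hmin j)).symm)
  obtain ⟨ε, hε, -, h⟩ := exists_sq_radius_le hn (hpos i₀) hmin hj
  let U : Set (R2n n) := ellQ n a ⁻¹' Ioo (1 - ε) (1 + ε)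
  have hcont : Continuous (ellQ n a) :=
    (continuous_ellForm.comp (isoCn n).continuous).congr (ellForm_isoCn a)
  have hU : IsOpen U := isOpen_Ioo.preimage hcont
  have hsub : ellipsoidBdry n a ⊆ U := fun z hz => by
    have hz' : ellQ n a z = 1 := hz
    change 1 - ε < ellQ n a z ∧ ellQ n a z < 1 + ε
    constructor <;> linarith
  refine ⟨U, hU, hsub, ?_⟩
  have ha : 0 < a i₀ ^ 2 := pow_pos (hpos i₀) 2
  have hs : sphericalCap n U ≤ ENNReal.ofReal (π * (a i₀ ^ 2 / 2)) := by
    refine sSup_le ?_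
    rintro _ ⟨r, hr, rfl, N, φ, hSN, hφ⟩
    refine ENNReal.ofReal_le_ofReal (mul_le_mul_of_nonneg_left ?_ pi_pos.le)
    refine h r _ _ hr (isSymp_conj hφ) (fun z hz => hSN ?_) fun z hz => ?_
    · rw [mem_sphere_zero_iff_norm] at hz ⊢
      rw [LinearIsometryEquiv.norm_map, hz]
    · rw [mem_preimage, ellForm_isoCn]
      exact hφ.2.2.2.1 hz
  have he : ENNReal.ofReal (π * a i₀ ^ 2) ≤ ellipsoidalCap n U := by
    refine le_sSup ⟨a, hpos, hmono, ?_, U, id, hsub, isSympEmbOn_id hU⟩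
    have : Nonempty (Fin n) := ⟨i₀⟩
    have hinf : ⨅ i, a i = a i₀ :=
      le_antisymm (ciInf_le (finite_range a).bddBelow i₀) (le_ciInf hmin)
    rw [hinf]
  refine hs.trans_lt (lt_of_lt_of_le ?_ he)
  rw [ENNReal.ofReal_lt_ofReal_iff (by positivity)]
  gcongr
  linarith
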